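/- Under the assumption that Γ = {x ∈ ∂Ω : e₃·n(x) = 0} is a smooth closed one-dimensional submanifold of ∂Ω on which e₃·n vanishes linearly, there exist δ₀ > 0, C > 0, α > 0 and h₀ > 0 such that for all h ∈ (0,h₀), all δ ∈ (0,δ₀), and all eigenpairs (λ,ψ) of the magnetic Neumann Laplacian L_h with λ ≤ Θ₀ h + C h^{4/3}, one has ∫_{Ω_δ} exp(2α·dist(p(x),Γ)/h^{1/4}) |ψ(x)|² dx ≤ C ‖ψ‖², where Ω_δ = {x ∈ Ω : dist(x,∂Ω) < δ} and p(x) ∈ ∂Ω is the nearest-point projection of x onto ∂Ω. -/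

import Mathlib

noncomputable section

open MeasureTheory Filter Topology Asymptotics

abbrev E3 := EuclideanSpace ℝ (Fin 3)

/-- `j`-th component of the magnetic gradient `(-i h ∇ - A) ψ`. -/
def magD (A : E3 → E3) (h : ℝ) (ψ : E3 → ℂ) (j : Fin 3) (x : E3) : ℂ :=
  -(Complex.I * h) * fderiv ℝ ψ x (EuclideanSpace.single j 1) - (A x j : ℂ) * ψ x

/-- Magnetic quadratic form (energy) on a set `Ω`. -/
def magEnergy (Ω : Set E3) (A : E3 → E3) (h : ℝ) (ψ : E3 → ℂ) : ℝ :=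
  ∫ x in Ω, ∑ j : Fin 3, ‖magD A h ψ j x‖ ^ 2

def l2sq (Ω : Set E3) (ψ : E3 → ℂ) : ℝ := ∫ x in Ω, ‖ψ x‖ ^ 2

/-- Sesquilinear magnetic form. -/
def magFormC (Ω : Set E3) (A : E3 → E3) (h : ℝ) (ψ φ : E3 → ℂ) : ℂ :=
  ∫ x in Ω, ∑ j : Fin 3, magD A h ψ j x * starRingEnd ℂ (magD A h φ j x)

def l2ipC (Ω : Set E3) (ψ φ : E3 → ℂ) : ℂ :=
  ∫ x in Ω, ψ x * starRingEnd ℂ (φ x)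

/-- `curl A = e₃`. -/
def HasUnitCurl (A : E3 → E3) : Prop :=
  ∀ x : E3,
    fderiv ℝ (fun y => A y 2) x (EuclideanSpace.single 1 1)
      - fderiv ℝ (fun y => A y 1) x (EuclideanSpace.single 2 1) = 0 ∧
    fderiv ℝ (fun y => A y 0) x (EuclideanSpace.single 2 1)
      - fderiv ℝ (fun y => A y 2) x (EuclideanSpace.single 0 1) = 0 ∧
    fderiv ℝ (fun y => A y 1) x (EuclideanSpace.single 0 1)
      - fderiv ℝ (fun y => A y 0) x (EuclideanSpace.single 1 1) = 1

/-- Form domain: smooth up to the boundary, Dirichlet condition on `D`. -/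
def InFormDomain (Ω D : Set E3) (ψ : E3 → ℂ) : Prop :=
  ContDiffOn ℝ (⊤ : ℕ∞) ψ (closure Ω) ∧ ∀ x ∈ D, ψ x = 0

/-- `n`-th min-max level (`n ≥ 1`) of the magnetic quadratic form, with the natural
(Neumann) condition on `∂Ω \ D` and Dirichlet condition on `D`. -/
def nthEV (Ω D : Set E3) (A : E3 → E3) (h : ℝ) (n : ℕ) : ℝ :=
  sInf { μ : ℝ | ∃ V : Submodule ℂ (E3 → ℂ), Module.finrank ℂ V = n ∧
    (∀ ψ ∈ V, InFormDomain Ω D ψ) ∧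
    μ = sSup ((fun ψ => magEnergy Ω A h ψ / l2sq Ω ψ) '' {ψ : E3 → ℂ | ψ ∈ V ∧ ψ ≠ 0}) }

/-- Weak eigenpair for the magnetic Laplacian with Dirichlet condition on `D` and
(natural) magnetic Neumann condition on the rest of the boundary. -/
def IsMagEigenpair (Ω D : Set E3) (A : E3 → E3) (h lam : ℝ) (ψ : E3 → ℂ) : Prop :=
  ψ ≠ 0 ∧ InFormDomain Ω D ψ ∧
  ∀ φ : E3 → ℂ, InFormDomain Ω D φ →
    magFormC Ω A h ψ φ = (lam : ℂ) * l2ipC Ω ψ φ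

/-- Lowest eigenvalue of the de Gennes operator (Neumann realization of
`-∂_t² + (ξ - t)²` on `L²(ℝ₊)`), defined through its quadratic form. -/
def deGennes (ξ : ℝ) : ℝ :=
  sInf { μ : ℝ | ∃ u : ℝ → ℝ, ContDiff ℝ (⊤ : ℕ∞) u ∧ HasCompactSupport u ∧
    (∫ t in Set.Ioi (0:ℝ), u t ^ 2) = 1 ∧
    μ = ∫ t in Set.Ioi (0:ℝ), (deriv u t ^ 2 + (ξ - t) ^ 2 * u t ^ 2) }

def Theta0 : ℝ := sInf (Set.range deGennes)

/-- Lowest eigenvalue of the Montgomery operator `-∂_t² + (ξ - t²/2)²` on `L²(ℝ)`. -/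
def montgomery (ξ : ℝ) : ℝ :=
  sInf { μ : ℝ | ∃ u : ℝ → ℝ, ContDiff ℝ (⊤ : ℕ∞) u ∧ HasCompactSupport u ∧
    (∫ t : ℝ, u t ^ 2) = 1 ∧
    μ = ∫ t : ℝ, (deriv u t ^ 2 + (ξ - t ^ 2 / 2) ^ 2 * u t ^ 2) }

def Theta0M : ℝ := sInf (Set.range montgomery)

/-- `Ω` is a sublevel set of a smooth function with nonvanishing gradient on `∂Ω`. -/
def HasSmoothBoundary (Ω : Set E3) : Prop :=
  ∃ f : E3 → ℝ, ContDiff ℝ (⊤ : ℕ∞) f ∧ Ω = f ⁻¹' Set.Iio 0 ∧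
    ∀ x ∈ frontier Ω, gradient f x ≠ 0

/-- `n` is the outward unit normal field of `Ω` along `∂Ω`. -/
def IsOutwardNormal (Ω : Set E3) (n : E3 → E3) : Prop :=
  ∃ f : E3 → ℝ, ContDiff ℝ (⊤ : ℕ∞) f ∧ Ω = f ⁻¹' Set.Iio 0 ∧
    (∀ x ∈ frontier Ω, gradient f x ≠ 0) ∧
    ∀ x ∈ frontier Ω, n x = ‖gradient f x‖⁻¹ • gradient f x

/-- The function `∂Ω ∋ x ↦ e₃ · n(x)` vanishes (exactly) linearly on `Γ`. -/
def VanishesLinearlyOn (Ω Γ : Set E3) (n : E3 → E3) : Prop :=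
  ∃ c > 0, ∀ x ∈ frontier Ω, c * Metric.infDist x Γ ≤ |n x 2|

namespace MagAux

lemma deGennes_nonneg (ξ : ℝ) : 0 ≤ deGennes ξ := by
  apply Real.sInf_nonneg
  rintro μ ⟨u, -, -, -, rfl⟩
  exact integral_nonneg fun t => by positivity

lemma theta0_nonneg : 0 ≤ Theta0 := by
  apply Real.sInf_nonneg
  rintro _ ⟨ξ, rfl⟩
  exact deGennes_nonneg ξ

lemma theta0_le (ξ : ℝ) : Theta0 ≤ deGennes ξ :=
  csInf_le ⟨0, by rintro _ ⟨ξ, rfl⟩; exact deGennes_nonneg ξ⟩ ⟨ξ, rfl⟩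

/-- Quadratic form of de Gennes operator on `(a, ∞)`. -/
def qG (a ξ : ℝ) (u : ℝ → ℝ) : ℝ :=
  ∫ t in Set.Ioi a, (deriv u t ^ 2 + (ξ - t) ^ 2 * u t ^ 2)

def mG (a : ℝ) (u : ℝ → ℝ) : ℝ := ∫ t in Set.Ioi a, u t ^ 2

lemma mG_nonneg (a u) : 0 ≤ mG a u := integral_nonneg fun t => by positivity
lemma qG_nonneg (a ξ u) : 0 ≤ qG a ξ u := integral_nonneg fun t => by positivity

lemma BI0 (ξ : ℝ) (u : ℝ → ℝ) (hu : ContDiff ℝ (⊤ : ℕ∞) u) (hc : HasCompactSupport u) :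
    Theta0 * mG 0 u ≤ qG 0 ξ u := by
  rcases (mG_nonneg 0 u).eq_or_lt with h | h
  · rw [← h, mul_zero]; exact qG_nonneg _ _ _
  · set m := mG 0 u with hm
    have hs : 0 < Real.sqrt m := Real.sqrt_pos.2 h
    have h2 : (Real.sqrt m)⁻¹ ^ 2 = m⁻¹ := by rw [inv_pow, Real.sq_sqrt h.le]
    have key : deGennes ξ ≤ m⁻¹ * qG 0 ξ u := by
      apply csInf_le
      · exact ⟨0, by rintro μ ⟨u, -, -, -, rfl⟩; exact integral_nonneg fun t => by positivity⟩
      · refine ⟨fun t => (Real.sqrt m)⁻¹ * u t, contDiff_const.mul hu, hc.mul_left, ?_, ?_⟩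
        · simp_rw [mul_pow, h2]
          rw [integral_const_mul]
          exact inv_mul_cancel₀ h.ne'
        · rw [qG, ← integral_const_mul]
          congr 1; ext t
          have : deriv (fun t => (Real.sqrt m)⁻¹ * u t) t = (Real.sqrt m)⁻¹ * deriv u t := by
            rw [deriv_const_mul]; exact (hu.differentiable (by simp)).differentiableAt
          rw [this, mul_pow, mul_pow, h2]; ring
    have := (theta0_le ξ).trans key
    calc Theta0 * m ≤ m⁻¹ * qG 0 ξ u * m := by gcongr
      _ = _ := by field_simp

lemma ioi_shift (F : ℝ → ℝ) (a : ℝ) :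
    ∫ t in Set.Ioi (0:ℝ), F (t + a) = ∫ t in Set.Ioi a, F t := by
  have := (measurePreserving_add_right (volume : Measure ℝ) a).setIntegral_preimage_emb
    (measurableEmbedding_addRight a) F (Set.Ioi a)
  rw [← this]; simp

lemma BIa (a ξ : ℝ) (u : ℝ → ℝ) (hu : ContDiff ℝ (⊤ : ℕ∞) u) (hc : HasCompactSupport u) :
    Theta0 * mG a u ≤ qG a ξ u := by
  have h := BI0 (ξ - a) (fun t => u (t + a)) (hu.comp (contDiff_id.add contDiff_const))
    (hc.comp_homeomorph (Homeomorph.addRight a))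
  have e1 : mG 0 (fun t => u (t + a)) = mG a u := by
    have := ioi_shift (fun t => u t ^ 2) a
    simpa [mG] using this
  have e2 : qG 0 (ξ - a) (fun t => u (t + a)) = qG a ξ u := by
    have := ioi_shift (fun t => deriv u t ^ 2 + (ξ - t) ^ 2 * u t ^ 2) a
    rw [qG, qG, ← this]
    congr 1; ext t
    rw [deriv_comp_add_const]; ring
  rwa [e1, e2] at h


lemma int_u2 {u : ℝ → ℝ} (hu : ContDiff ℝ (⊤ : ℕ∞) u)
    (hc : HasCompactSupport u) (g : ℝ → ℝ) (hg : Continuous g) : Integrable (fun t => g t * u t ^ 2) :=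
  (hg.mul (hu.continuous.pow 2)).integrable_of_hasCompactSupport
    (HasCompactSupport.mul_left (by
      rw [pow_two]; exact hc.mul_left))

lemma int_du2 {u : ℝ → ℝ} (hu : ContDiff ℝ (⊤ : ℕ∞) u)
    (hc : HasCompactSupport u) (g : ℝ → ℝ) (hg : Continuous g) : Integrable (fun t => g t * deriv u t ^ 2) :=
  (hg.mul ((hu.continuous_deriv (by simp)).pow 2)).integrable_of_hasCompactSupport
    (HasCompactSupport.mul_left (by
      rw [pow_two]; exact hc.deriv.mul_left))

lemma int_udu {u : ℝ → ℝ} (hu : ContDiff ℝ (⊤ : ℕ∞) u)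
    (hc : HasCompactSupport u) (g : ℝ → ℝ) (hg : Continuous g) : Integrable (fun t => g t * (u t * deriv u t)) :=
  (hg.mul (hu.continuous.mul (hu.continuous_deriv (by simp)))).integrable_of_hasCompactSupport
    (HasCompactSupport.mul_left hc.deriv.mul_left)

lemma hda {u : ℝ → ℝ} (hu : ContDiff ℝ (⊤ : ℕ∞) u)
    (_hc : HasCompactSupport u) (t : ℝ) : HasDerivAt u (deriv u t) t :=
  ((hu.differentiable (by simp)).differentiableAt).hasDerivAt

/-- Integration by parts against a linear weight. -/
lemma ibp_lin {u : ℝ → ℝ} (hu : ContDiff ℝ (⊤ : ℕ∞) u)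
    (hc : HasCompactSupport u) (ξ : ℝ) :
    ∫ t in Set.Ioi (0:ℝ), (u t ^ 2 + 2 * ((t - ξ) * (u t * deriv u t))) = ξ * u 0 ^ 2 := by
  have hd : ∀ t ∈ Set.Ici (0:ℝ), HasDerivAt (fun t => (t - ξ) * u t ^ 2)
      (u t ^ 2 + 2 * ((t - ξ) * (u t * deriv u t))) t := by
    intro t _
    have h0 : HasDerivAt (fun t => (t - ξ) * u t ^ 2) _ t :=
      ((hasDerivAt_id t).sub_const ξ).mul ((hda hu hc t).pow 2)
    refine h0.congr_deriv ?_
    simp; ring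
  have hi : IntegrableOn (fun t => u t ^ 2 + 2 * ((t - ξ) * (u t * deriv u t))) (Set.Ioi 0) := by
    apply Integrable.integrableOn
    have h1 := int_u2 hu hc (fun _ => 1) continuous_const
    have h2 := int_udu hu hc (fun t => 2 * (t - ξ)) (by fun_prop)
    refine (h1.add h2).congr (Eventually.of_forall fun t => ?_)
    simp; ring
  have ht : Tendsto (fun t => (t - ξ) * u t ^ 2) atTop (𝓝 0) := by
    have : HasCompactSupport (fun t => (t - ξ) * u t ^ 2) := HasCompactSupport.mul_left (by
      simp_rw [pow_two]; exact hc.mul_left)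
    exact this.is_zero_at_infty.mono_left (by rw [cocompact_eq_atBot_atTop]; exact le_sup_right)
  rw [integral_Ioi_of_hasDerivAt_of_tendsto' hd hi ht]; ring

lemma qG_eq {u : ℝ → ℝ} (hu : ContDiff ℝ (⊤ : ℕ∞) u)
    (hc : HasCompactSupport u) (ξ : ℝ) : qG 0 ξ u = (∫ t in Set.Ioi (0:ℝ), (deriv u t + (t - ξ) * u t) ^ 2)
    + mG 0 u - ξ * u 0 ^ 2 := by
  rw [← ibp_lin hu hc ξ, qG, mG]
  have i1 : Integrable (fun t => (deriv u t + (t - ξ) * u t) ^ 2) := by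
    have h1 := int_u2 hu hc (fun t => (t - ξ) ^ 2) (by fun_prop)
    have h2 := int_udu hu hc (fun t => 2 * (t - ξ)) (by fun_prop)
    have h3 := int_du2 hu hc (fun t => 1) (by fun_prop)
    refine ((h1.add h2).add h3).congr (Eventually.of_forall fun t => ?_)
    simp; ring
  have i2 : Integrable (fun t => u t ^ 2) := by
    simpa using int_u2 hu hc (fun _ => 1) continuous_const
  have i3 : Integrable (fun t => u t ^ 2 + 2 * ((t - ξ) * (u t * deriv u t))) := by
    have h2 := int_udu hu hc (fun t => 2 * (t - ξ)) (by fun_prop)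
    refine (i2.add h2).congr (Eventually.of_forall fun t => ?_)
    simp; ring
  have i12 : Integrable (fun t => (deriv u t + (t - ξ) * u t) ^ 2 + u t ^ 2) := i1.add i2
  rw [← integral_add i1.integrableOn i2.integrableOn,
    ← integral_sub i12.integrableOn i3.integrableOn]
  congr 1; ext t; ring

lemma qG_split {u : ℝ → ℝ} (hu : ContDiff ℝ (⊤ : ℕ∞) u)
    (hc : HasCompactSupport u) (a b ξ : ℝ) : qG a ξ u = qG b ξ u +
    ∫ t in a..b, (deriv u t ^ 2 + (ξ - t) ^ 2 * u t ^ 2) := by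
  have i : Integrable (fun t => deriv u t ^ 2 + (ξ - t) ^ 2 * u t ^ 2) := by
    have h1 := int_u2 hu hc (fun t => (ξ - t) ^ 2) (by fun_prop)
    have h3 := int_du2 hu hc (fun t => 1) (by fun_prop)
    refine (h3.add h1).congr (Eventually.of_forall fun t => ?_)
    simp
  have := intervalIntegral.integral_interval_add_Ioi (a := a) (b := b) i.integrableOn i.integrableOn
  rw [qG, qG, ← this]; ring

lemma mG_split {u : ℝ → ℝ} (hu : ContDiff ℝ (⊤ : ℕ∞) u)
    (hc : HasCompactSupport u) (a b : ℝ) : mG a u = mG b u + ∫ t in a..b, u t ^ 2 := by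
  have i : Integrable (fun t => u t ^ 2) := by
    simpa using int_u2 hu hc (fun _ => 1) continuous_const
  have := intervalIntegral.integral_interval_add_Ioi (a := a) (b := b) i.integrableOn i.integrableOn
  rw [mG, mG, ← this]; ring

end MagAux

namespace MagAux

lemma theta0_lt_one : Theta0 < 1 := by
  by_contra hcon
  push Not at hcon
  let χ : ContDiffBump (0:ℝ) := ⟨1, 2, by norm_num, by norm_num⟩
  have hχd : ContDiff ℝ (⊤ : ℕ∞) (χ : ℝ → ℝ) := χ.contDiff
  have hχc : HasCompactSupport (χ : ℝ → ℝ) := χ.hasCompactSupport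
  obtain ⟨M, hM⟩ := hχc.deriv.exists_bound_of_continuous (hχd.continuous_deriv (by simp))
  let g : ℝ → ℝ := fun t => Real.exp (-(t - 1) ^ 2 / 2)
  have hg : ContDiff ℝ (⊤ : ℕ∞) g := by fun_prop
  have hgi : Integrable (fun t => g t ^ 2) := by
    have h0 := (integrable_exp_neg_mul_sq (b := 1) one_pos).comp_sub_right 1
    refine h0.congr (Eventually.of_forall fun t => ?_)
    simp only [g]
    rw [← Real.exp_nat_mul]; congr 1; push_cast; ring
  set G := ∫ t, g t ^ 2 with hG
  have key : ∀ R : ℝ, 0 < R → Real.exp (-1) ≤ (M / R) ^ 2 * G := by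
    intro R hR
    let u : ℝ → ℝ := fun t => χ (R⁻¹ * t) * g t
    have hu : ContDiff ℝ (⊤ : ℕ∞) u :=
      (hχd.comp (contDiff_const.mul contDiff_id)).mul hg
    have hc : HasCompactSupport u :=
      (hχc.comp_homeomorph (Homeomorph.mulLeft₀ R⁻¹ (inv_pos.2 hR).ne')).mul_right
    have h1 := BI0 1 u hu hc
    rw [qG_eq hu hc] at h1
    have hu0 : u 0 ^ 2 = Real.exp (-1) := by
      have : χ (0:ℝ) = 1 := χ.one_of_mem_closedBall (by simp [χ])
      simp only [u, g, mul_zero, this, one_mul]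
      rw [← Real.exp_nat_mul]; congr 1; norm_num
    have h2 : ∫ t in Set.Ioi (0:ℝ), (deriv u t + (t - 1) * u t) ^ 2 ≤ (M / R) ^ 2 * G := by
      have hd : ∀ t, deriv u t + (t - 1) * u t = R⁻¹ * deriv χ (R⁻¹ * t) * g t := by
        intro t
        have d1 : HasDerivAt (fun t => χ (R⁻¹ * t)) (deriv χ (R⁻¹ * t) * R⁻¹) t := by
          have a1 : HasDerivAt (fun t : ℝ => R⁻¹ * t) R⁻¹ t := by
            simpa using (hasDerivAt_id t).const_mul R⁻¹
          exact ((hχd.differentiable (by simp)).differentiableAt.hasDerivAt).comp t a1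
        have d2 : HasDerivAt g (g t * (-(t - 1))) t := by
          have a1 : HasDerivAt (fun t : ℝ => -(t - 1) ^ 2 / 2) (-(t - 1)) t := by
            have a2 : HasDerivAt (fun t : ℝ => -(t - 1) ^ 2 / 2) _ t :=
              ((((hasDerivAt_id t).sub_const 1).pow 2).neg).div_const 2
            refine a2.congr_deriv ?_
            simp; ring
          exact a1.exp
        have d3 : HasDerivAt u _ t := d1.mul d2
        rw [d3.deriv]; simp only [u]; ring
      simp_rw [hd]
      rw [hG, ← integral_const_mul]
      have hMi : ∀ t, (R⁻¹ * deriv χ (R⁻¹ * t) * g t) ^ 2 ≤ (M / R) ^ 2 * g t ^ 2 := by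
        intro t
        rw [mul_pow]
        refine mul_le_mul_of_nonneg_right ?_ (sq_nonneg _)
        rw [div_eq_inv_mul, mul_pow, mul_pow]
        refine mul_le_mul_of_nonneg_left ?_ (sq_nonneg _)
        have := hM (R⁻¹ * t)
        rw [Real.norm_eq_abs] at this
        exact sq_le_sq' (by linarith [neg_abs_le (deriv χ (R⁻¹ * t))]) ((le_abs_self _).trans this)
      calc _ ≤ ∫ t in Set.Ioi (0:ℝ), (M / R) ^ 2 * g t ^ 2 := by
            apply integral_mono_of_nonneg (Eventually.of_forall fun t => by positivity)
              (hgi.const_mul _).integrableOn (Eventually.of_forall hMi)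
        _ ≤ _ := setIntegral_le_integral (hgi.const_mul _)
              (Eventually.of_forall fun t => by positivity)
    have h3 : mG 0 u ≤ Theta0 * mG 0 u := le_mul_of_one_le_left (mG_nonneg _ _) hcon
    rw [hu0] at h1
    linarith
  have hlim : Tendsto (fun R : ℝ => (M / R) ^ 2 * G) atTop (𝓝 ((0:ℝ) ^ 2 * G)) :=
    ((tendsto_const_nhds.div_atTop tendsto_id).pow 2).mul_const G
  have := ge_of_tendsto hlim ((eventually_gt_atTop 0).mono key)
  have h2 := Real.exp_pos (-1)
  simp at this
  linarith

lemma smoothTransition_deriv_bound : ∃ M : ℝ, 0 ≤ M ∧ (∀ x, |deriv Real.smoothTransition x| ≤ M) ∧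
    ∀ x < 0, deriv Real.smoothTransition x = 0 := by
  have hS : ContDiff ℝ (⊤ : ℕ∞) Real.smoothTransition := Real.smoothTransition.contDiff
  have h0 : ∀ x < 0, deriv Real.smoothTransition x = 0 := by
    intro x hx
    have : Real.smoothTransition =ᶠ[𝓝 x] fun _ => 0 := by
      filter_upwards [Iio_mem_nhds hx] with y hy
      exact Real.smoothTransition.zero_of_nonpos (le_of_lt hy)
    rw [this.deriv_eq]; simp
  have h1 : ∀ x > 1, deriv Real.smoothTransition x = 0 := by
    intro x hx
    have : Real.smoothTransition =ᶠ[𝓝 x] fun _ => 1 := by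
      filter_upwards [Ioi_mem_nhds hx] with y hy
      exact Real.smoothTransition.one_of_one_le (le_of_lt hy)
    rw [this.deriv_eq]; simp
  have hc : HasCompactSupport (deriv Real.smoothTransition) := by
    apply HasCompactSupport.intro (isCompact_Icc (a := (0:ℝ)) (b := 1))
    intro x hx
    rw [Set.mem_Icc, not_and_or, not_le, not_le] at hx
    exact hx.elim (h0 x) (h1 x)
  obtain ⟨M, hM⟩ := hc.exists_bound_of_continuous (hS.continuous_deriv (by simp))
  exact ⟨M, (norm_nonneg _).trans (hM 0), hM, h0⟩

lemma ext_lemma {u : ℝ → ℝ} (hu : ContDiff ℝ (⊤ : ℕ∞) u)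
    (hc : HasCompactSupport u) (ξ b : ℝ) (hb : 0 < b) :
    Theta0 * (mG 0 u + b * u 0 ^ 2) ≤ qG 0 ξ u + u 0 ^ 2 * ∫ s in (0:ℝ)..b, (ξ + s) ^ 2 := by
  obtain ⟨M', hM'0, hM', hM'z⟩ := smoothTransition_deriv_bound
  obtain ⟨M1, hM1⟩ := hc.exists_bound_of_continuous hu.continuous
  obtain ⟨M2, hM2⟩ := hc.deriv.exists_bound_of_continuous (hu.continuous_deriv (by simp))
  have hM10 : 0 ≤ M1 := (norm_nonneg _).trans (hM1 0)
  have hM20 : 0 ≤ M2 := (norm_nonneg _).trans (hM2 0)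
  have hS : ContDiff ℝ (⊤ : ℕ∞) Real.smoothTransition := Real.smoothTransition.contDiff
  let σ : ℕ → ℝ → ℝ := fun k t => Real.smoothTransition (1 + (k + 1) * t)
  let w : ℕ → ℝ → ℝ := fun k t => u 0 + σ k t * (u t - u 0)
  let θ : ℝ → ℝ := fun t => Real.smoothTransition (t + b + 1)
  let v : ℕ → ℝ → ℝ := fun k t => θ t * w k t
  have hσ : ∀ k, ContDiff ℝ (⊤ : ℕ∞) (σ k) := fun k =>
    hS.comp (contDiff_const.add (contDiff_const.mul contDiff_id))
  have hw : ∀ k, ContDiff ℝ (⊤ : ℕ∞) (w k) := fun k =>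
    contDiff_const.add ((hσ k).mul (hu.sub contDiff_const))
  have hθ : ContDiff ℝ (⊤ : ℕ∞) θ := hS.comp ((contDiff_id.add contDiff_const).add contDiff_const)
  have hv : ∀ k, ContDiff ℝ (⊤ : ℕ∞) (v k) := fun k => hθ.mul (hw k)
  have hv_pos : ∀ k, ∀ t, 0 ≤ t → v k t = u t := by
    intro k t ht
    have h1 : θ t = 1 := Real.smoothTransition.one_of_one_le (by linarith)
    have h2 : σ k t = 1 := Real.smoothTransition.one_of_one_le (by
      have : 0 ≤ ((k:ℝ) + 1) * t := by positivity
      linarith)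
    simp only [v, w, h1, h2]; ring
  have hvc : ∀ k, HasCompactSupport (v k) := by
    intro k
    obtain ⟨T, hT⟩ : ∃ T, ∀ t, T < t → u t = 0 := by
      obtain ⟨T, hT⟩ := hc.isCompact.bddAbove
      refine ⟨T, fun t ht => ?_⟩
      by_contra hne
      exact absurd (hT (subset_tsupport _ hne)) (not_le.2 ht)
    apply HasCompactSupport.intro (isCompact_Icc (a := -b - 1) (b := max T 0))
    intro t ht
    rw [Set.mem_Icc, not_and_or, not_le, not_le] at ht
    rcases ht with ht | ht
    · have : θ t = 0 := Real.smoothTransition.zero_of_nonpos (by linarith)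
      simp [v, this]
    · rw [hv_pos k t ((le_max_right _ _).trans ht.le)]
      exact hT t ((le_max_left _ _).trans_lt ht)
  have hv_mid : ∀ k, ∀ t, -b < t → v k =ᶠ[𝓝 t] w k := by
    intro k t ht
    filter_upwards [Ioi_mem_nhds ht] with s hs
    have h1 : θ s = 1 := Real.smoothTransition.one_of_one_le (by
      have : -b < s := hs
      linarith)
    simp [v, h1]
  have hwd : ∀ k t, HasDerivAt (w k) (deriv Real.smoothTransition (1 + (k + 1) * t) * (k + 1) *
      (u t - u 0) + σ k t * deriv u t) t := by
    intro k t
    have a1 : HasDerivAt (fun t : ℝ => 1 + ((k:ℝ) + 1) * t) ((k:ℝ) + 1) t := by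
      simpa using ((hasDerivAt_id t).const_mul ((k:ℝ) + 1)).const_add 1
    have a2 : HasDerivAt (σ k) _ t :=
      ((hS.differentiable (by simp)).differentiableAt.hasDerivAt).comp t a1
    exact (a2.mul ((hda hu hc t).sub_const (u 0))).const_add (u 0)
  have hwz : ∀ t < 0, ∀ᶠ k in atTop, w k t = u 0 ∧ deriv (w k) t = 0 := by
    intro t ht
    obtain ⟨N, hN⟩ := exists_nat_gt (-t)⁻¹
    filter_upwards [eventually_ge_atTop N] with k hk
    have hk' : (N:ℝ) ≤ k := by exact_mod_cast hk
    have h1 : 1 + ((k:ℝ) + 1) * t < 0 := by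
      have h3 : 1 < N * (-t) := by
        rw [inv_lt_iff_one_lt_mul₀ (by linarith)] at hN; linarith
      nlinarith
    have h2 : σ k t = 0 := Real.smoothTransition.zero_of_nonpos h1.le
    refine ⟨by simp [w, h2], ?_⟩
    rw [(hwd k t).deriv, hM'z _ h1, h2]; ring
  have hσ1 : ∀ k t, |σ k t| ≤ 1 := fun k t => by
    rw [abs_of_nonneg (Real.smoothTransition.nonneg _)]; exact Real.smoothTransition.le_one _
  have hwb : ∀ k t, |w k t| ≤ 3 * M1 := by
    intro k t
    have h1 := hM1 t; have h2 := hM1 0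
    rw [Real.norm_eq_abs] at h1 h2
    calc |w k t| ≤ |u 0| + |σ k t| * |u t - u 0| := by
          rw [← abs_mul]; exact abs_add_le _ _
      _ ≤ M1 + 1 * (M1 + M1) := by
          gcongr
          · exact hσ1 k t
          · exact (abs_sub _ _).trans (add_le_add h1 h2)
      _ = _ := by ring
  have hwdb : ∀ k, ∀ t ≤ 0, |deriv (w k) t| ≤ M' * M2 + M2 := by
    intro k t ht
    rw [(hwd k t).deriv]
    have h2 : |σ k t * deriv u t| ≤ M2 := by
      rw [abs_mul]
      calc _ ≤ 1 * M2 := by gcongr; exacts [hσ1 k t, hM2 t]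
        _ = _ := one_mul _
    have h3 : |u t - u 0| ≤ M2 * |t| := by
      have := (convex_univ (𝕜 := ℝ) (E := ℝ)).norm_image_sub_le_of_norm_deriv_le
        (f := u) (C := M2) (x := 0) (y := t)
        (fun x _ => (hda hu hc x).differentiableAt) (fun x _ => hM2 x) trivial trivial
      simpa using this
    have h1 : |deriv Real.smoothTransition (1 + (k + 1) * t) * (k + 1) * (u t - u 0)|
        ≤ M' * M2 := by
      by_cases hneg : 1 + ((k:ℝ) + 1) * t < 0
      · rw [hM'z _ hneg]; simp; positivity
      · push Not at hneg
        rw [mul_assoc, abs_mul]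
        gcongr
        · exact hM' _
        · rw [abs_mul, abs_of_pos (by positivity : (0:ℝ) < k + 1)]
          calc ((k:ℝ) + 1) * |u t - u 0| ≤ (k + 1) * (M2 * |t|) := by gcongr
            _ = ((k + 1) * |t|) * M2 := by ring
            _ ≤ 1 * M2 := by
              gcongr
              rw [abs_of_nonpos ht]; linarith
            _ = M2 := one_mul _
    exact (abs_add_le _ _).trans (add_le_add h1 h2)
  have ineq : ∀ k, Theta0 * (mG 0 u + ∫ t in (-b)..0, w k t ^ 2) ≤
      qG 0 ξ u + ∫ t in (-b)..0, (deriv (w k) t ^ 2 + (ξ - t) ^ 2 * w k t ^ 2) := by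
    intro k
    have h := BIa (-b) ξ (v k) (hv k) (hvc k)
    rw [mG_split (hv k) (hvc k) (-b) 0, qG_split (hv k) (hvc k) (-b) 0] at h
    have e1 : mG 0 (v k) = mG 0 u := by
      apply setIntegral_congr_fun measurableSet_Ioi
      intro t ht; simp only; rw [hv_pos k t (le_of_lt ht)]
    have e2 : qG 0 ξ (v k) = qG 0 ξ u := by
      apply setIntegral_congr_fun measurableSet_Ioi
      intro t ht
      have : v k =ᶠ[𝓝 t] u := by
        filter_upwards [Ioi_mem_nhds ht] with s hs using hv_pos k s (le_of_lt hs)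
      simp only; rw [hv_pos k t (le_of_lt ht), this.deriv_eq]
    have e3 : ∫ t in (-b)..0, v k t ^ 2 = ∫ t in (-b)..0, w k t ^ 2 := by
      apply intervalIntegral.integral_congr_ae
      refine Eventually.of_forall fun t ht => ?_
      rw [Set.uIoc_of_le (by linarith)] at ht
      rw [(hv_mid k t ht.1).eq_of_nhds]
    have e4 : ∫ t in (-b)..0, (deriv (v k) t ^ 2 + (ξ - t) ^ 2 * v k t ^ 2) =
        ∫ t in (-b)..0, (deriv (w k) t ^ 2 + (ξ - t) ^ 2 * w k t ^ 2) := by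
      apply intervalIntegral.integral_congr_ae
      refine Eventually.of_forall fun t ht => ?_
      rw [Set.uIoc_of_le (by linarith)] at ht
      rw [(hv_mid k t ht.1).eq_of_nhds, (hv_mid k t ht.1).deriv_eq]
    rwa [e1, e2, e3, e4] at h
  have aene : ∀ᵐ t : ℝ, t ≠ 0 := by
    simp [ae_iff]
  have lim1 : Tendsto (fun k => ∫ t in (-b)..0, w k t ^ 2) atTop
      (𝓝 (∫ t in (-b)..0, u 0 ^ 2)) := by
    apply intervalIntegral.tendsto_integral_filter_of_dominated_convergence (fun _ => (3 * M1) ^ 2)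
    · exact Eventually.of_forall fun k => ((hw k).continuous.pow 2).aestronglyMeasurable
    · refine Eventually.of_forall fun k => Eventually.of_forall fun t _ => ?_
      rw [norm_pow]; gcongr; exact hwb k t
    · exact intervalIntegrable_const
    · filter_upwards [aene] with t hne ht
      rw [Set.uIoc_of_le (by linarith)] at ht
      apply tendsto_const_nhds.congr'
      filter_upwards [hwz t (lt_of_le_of_ne ht.2 hne)] with k hk
      rw [hk.1]
  have lim2 : Tendsto (fun k => ∫ t in (-b)..0, (deriv (w k) t ^ 2 + (ξ - t) ^ 2 * w k t ^ 2)) atTop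
      (𝓝 (∫ t in (-b)..0, (ξ - t) ^ 2 * u 0 ^ 2)) := by
    apply intervalIntegral.tendsto_integral_filter_of_dominated_convergence
      (fun t => (M' * M2 + M2) ^ 2 + (ξ - t) ^ 2 * (3 * M1) ^ 2)
    · refine Eventually.of_forall fun k => Continuous.aestronglyMeasurable ?_
      have := (hw k).continuous_deriv (by simp)
      have := (hw k).continuous
      fun_prop
    · refine Eventually.of_forall fun k => Eventually.of_forall fun t ht => ?_
      rw [Set.uIoc_of_le (by linarith)] at ht
      rw [Real.norm_eq_abs, abs_of_nonneg (by positivity)]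
      have h1 := hwdb k t ht.2
      have h2 := hwb k t
      rw [← sq_abs (deriv (w k) t), ← sq_abs (w k t)]
      gcongr
    · apply Continuous.intervalIntegrable; fun_prop
    · filter_upwards [aene] with t hne ht
      rw [Set.uIoc_of_le (by linarith)] at ht
      apply tendsto_const_nhds.congr'
      filter_upwards [hwz t (lt_of_le_of_ne ht.2 hne)] with k hk
      rw [hk.1, hk.2]; ring
  have fin := le_of_tendsto_of_tendsto' ((lim1.const_add (mG 0 u)).const_mul Theta0)
    (lim2.const_add (qG 0 ξ u)) ineq
  have e5 : ∫ t in (-b)..0, u 0 ^ 2 = b * u 0 ^ 2 := by simp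
  have e6 : ∫ t in (-b)..0, (ξ - t) ^ 2 * u 0 ^ 2 = u 0 ^ 2 * ∫ s in (0:ℝ)..b, (ξ + s) ^ 2 := by
    rw [intervalIntegral.integral_mul_const, mul_comm]
    congr 1
    have := intervalIntegral.integral_comp_neg (a := 0) (b := b) (fun t => (ξ - t) ^ 2)
    simp only [neg_zero, sub_neg_eq_add] at this
    exact this.symm
  rwa [e5, e6] at fin

end MagAux

namespace MagAux

lemma trace_int {u : ℝ → ℝ} (hu : ContDiff ℝ (⊤ : ℕ∞) u)
    (hc : HasCompactSupport u) (b : ℝ) (hb : 0 < b) :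
    b * u 0 ^ 2 ≤ 2 * (∫ t in (0:ℝ)..b, u t ^ 2) + b ^ 2 * ∫ t in (0:ℝ)..b, deriv u t ^ 2 := by
  have cu := hu.continuous
  have cdu : Continuous (deriv u) := hu.continuous_deriv (by simp)
  have hd : ∀ t ∈ Set.uIcc 0 b, HasDerivAt (fun t => -((b - t) * u t ^ 2))
      (u t ^ 2 - 2 * ((b - t) * (u t * deriv u t))) t := by
    intro t _
    have h0 : HasDerivAt (fun t => -((b - t) * u t ^ 2)) _ t :=
      (((hasDerivAt_id t).const_sub b).mul ((hda hu hc t).pow 2)).neg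
    refine h0.congr_deriv ?_
    simp; ring
  have h1 := intervalIntegral.integral_eq_sub_of_hasDerivAt hd
    (Continuous.intervalIntegrable (by fun_prop) _ _)
  have h2 : b * u 0 ^ 2 = ∫ t in (0:ℝ)..b, (u t ^ 2 - 2 * ((b - t) * (u t * deriv u t))) := by
    rw [h1]; ring
  rw [h2, ← intervalIntegral.integral_const_mul, ← intervalIntegral.integral_const_mul,
    ← intervalIntegral.integral_add (Continuous.intervalIntegrable (by fun_prop) _ _)
      (Continuous.intervalIntegrable (by fun_prop) _ _)]
  apply intervalIntegral.integral_mono_on hb.le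
    (Continuous.intervalIntegrable (by fun_prop) _ _)
    (Continuous.intervalIntegrable (by fun_prop) _ _)
  intro t ht
  have h3 : (b - t) ^ 2 * deriv u t ^ 2 ≤ b ^ 2 * deriv u t ^ 2 := by
    gcongr
    · linarith [ht.2]
    · linarith [ht.1]
  nlinarith [sq_nonneg (u t + (b - t) * deriv u t)]

lemma trace_inf {u : ℝ → ℝ} (hu : ContDiff ℝ (⊤ : ℕ∞) u)
    (hc : HasCompactSupport u) (ξ : ℝ) : u 0 ^ 2 ≤ mG 0 u + qG 0 ξ u := by
  have h1 := ibp_lin hu hc 1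
  have h0 := ibp_lin hu hc 0
  have i3 : ∀ ξ, Integrable (fun t => u t ^ 2 + 2 * ((t - ξ) * (u t * deriv u t))) := by
    intro ξ
    have i2 := int_u2 hu hc (fun _ => 1) continuous_const
    have h2 := int_udu hu hc (fun t => 2 * (t - ξ)) (by fun_prop)
    refine (i2.add h2).congr (Eventually.of_forall fun t => ?_)
    simp; ring
  have i2 : Integrable (fun t => u t ^ 2) := by
    simpa using int_u2 hu hc (fun _ => 1) continuous_const
  have i : Integrable (fun t => deriv u t ^ 2 + (ξ - t) ^ 2 * u t ^ 2) := by
    have h1 := int_u2 hu hc (fun t => (ξ - t) ^ 2) (by fun_prop)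
    have h3 := int_du2 hu hc (fun t => 1) (by fun_prop)
    refine (h3.add h1).congr (Eventually.of_forall fun t => ?_)
    simp
  have h2 : u 0 ^ 2 = ∫ t in Set.Ioi (0:ℝ), ((u t ^ 2 + 2 * ((t - 1) * (u t * deriv u t))) -
      (u t ^ 2 + 2 * ((t - 0) * (u t * deriv u t)))) := by
    rw [integral_sub (i3 1).integrableOn (i3 0).integrableOn, h1, h0]; ring
  rw [h2, mG, qG, ← integral_add i2.integrableOn i.integrableOn]
  apply integral_mono ((i3 1).sub (i3 0)).integrableOn (i2.add i).integrableOn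
  intro t
  simp only [Pi.add_apply, Pi.sub_apply]
  nlinarith [sq_nonneg (u t + deriv u t), sq_nonneg ((ξ - t) * u t)]

set_option maxHeartbeats 1600000 in
lemma gap_core {u : ℝ → ℝ} (hu : ContDiff ℝ (⊤ : ℕ∞) u)
    (hc : HasCompactSupport u) (ξ e m : ℝ) (hm : m = 1 - Theta0) (h1 : mG 0 u = 1)
    (he : qG 0 ξ u = Theta0 + e) (hem : e < m / 12) :
    (ξ - Real.sqrt Theta0) ^ 2 ≤ 25920 / m ^ 3 * e := by
  have hT0 := theta0_nonneg
  have hT1 := theta0_lt_one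
  have hm0 : 0 < m := by linarith
  have hm1 : m ≤ 1 := by linarith
  have cu := hu.continuous
  have cdu : Continuous (deriv u) := hu.continuous_deriv (by simp)
  have he0 : 0 ≤ e := by
    have := BI0 ξ u hu hc
    rw [h1, he] at this; linarith
  set U := u 0 ^ 2 with hU
  have hU0 : 0 ≤ U := sq_nonneg _
  have i : m / 2 ≤ ξ * U := by
    have := qG_eq hu hc ξ
    have h2 : 0 ≤ ∫ t in Set.Ioi (0:ℝ), (deriv u t + (t - ξ) * u t) ^ 2 :=
      integral_nonneg fun t => sq_nonneg _
    rw [he, h1] at this; linarith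
  have ii : U ≤ 3 := by
    have := trace_inf hu hc ξ
    rw [h1, he] at this; linarith
  have hξ0 : m / 6 ≤ ξ := by
    have : 0 < ξ := by
      by_contra hneg
      push Not at hneg
      nlinarith
    nlinarith
  have iii : ∀ b, (∫ t in (0:ℝ)..b, (deriv u t ^ 2 + (ξ - t) ^ 2 * u t ^ 2))
      - Theta0 * ∫ t in (0:ℝ)..b, u t ^ 2 ≤ e := by
    intro b
    have h2 := BIa b ξ u hu hc
    rw [qG_split hu hc 0 b] at he
    rw [mG_split hu hc 0 b] at h1
    have : mG b u = 1 - ∫ t in (0:ℝ)..b, u t ^ 2 := by linarith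
    rw [this] at h2
    linarith
  have iii' : ∀ b > 0, ∀ κ, (∀ t ∈ Set.Icc 0 b, κ ≤ (ξ - t) ^ 2 - Theta0) →
      (∫ t in (0:ℝ)..b, deriv u t ^ 2) + κ * (∫ t in (0:ℝ)..b, u t ^ 2) ≤ e := by
    intro b hb κ hκ
    refine le_trans ?_ (iii b)
    rw [← intervalIntegral.integral_const_mul, ← intervalIntegral.integral_const_mul,
      ← intervalIntegral.integral_add (Continuous.intervalIntegrable (by fun_prop) _ _)
      (Continuous.intervalIntegrable (by fun_prop) _ _),
      ← intervalIntegral.integral_sub (Continuous.intervalIntegrable (by fun_prop) _ _)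
      (Continuous.intervalIntegrable (by fun_prop) _ _)]
    apply intervalIntegral.integral_mono_on hb.le
      (Continuous.intervalIntegrable (by fun_prop) _ _)
      (Continuous.intervalIntegrable (by fun_prop) _ _)
    intro t ht
    nlinarith [mul_le_mul_of_nonneg_right (hκ t ht) (sq_nonneg (u t))]
  have I0 : ∀ b > 0, 0 ≤ ∫ t in (0:ℝ)..b, u t ^ 2 := fun b hb =>
    intervalIntegral.integral_nonneg hb.le fun t _ => sq_nonneg _
  have J0 : ∀ b > 0, 0 ≤ ∫ t in (0:ℝ)..b, deriv u t ^ 2 := fun b hb =>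
    intervalIntegral.integral_nonneg hb.le fun t _ => sq_nonneg _
  have hξ3 : ξ < 3 := by
    by_contra hge
    push Not at hge
    have hb : (0:ℝ) < 1 / ξ := by positivity
    have hb1 : 1 / ξ ≤ 1 := by rw [div_le_one (by linarith)]; linarith
    have h2 := iii' (1 / ξ) hb (ξ ^ 2 / 3) (by
      intro t ht
      have := ht.2.trans hb1
      nlinarith [ht.1])
    have h3 := trace_int hu hc (1 / ξ) hb
    have h4 := I0 _ hb
    have h5 := J0 _ hb
    set I := ∫ t in (0:ℝ)..(1 / ξ), u t ^ 2
    set J := ∫ t in (0:ℝ)..(1 / ξ), deriv u t ^ 2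
    have hξp : 0 < ξ := by linarith
    have h6 : ξ * U ≤ 2 * (ξ ^ 2 * I) + J := by
      have : ξ ^ 2 * (1 / ξ * U) ≤ ξ ^ 2 * (2 * I + (1 / ξ) ^ 2 * J) :=
        mul_le_mul_of_nonneg_left h3 (by positivity)
      have e1 : ξ ^ 2 * (1 / ξ * U) = ξ * U := by field_simp
      have e2 : ξ ^ 2 * (2 * I + (1 / ξ) ^ 2 * J) = 2 * (ξ ^ 2 * I) + J := by field_simp
      rwa [e1, e2] at this
    nlinarith
  have hUm : m / 6 ≤ U := by nlinarith
  have hΔ1 : 0 < ξ ^ 2 - Theta0 → (ξ ^ 2 - Theta0) ^ 2 ≤ 720 / m * e := by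
    intro hΔ
    set Δ := ξ ^ 2 - Theta0 with hΔd
    have hΔ9 : Δ ≤ 9 := by nlinarith
    have hb : 0 < Δ / 12 := by positivity
    have h2 := iii' (Δ / 12) hb (Δ / 2) (by
      intro t ht
      have h7 := ht.2
      have h8 := ht.1
      nlinarith [mul_nonneg h8 (by linarith : (0:ℝ) ≤ 3 - ξ)])
    have h3 := trace_int hu hc (Δ / 12) hb
    have h4 := I0 _ hb
    have h5 := J0 _ hb
    set I := ∫ t in (0:ℝ)..(Δ / 12), u t ^ 2
    set J := ∫ t in (0:ℝ)..(Δ / 12), deriv u t ^ 2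
    have h66 : 0 ≤ Δ / 2 * I := by positivity
    have h6 : J ≤ e := by linarith
    have h7 : Δ * I ≤ 2 * e := by linarith
    have h8 : Δ * (Δ / 12 * U) ≤ 2 * (Δ * I) + Δ * ((Δ / 12) ^ 2 * J) := by
      have := mul_le_mul_of_nonneg_left h3 hΔ.le
      linarith
    have h9 : Δ * ((Δ / 12) ^ 2 * J) ≤ 6 * e := by
      have : Δ * (Δ / 12) ^ 2 ≤ 6 := by
        have h99 : Δ ^ 3 ≤ 9 ^ 3 := pow_le_pow_left₀ hΔ.le hΔ9 3
        have h98 : Δ * (Δ / 12) ^ 2 = Δ ^ 3 / 144 := by ring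
        rw [h98]; linarith
      calc Δ * ((Δ / 12) ^ 2 * J) = (Δ * (Δ / 12) ^ 2) * J := by ring
        _ ≤ 6 * e := by gcongr
    have h10 : Δ ^ 2 * (m / 72) ≤ 10 * e := by
      have : Δ ^ 2 * (m / 72) ≤ Δ * (Δ / 12 * U) := by
        have := mul_le_mul_of_nonneg_left hUm (sq_nonneg Δ)
        linarith
      linarith
    rw [div_mul_eq_mul_div, le_div_iff₀ hm0]; linarith
  have hΔ2 : 0 < Theta0 - ξ ^ 2 → (ξ ^ 2 - Theta0) ^ 2 ≤ 720 / m * e := by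
    intro hΔ
    set D := Theta0 - ξ ^ 2 with hDd
    have hb : 0 < D / 8 := by positivity
    have hD1 : D ≤ 1 := by nlinarith
    have h2 := ext_lemma hu hc ξ (D / 8) hb
    have h3 : ∫ s in (0:ℝ)..(D / 8), (ξ + s) ^ 2 ≤ (D / 8) * (ξ ^ 2 + D / 2) := by
      have : (D / 8) * (ξ ^ 2 + D / 2) = ∫ s in (0:ℝ)..(D / 8), (ξ ^ 2 + D / 2) := by
        rw [intervalIntegral.integral_const, smul_eq_mul]; ring
      rw [this]
      apply intervalIntegral.integral_mono_on hb.le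
        (Continuous.intervalIntegrable (by fun_prop) _ _)
        (Continuous.intervalIntegrable (by fun_prop) _ _)
      intro s hs
      have hξ1 : ξ ≤ 1 := by nlinarith
      nlinarith [hs.1, hs.2, mul_nonneg hs.1 (by linarith : (0:ℝ) ≤ 1 - ξ),
        mul_nonneg hs.1 (by linarith [hs.2] : (0:ℝ) ≤ 1 - s)]
    rw [h1, he] at h2
    have h4 : U * ∫ s in (0:ℝ)..(D / 8), (ξ + s) ^ 2 ≤ U * ((D / 8) * (ξ ^ 2 + D / 2)) := by gcongr
    have h5 : U * D ^ 2 ≤ 16 * e := by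
      have : Theta0 = D + ξ ^ 2 := by rw [hDd]; ring
      nlinarith
    have h6 : m / 6 * D ^ 2 ≤ 16 * e := le_trans (by gcongr) h5
    rw [div_mul_eq_mul_div, le_div_iff₀ hm0]
    have : (ξ ^ 2 - Theta0) ^ 2 = D ^ 2 := by rw [hDd]; ring
    rw [this]; linarith
  have hΔ : (ξ ^ 2 - Theta0) ^ 2 ≤ 720 / m * e := by
    rcases lt_trichotomy (ξ ^ 2) Theta0 with h | h | h
    · exact hΔ2 (by linarith)
    · rw [h]; simp; positivity
    · exact hΔ1 (by linarith)
  set ξ₀ := Real.sqrt Theta0 with hξ₀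
  have hξ₀n : 0 ≤ ξ₀ := Real.sqrt_nonneg _
  have hsq : ξ₀ ^ 2 = Theta0 := Real.sq_sqrt hT0
  have h2 : (m / 6) ^ 2 * (ξ - ξ₀) ^ 2 ≤ (ξ ^ 2 - Theta0) ^ 2 := by
    have : (ξ ^ 2 - Theta0) ^ 2 = (ξ + ξ₀) ^ 2 * (ξ - ξ₀) ^ 2 := by rw [← hsq]; ring
    rw [this]
    gcongr
    linarith
  have h3 := h2.trans hΔ
  rw [div_mul_eq_mul_div, le_div_iff₀ (by positivity)]
  rw [div_mul_eq_mul_div, le_div_iff₀ hm0] at h3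
  linarith

lemma gap_exists : ∃ c₁ > (0:ℝ), c₁ ≤ 1 ∧ ∀ (ξ : ℝ) (u : ℝ → ℝ), ContDiff ℝ (⊤ : ℕ∞) u →
    HasCompactSupport u →
    (Theta0 + c₁ * min 1 ((ξ - Real.sqrt Theta0) ^ 2)) * mG 0 u ≤ qG 0 ξ u := by
  have hT0 := theta0_nonneg
  have hT1 := theta0_lt_one
  set m := 1 - Theta0 with hm
  have hm0 : 0 < m := by linarith
  have hm1 : m ≤ 1 := by linarith
  refine ⟨min (m / 12) (m ^ 3 / 25920), by positivity, (min_le_left _ _).trans (by linarith), ?_⟩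
  intro ξ u hu hc
  rcases (mG_nonneg 0 u).eq_or_lt with h | h
  · rw [← h, mul_zero]; exact qG_nonneg _ _ _
  set M := mG 0 u with hM
  have hs : 0 < Real.sqrt M := Real.sqrt_pos.2 h
  have h2 : (Real.sqrt M)⁻¹ ^ 2 = M⁻¹ := by rw [inv_pow, Real.sq_sqrt h.le]
  let v : ℝ → ℝ := fun t => (Real.sqrt M)⁻¹ * u t
  have hv : ContDiff ℝ (⊤ : ℕ∞) v := contDiff_const.mul hu
  have hvc : HasCompactSupport v := hc.mul_left
  have m1 : mG 0 v = 1 := by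
    simp only [mG, v, mul_pow, h2]
    rw [integral_const_mul]
    exact inv_mul_cancel₀ h.ne'
  have q1 : qG 0 ξ v = M⁻¹ * qG 0 ξ u := by
    rw [qG, qG, ← integral_const_mul]
    congr 1; ext t
    have : deriv v t = (Real.sqrt M)⁻¹ * deriv u t := by
      simp only [v]
      rw [deriv_const_mul]; exact (hu.differentiable (by simp)).differentiableAt
    rw [this]; simp only [v]; rw [mul_pow, mul_pow, h2]; ring
  have key : Theta0 + min (m / 12) (m ^ 3 / 25920) * min 1 ((ξ - Real.sqrt Theta0) ^ 2) ≤
      qG 0 ξ v := by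
    set e := qG 0 ξ v - Theta0 with he
    have he0 : 0 ≤ e := by
      have := BI0 ξ v hv hvc
      rw [m1] at this; linarith
    suffices min (m / 12) (m ^ 3 / 25920) * min 1 ((ξ - Real.sqrt Theta0) ^ 2) ≤ e by linarith
    have hn : 0 ≤ min 1 ((ξ - Real.sqrt Theta0) ^ 2) := le_min zero_le_one (sq_nonneg _)
    by_cases hem : e < m / 12
    · have := gap_core hv hvc ξ e m hm m1 (by rw [he]; ring) hem
      calc _ ≤ (m ^ 3 / 25920) * ((ξ - Real.sqrt Theta0) ^ 2) := by
            gcongr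
            · exact min_le_right _ _
            · exact min_le_right _ _
        _ ≤ (m ^ 3 / 25920) * (25920 / m ^ 3 * e) := by gcongr
        _ = e := by field_simp
    · push Not at hem
      calc _ ≤ (m / 12) * 1 := by
            gcongr
            · exact min_le_left _ _
            · exact min_le_left _ _
        _ ≤ e := by linarith
  rw [q1] at key
  calc _ ≤ (M⁻¹ * qG 0 ξ u) * M := by gcongr
    _ = _ := by field_simp

end MagAux

namespace MagAux

def GapC (c₁ : ℝ) : Prop := ∀ (ξ : ℝ) (u : ℝ → ℝ), ContDiff ℝ (⊤ : ℕ∞) u →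
    HasCompactSupport u →
    (Theta0 + c₁ * min 1 ((ξ - Real.sqrt Theta0) ^ 2)) * mG 0 u ≤ qG 0 ξ u

lemma ioi_affine (F : ℝ → ℝ) (a ℓ : ℝ) (hℓ : 0 < ℓ) :
    ∫ t in Set.Ioi a, F t = ℓ * ∫ τ in Set.Ioi (0:ℝ), F (ℓ * τ + a) := by
  have := integral_comp_mul_left_Ioi' (fun t => F (t + a)) 0 hℓ
  rw [smul_eq_mul, mul_zero, ioi_shift] at this
  exact this.symm

lemma t1 {c₁ : ℝ} (G : GapC c₁) {u : ℝ → ℝ} (hu : ContDiff ℝ (⊤ : ℕ∞) u)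
    (hc : HasCompactSupport u) (q ρ h a ζ : ℝ) (hq : 0 < q) (hρ : 0 < ρ) (hqh : q ^ 2 = h * ρ) :
    q ^ 2 * (Theta0 + c₁ * min 1 (((ζ + ρ * a) / q + Real.sqrt Theta0) ^ 2)) *
      (∫ t in Set.Ioi a, u t ^ 2) ≤
    ∫ t in Set.Ioi a, (h ^ 2 * deriv u t ^ 2 + (ζ + ρ * t) ^ 2 * u t ^ 2) := by
  set ℓ := q / ρ with hℓ
  have hℓ0 : 0 < ℓ := by positivity
  let v : ℝ → ℝ := fun τ => u (ℓ * τ + a)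
  have hv : ContDiff ℝ (⊤ : ℕ∞) v := hu.comp (by fun_prop)
  have hvc : HasCompactSupport v := by
    have e : v = u ∘ (((Homeomorph.mulLeft₀ ℓ hℓ0.ne').trans (Homeomorph.addRight a))) := by
      ext t; simp [v]
    rw [e]
    exact hc.comp_homeomorph _
  have hdv : ∀ τ, deriv v τ = ℓ * deriv u (ℓ * τ + a) := by
    intro τ
    have h1 : HasDerivAt (fun τ => ℓ * τ + a) ℓ τ := by
      simpa using ((hasDerivAt_id τ).const_mul ℓ).add_const a
    have h2 : HasDerivAt v _ τ := (hda hu hc (ℓ * τ + a)).comp τ h1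
    rw [h2.deriv]; ring
  have key := G (-((ζ + ρ * a) / q)) v hv hvc
  rw [ioi_affine _ a ℓ hℓ0, ioi_affine (fun t => h ^ 2 * deriv u t ^ 2 + (ζ + ρ * t) ^ 2 * u t ^ 2) a ℓ hℓ0]
  have e1 : (-((ζ + ρ * a) / q) - Real.sqrt Theta0) ^ 2 = ((ζ + ρ * a) / q + Real.sqrt Theta0) ^ 2 := by
    ring
  rw [e1] at key
  have e2 : ∫ τ in Set.Ioi (0:ℝ), (h ^ 2 * deriv u (ℓ * τ + a) ^ 2 + (ζ + ρ * (ℓ * τ + a)) ^ 2 * u (ℓ * τ + a) ^ 2)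
     = q ^ 2 * qG 0 (-((ζ + ρ * a) / q)) v := by
    rw [qG, ← integral_const_mul]
    congr 1; ext τ
    rw [hdv]
    simp only [v]
    have hh : h = q ^ 2 / ρ := by field_simp; linarith
    rw [hh, hℓ]; field_simp; ring
  rw [e2]
  have e3 : ∫ τ in Set.Ioi (0:ℝ), u (ℓ * τ + a) ^ 2 = mG 0 v := rfl
  rw [e3]
  calc _ = ℓ * (q ^ 2 * ((Theta0 + c₁ * min 1 (((ζ + ρ * a) / q + Real.sqrt Theta0) ^ 2)) * mG 0 v)) := by ring
    _ ≤ _ := by gcongr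

lemma cutoff_ext (u : ℝ → ℝ) (hu : ContDiffOn ℝ (⊤ : ℕ∞) u (Set.Ioi 0)) (T : ℝ)
    (hT : ∀ t, T < t → u t = 0) (ε : ℝ) (hε : 0 < ε) :
    ∃ v : ℝ → ℝ, ContDiff ℝ (⊤ : ℕ∞) v ∧ HasCompactSupport v ∧ ∀ t, ε ≤ t → v t = u t := by
  let χ : ℝ → ℝ := fun t => Real.smoothTransition ((t - ε / 2) / (ε / 2))
  have hχ : ContDiff ℝ (⊤ : ℕ∞) χ := Real.smoothTransition.contDiff.comp (by fun_prop)
  have χ0 : ∀ t, t ≤ ε / 2 → χ t = 0 := fun t ht =>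
    Real.smoothTransition.zero_of_nonpos (div_nonpos_of_nonpos_of_nonneg (by linarith) (by linarith))
  have χ1 : ∀ t, ε ≤ t → χ t = 1 := fun t ht =>
    Real.smoothTransition.one_of_one_le (by rw [le_div_iff₀ (by linarith)]; linarith)
  refine ⟨fun t => χ t * u t, ?_, ?_, fun t ht => by simp [χ1 t ht]⟩
  · rw [contDiff_iff_contDiffAt]
    intro t
    rcases lt_or_ge 0 t with h | h
    · exact hχ.contDiffAt.mul (hu.contDiffAt (Ioi_mem_nhds h))
    · have : (fun t => χ t * u t) =ᶠ[𝓝 t] fun _ => 0 := by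
        filter_upwards [Iio_mem_nhds (show t < ε / 2 by linarith)] with s hs
        rw [χ0 s (le_of_lt hs), zero_mul]
      exact contDiffAt_const.congr_of_eventuallyEq this
  · apply HasCompactSupport.intro (isCompact_Icc (a := ε / 2) (b := T))
    intro t ht
    rw [Set.mem_Icc, not_and_or, not_le, not_le] at ht
    rcases ht with h | h
    · simp [χ0 t h.le]
    · simp [hT t h]

lemma ioi_iSup (f : ℝ → ENNReal) :
    ∫⁻ t in Set.Ioi (0:ℝ), f t = ⨆ n : ℕ, ∫⁻ t in Set.Ioi (1 / ((n:ℝ) + 1)), f t := by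
  have : Set.Ioi (0:ℝ) = ⋃ n : ℕ, Set.Ioi (1 / ((n:ℝ) + 1)) := by
    ext t
    simp only [Set.mem_Ioi, Set.mem_iUnion]
    constructor
    · exact fun h => exists_nat_one_div_lt h
    · rintro ⟨n, hn⟩
      exact lt_trans (by positivity) hn
  rw [this, setLIntegral_iUnion_of_directed]
  apply directed_of_isDirected_le
  intro m n hmn
  apply Set.Ioi_subset_Ioi
  exact one_div_le_one_div_of_le (by positivity) (by exact_mod_cast Nat.succ_le_succ hmn)

/-- `t`-lemma, real functions. -/
lemma t2 {c₁ : ℝ} (hc₁ : 0 ≤ c₁) (G : GapC c₁) {u : ℝ → ℝ}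
    (hu : ContDiffOn ℝ (⊤ : ℕ∞) u (Set.Ioi 0)) (T : ℝ)
    (hT : ∀ t, T < t → u t = 0) (q ρ h ζ : ℝ) (hq : 0 < q) (hρ : 0 < ρ) (hqh : q ^ 2 = h * ρ) :
    ENNReal.ofReal (q ^ 2 * (Theta0 + c₁ * min 1 ((ζ / q + Real.sqrt Theta0) ^ 2))) *
      (∫⁻ t in Set.Ioi (0:ℝ), ENNReal.ofReal (u t ^ 2)) ≤
    ∫⁻ t in Set.Ioi (0:ℝ), ENNReal.ofReal (h ^ 2 * deriv u t ^ 2 + (ζ + ρ * t) ^ 2 * u t ^ 2) := by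
  have hT0 := theta0_nonneg
  set X := ∫⁻ t in Set.Ioi (0:ℝ), ENNReal.ofReal (h ^ 2 * deriv u t ^ 2 + (ζ + ρ * t) ^ 2 * u t ^ 2)
  by_cases hX : X = ⊤
  · rw [hX]; exact le_top
  let k : ℝ → ℝ := fun ε => q ^ 2 * (Theta0 + c₁ * min 1 (((ζ + ρ * ε) / q + Real.sqrt Theta0) ^ 2))
  have k0 : ∀ ε, 0 ≤ k ε := fun ε => by
    have : 0 ≤ min 1 (((ζ + ρ * ε) / q + Real.sqrt Theta0) ^ 2) := le_min zero_le_one (sq_nonneg _)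
    positivity
  have kc : Continuous k := by fun_prop
  have main : ∀ ε > 0, ∀ ε₁ ≥ ε, ENNReal.ofReal (k ε) * (∫⁻ t in Set.Ioi ε₁, ENNReal.ofReal (u t ^ 2)) ≤ X
      ∧ (∫⁻ t in Set.Ioi ε₁, ENNReal.ofReal (u t ^ 2)) ≠ ⊤ := by
    intro ε hε ε₁ hε₁
    obtain ⟨v, hv, hvc, hvu⟩ := cutoff_ext u hu T hT ε hε
    have h1 := t1 G hv hvc q ρ h ε ζ hq hρ hqh
    have i2 : Integrable (fun t => v t ^ 2) := by
      simpa using int_u2 hv hvc (fun _ => 1) continuous_const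
    have i : Integrable (fun t => h ^ 2 * deriv v t ^ 2 + (ζ + ρ * t) ^ 2 * v t ^ 2) :=
      (int_du2 hv hvc (fun _ => h ^ 2) (by fun_prop)).add
        (int_u2 hv hvc (fun t => (ζ + ρ * t) ^ 2) (by fun_prop))
    have e1 : ∫⁻ t in Set.Ioi ε, ENNReal.ofReal (u t ^ 2) = ENNReal.ofReal (∫ t in Set.Ioi ε, v t ^ 2) := by
      rw [ofReal_integral_eq_lintegral_ofReal i2.integrableOn (Eventually.of_forall fun t => sq_nonneg _)]
      apply setLIntegral_congr_fun measurableSet_Ioi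
      intro t ht
      simp only
      rw [hvu t (le_of_lt ht)]
    have e2 : ENNReal.ofReal (∫ t in Set.Ioi ε, (h ^ 2 * deriv v t ^ 2 + (ζ + ρ * t) ^ 2 * v t ^ 2)) ≤ X := by
      rw [ofReal_integral_eq_lintegral_ofReal i.integrableOn (Eventually.of_forall fun t => by
        simp only [Pi.zero_apply]; positivity)]
      refine le_trans (le_of_eq ?_) (lintegral_mono_set (Set.Ioi_subset_Ioi hε.le))
      apply setLIntegral_congr_fun measurableSet_Ioi
      intro t ht
      simp only
      have : v =ᶠ[𝓝 t] u := by
        filter_upwards [Ioi_mem_nhds ht] with s hs using hvu s (le_of_lt hs)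
      rw [this.deriv_eq, hvu t (le_of_lt ht)]
    have e3 : ∫⁻ t in Set.Ioi ε₁, ENNReal.ofReal (u t ^ 2) ≤ ∫⁻ t in Set.Ioi ε, ENNReal.ofReal (u t ^ 2) :=
      lintegral_mono_set (Set.Ioi_subset_Ioi hε₁)
    constructor
    · calc _ ≤ ENNReal.ofReal (k ε) * ∫⁻ t in Set.Ioi ε, ENNReal.ofReal (u t ^ 2) := by gcongr
        _ = ENNReal.ofReal (k ε * ∫ t in Set.Ioi ε, v t ^ 2) := by
          rw [e1, ← ENNReal.ofReal_mul (k0 ε)]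
        _ ≤ _ := (ENNReal.ofReal_le_ofReal h1).trans e2
    · rw [e1] at e3
      exact ne_top_of_le_ne_top ENNReal.ofReal_ne_top e3
  rw [ioi_iSup, ENNReal.mul_iSup]
  apply iSup_le
  intro n
  set ε₁ : ℝ := 1 / ((n:ℝ) + 1)
  have hε₁ : 0 < ε₁ := by positivity
  have kz : k 0 = q ^ 2 * (Theta0 + c₁ * min 1 ((ζ / q + Real.sqrt Theta0) ^ 2)) := by simp [k]
  rw [← kz]
  have lim : Tendsto (fun ε => ENNReal.ofReal (k ε) * (∫⁻ t in Set.Ioi ε₁, ENNReal.ofReal (u t ^ 2)))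
      (𝓝[>] 0) (𝓝 (ENNReal.ofReal (k 0) * (∫⁻ t in Set.Ioi ε₁, ENNReal.ofReal (u t ^ 2)))) := by
    apply ENNReal.Tendsto.mul_const
    · exact (ENNReal.continuous_ofReal.comp kc).continuousAt.tendsto.mono_left nhdsWithin_le_nhds
    · exact Or.inr (main ε₁ hε₁ ε₁ le_rfl).2
  apply le_of_tendsto lim
  filter_upwards [Ioo_mem_nhdsGT hε₁] with ε hε
  exact (main ε hε.1 ε₁ hε.2.le).1

/-- `t`-lemma, complex functions. -/
lemma t3 {c₁ : ℝ} (hc₁ : 0 ≤ c₁) (G : GapC c₁) {g g' : ℝ → ℂ}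
    (hg : ContDiffOn ℝ (⊤ : ℕ∞) g (Set.Ioi 0)) (hg' : ∀ t > 0, HasDerivAt g (g' t) t) (T : ℝ)
    (hT : ∀ t, T < t → g t = 0) (q ρ h ζ : ℝ) (hq : 0 < q) (hρ : 0 < ρ) (hqh : q ^ 2 = h * ρ) :
    ENNReal.ofReal (q ^ 2 * (Theta0 + c₁ * min 1 ((ζ / q + Real.sqrt Theta0) ^ 2))) *
      (∫⁻ t in Set.Ioi (0:ℝ), ENNReal.ofReal (‖g t‖ ^ 2)) ≤
    ∫⁻ t in Set.Ioi (0:ℝ), ENNReal.ofReal (h ^ 2 * ‖g' t‖ ^ 2 + (ζ + ρ * t) ^ 2 * ‖g t‖ ^ 2) := by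
  have hre : ContDiffOn ℝ (⊤ : ℕ∞) (fun t => (g t).re) (Set.Ioi 0) :=
    Complex.reCLM.contDiff.comp_contDiffOn hg
  have him : ContDiffOn ℝ (⊤ : ℕ∞) (fun t => (g t).im) (Set.Ioi 0) :=
    Complex.imCLM.contDiff.comp_contDiffOn hg
  have dre : ∀ t > 0, deriv (fun t => (g t).re) t = (g' t).re := fun t ht =>
    (Complex.reCLM.hasFDerivAt.comp_hasDerivAt t (hg' t ht)).deriv
  have dim : ∀ t > 0, deriv (fun t => (g t).im) t = (g' t).im := fun t ht =>
    (Complex.imCLM.hasFDerivAt.comp_hasDerivAt t (hg' t ht)).deriv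
  have h1 := t2 hc₁ G hre T (fun t ht => by simp [hT t ht]) q ρ h ζ hq hρ hqh
  have h2 := t2 hc₁ G him T (fun t ht => by simp [hT t ht]) q ρ h ζ hq hρ hqh
  have hsq : ∀ z : ℂ, ‖z‖ ^ 2 = z.re ^ 2 + z.im ^ 2 := fun z => by
    rw [Complex.sq_norm, Complex.normSq_apply]; ring
  have e1 : ∫⁻ t in Set.Ioi (0:ℝ), ENNReal.ofReal (‖g t‖ ^ 2) =
      (∫⁻ t in Set.Ioi (0:ℝ), ENNReal.ofReal ((g t).re ^ 2)) + ∫⁻ t in Set.Ioi (0:ℝ), ENNReal.ofReal ((g t).im ^ 2) := by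
    rw [← lintegral_add_left']
    · congr 1; ext t
      rw [hsq, ENNReal.ofReal_add (sq_nonneg _) (sq_nonneg _)]
    · exact ((hre.continuousOn.aemeasurable measurableSet_Ioi).pow_const 2).ennreal_ofReal
  rw [e1, mul_add]
  refine (add_le_add h1 h2).trans ?_
  rw [← lintegral_add_left']
  · apply le_of_eq
    apply setLIntegral_congr_fun measurableSet_Ioi
    intro t ht
    simp only
    rw [← ENNReal.ofReal_add (by positivity) (by positivity), dre t ht, dim t ht, hsq, hsq]
    congr 1; ring
  · have hm : AEMeasurable (fun t => deriv (fun t => (g t).re) t) (volume.restrict (Set.Ioi (0:ℝ))) :=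
      (measurable_deriv _).aemeasurable
    have hm2 := hre.continuousOn.aemeasurable (μ := volume) measurableSet_Ioi
    apply AEMeasurable.ennreal_ofReal
    apply AEMeasurable.add
    · exact (hm.pow_const 2).const_mul _
    · exact AEMeasurable.mul (by fun_prop) (hm2.pow_const 2)

/-- `s`-lemma. -/
lemma s1 {g g' : ℝ → ℂ} (hg : ∀ s, HasDerivAt g (g' s) s) (hcg : Continuous g') (R : ℝ)
    (hR : ∀ s, R < |s| → g s = 0) {Φ Φ' : ℝ → ℝ} (hΦ : ∀ s, HasDerivAt Φ (Φ' s) s)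
    (hcΦ : Continuous Φ') (hΦ0 : ∀ s, 0 ≤ Φ' s) :
    ∫⁻ s, ENNReal.ofReal (Φ' s * ‖g s‖ ^ 2) ≤
      ∫⁻ s, ENNReal.ofReal (‖g' s‖ ^ 2 + Φ s ^ 2 * ‖g s‖ ^ 2) := by
  have cg : Continuous g := continuous_iff_continuousAt.2 fun s => (hg s).continuousAt
  have cΦ : Continuous Φ := continuous_iff_continuousAt.2 fun s => (hΦ s).continuousAt
  have sg : HasCompactSupport g := by
    apply HasCompactSupport.intro (isCompact_Icc (a := -R) (b := R))
    intro s hs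
    apply hR
    by_contra hh
    push Not at hh
    exact hs (abs_le.1 hh)
  have eg' : g' = deriv g := by ext s; exact (hg s).deriv.symm
  have sg' : HasCompactSupport g' := by rw [eg']; exact sg.deriv
  have sn : HasCompactSupport (fun s => ‖g s‖ ^ 2) := by
    have := sg.norm
    simp only [pow_two]; exact this.mul_left
  have sn' : HasCompactSupport (fun s => ‖g' s‖ ^ 2) := by
    have := sg'.norm
    simp only [pow_two]; exact this.mul_left
  have hd : ∀ s, HasDerivAt (fun s => ‖g s‖ ^ 2) (2 * inner ℝ (g s) (g' s)) s := fun s => (hg s).norm_sq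
  have ci : Continuous (fun s => (inner ℝ (g s) (g' s) : ℝ)) := cg.inner hcg
  have hD : ∀ s, HasDerivAt (fun s => Φ s * ‖g s‖ ^ 2)
      (Φ' s * ‖g s‖ ^ 2 + Φ s * (2 * inner ℝ (g s) (g' s))) s := fun s => (hΦ s).mul (hd s)
  have i1 : Integrable (fun s => Φ' s * ‖g s‖ ^ 2) :=
    Continuous.integrable_of_hasCompactSupport (by fun_prop) sn.mul_left
  have i2 : Integrable (fun s => Φ s * (2 * inner ℝ (g s) (g' s))) := by
    apply Continuous.integrable_of_hasCompactSupport (by fun_prop)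
    apply HasCompactSupport.mul_left
    apply HasCompactSupport.mul_left
    apply sg.mono'
    intro s hs
    apply subset_closure
    rw [Function.mem_support] at hs ⊢
    intro h0; apply hs; simp [h0]
  have i3 : Integrable (fun s => ‖g' s‖ ^ 2 + Φ s ^ 2 * ‖g s‖ ^ 2) :=
    (Continuous.integrable_of_hasCompactSupport (by fun_prop) sn').add
      (Continuous.integrable_of_hasCompactSupport (by fun_prop) sn.mul_left)
  have h0 : ∫ s, (Φ' s * ‖g s‖ ^ 2 + Φ s * (2 * inner ℝ (g s) (g' s))) = 0 := by
    apply integral_eq_zero_of_hasDerivAt_of_integrable hD (i1.add i2)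
    exact Continuous.integrable_of_hasCompactSupport (by fun_prop) sn.mul_left
  rw [integral_add i1 i2] at h0
  rw [← ofReal_integral_eq_lintegral_ofReal i1 (Eventually.of_forall fun s => by
      have := hΦ0 s
      simp only [Pi.zero_apply]; positivity),
    ← ofReal_integral_eq_lintegral_ofReal i3 (Eventually.of_forall fun s => by
      simp only [Pi.zero_apply]; positivity)]
  apply ENNReal.ofReal_le_ofReal
  have h4 : ∫ s, Φ' s * ‖g s‖ ^ 2 = ∫ s, -(Φ s * (2 * inner ℝ (g s) (g' s))) := by
    rw [integral_neg]; linarith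
  rw [h4]
  apply integral_mono i2.neg i3
  intro s
  simp only [Pi.neg_apply]
  have h5 := abs_real_inner_le_norm (g s) (g' s)
  have h6 : -(Φ s * (2 * inner ℝ (g s) (g' s))) ≤ 2 * (|Φ s| * (‖g s‖ * ‖g' s‖)) := by
    calc _ ≤ |Φ s * (2 * inner ℝ (g s) (g' s))| := neg_le_abs _
      _ = 2 * (|Φ s| * |inner ℝ (g s) (g' s)|) := by rw [abs_mul, abs_mul, abs_two]; ring
      _ ≤ _ := by gcongr
  nlinarith [sq_nonneg (|Φ s| * ‖g s‖ - ‖g' s‖), sq_abs (Φ s)]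

end MagAux

namespace MagAux

/-- Measure on the half-plane `(s,t)`, `t > 0`. -/
def hpm : Measure (ℝ × ℝ) := (volume : Measure ℝ).prod ((volume : Measure ℝ).restrict (Set.Ioi 0))

instance : SFinite hpm := by unfold hpm; infer_instance

structure HP (T : ℝ) (G Gs Gt : ℝ × ℝ → ℂ) : Prop where
  mG : Measurable G
  mGs : Measurable Gs
  mGt : Measurable Gt
  ct : ∀ s, ContDiffOn ℝ (⊤ : ℕ∞) (fun t => G (s, t)) (Set.Ioi 0)
  dt : ∀ s, ∀ t > 0, HasDerivAt (fun t => G (s, t)) (Gt (s, t)) t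
  zt : ∀ s t, T < t → G (s, t) = 0
  ds : ∀ t > 0, ∀ s, HasDerivAt (fun s => G (s, t)) (Gs (s, t)) s
  cs : ∀ t > 0, Continuous (fun s => Gs (s, t))
  zs : ∀ s t, T < |s| → G (s, t) = 0

lemma combine {T : ℝ} {G Gs Gt : ℝ × ℝ → ℂ} (H : HP T G Gs Gt) (h E : ℝ)
    (V N F : ℝ → ℝ) (P1 P2 P : ℝ × ℝ → ℝ) (mV : Measurable V) (mN : Measurable N) (mF : Measurable F)
    (mP1 : Measurable P1) (mP2 : Measurable P2)
    (V0 : ∀ s, 0 ≤ V s) (N0 : ∀ s, 0 ≤ N s) (F0 : ∀ s, 0 ≤ F s)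
    (P10 : ∀ z, 0 ≤ P1 z) (P20 : ∀ z, 0 ≤ P2 z)
    (h1 : ∀ s, ENNReal.ofReal (V s + N s) * (∫⁻ t in Set.Ioi (0:ℝ), ENNReal.ofReal (‖G (s, t)‖ ^ 2)) ≤
      ∫⁻ t in Set.Ioi (0:ℝ), ENNReal.ofReal (h ^ 2 * ‖Gt (s, t)‖ ^ 2 + P1 (s, t) * ‖G (s, t)‖ ^ 2))
    (h2 : ∀ t > 0, (∫⁻ s, ENNReal.ofReal (F s * ‖G (s, t)‖ ^ 2)) ≤
      ∫⁻ s, ENNReal.ofReal (h ^ 2 * ‖Gs (s, t)‖ ^ 2 + (P2 (s, t) + N s) * ‖G (s, t)‖ ^ 2))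
    (hE : ∀ s, E ≤ V s + F s) (hP : ∀ z, P1 z + P2 z ≤ P z) :
    ENNReal.ofReal E * ∫⁻ z, ENNReal.ofReal (‖G z‖ ^ 2) ∂hpm ≤
    ∫⁻ z, ENNReal.ofReal (h ^ 2 * ‖Gs z‖ ^ 2 + h ^ 2 * ‖Gt z‖ ^ 2 + P z * ‖G z‖ ^ 2) ∂hpm := by
  obtain ⟨mG, mGs, mGt, -⟩ := H
  have i1 : ∫⁻ z : ℝ × ℝ, ENNReal.ofReal ((V z.1 + N z.1) * ‖G z‖ ^ 2) ∂hpm ≤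
      ∫⁻ z, ENNReal.ofReal (h ^ 2 * ‖Gt z‖ ^ 2 + P1 z * ‖G z‖ ^ 2) ∂hpm := by
    rw [hpm, lintegral_prod _ (by fun_prop), lintegral_prod _ (by fun_prop)]
    apply lintegral_mono
    intro s
    refine le_trans (le_of_eq ?_) (h1 s)
    rw [← lintegral_const_mul _ (by fun_prop)]
    refine lintegral_congr fun t => ?_
    rw [ENNReal.ofReal_mul (add_nonneg (V0 s) (N0 s))]
  have i2 : ∫⁻ z : ℝ × ℝ, ENNReal.ofReal (F z.1 * ‖G z‖ ^ 2) ∂hpm ≤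
      ∫⁻ z, ENNReal.ofReal (h ^ 2 * ‖Gs z‖ ^ 2 + (P2 z + N z.1) * ‖G z‖ ^ 2) ∂hpm := by
    rw [hpm, lintegral_prod_symm _ (by fun_prop), lintegral_prod_symm _ (by fun_prop)]
    apply setLIntegral_mono' measurableSet_Ioi
    intro t ht
    exact h2 t ht
  rw [← lintegral_const_mul _ (by fun_prop)]
  calc ∫⁻ z, ENNReal.ofReal E * ENNReal.ofReal (‖G z‖ ^ 2) ∂hpm
      ≤ ∫⁻ z, (ENNReal.ofReal (V z.1 * ‖G z‖ ^ 2) + ENNReal.ofReal (F z.1 * ‖G z‖ ^ 2)) ∂hpm := by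
        apply lintegral_mono
        intro z
        have := V0 z.1
        have := F0 z.1
        simp only
        rw [← ENNReal.ofReal_mul' (by positivity), ← ENNReal.ofReal_add (by positivity) (by positivity), ← add_mul]
        apply ENNReal.ofReal_le_ofReal
        gcongr
        exact hE z.1
    _ = ∫⁻ z, ENNReal.ofReal (V z.1 * ‖G z‖ ^ 2) ∂hpm + ∫⁻ z, ENNReal.ofReal (F z.1 * ‖G z‖ ^ 2) ∂hpm :=
        lintegral_add_left (by fun_prop) _
    _ ≤ ∫⁻ z, ENNReal.ofReal (V z.1 * ‖G z‖ ^ 2) ∂hpm +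
        ∫⁻ z, ENNReal.ofReal (h ^ 2 * ‖Gs z‖ ^ 2 + (P2 z + N z.1) * ‖G z‖ ^ 2) ∂hpm := by gcongr
    _ = ∫⁻ z, ENNReal.ofReal ((V z.1 + N z.1) * ‖G z‖ ^ 2) ∂hpm +
        ∫⁻ z, ENNReal.ofReal (h ^ 2 * ‖Gs z‖ ^ 2 + P2 z * ‖G z‖ ^ 2) ∂hpm := by
        rw [← lintegral_add_left (by fun_prop), ← lintegral_add_left (by fun_prop)]
        congr 1; ext z
        have := V0 z.1
        have := N0 z.1
        have := P20 z
        rw [← ENNReal.ofReal_add (by positivity) (by positivity),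
          ← ENNReal.ofReal_add (by positivity) (by positivity)]
        congr 1; ring
    _ ≤ ∫⁻ z, ENNReal.ofReal (h ^ 2 * ‖Gt z‖ ^ 2 + P1 z * ‖G z‖ ^ 2) ∂hpm +
        ∫⁻ z, ENNReal.ofReal (h ^ 2 * ‖Gs z‖ ^ 2 + P2 z * ‖G z‖ ^ 2) ∂hpm := by gcongr
    _ ≤ _ := by
        rw [← lintegral_add_left (by fun_prop)]
        apply lintegral_mono
        intro z
        have := P10 z
        have := P20 z
        simp only
        rw [← ENNReal.ofReal_add (by positivity) (by positivity)]
        apply ENNReal.ofReal_le_ofReal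
        have := mul_le_mul_of_nonneg_right (hP z) (sq_nonneg ‖G z‖)
        linarith

lemma s2 {g g' : ℝ → ℂ} (hg : ∀ s, HasDerivAt g (g' s) s) (hcg : Continuous g') (R : ℝ)
    (hR : ∀ s, R < |s| → g s = 0) {Φ Φ' : ℝ → ℝ} (hΦ : ∀ s, HasDerivAt Φ (Φ' s) s)
    (hcΦ : Continuous Φ') (hΦ0 : ∀ s, 0 ≤ Φ' s) (h : ℝ) :
    ∫⁻ s, ENNReal.ofReal (h ^ 2 * Φ' s * ‖g s‖ ^ 2) ≤
      ∫⁻ s, ENNReal.ofReal (h ^ 2 * ‖g' s‖ ^ 2 + h ^ 2 * Φ s ^ 2 * ‖g s‖ ^ 2) := by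
  have h1 := s1 hg hcg R hR hΦ hcΦ hΦ0
  have := mul_le_mul_right h1 (ENNReal.ofReal (h ^ 2))
  have cg : Continuous g := continuous_iff_continuousAt.2 fun s => (hg s).continuousAt
  have cΦ : Continuous Φ := continuous_iff_continuousAt.2 fun s => (hΦ s).continuousAt
  rw [← lintegral_const_mul _ (by fun_prop), ← lintegral_const_mul _ (by fun_prop)] at this
  simp only [← ENNReal.ofReal_mul (sq_nonneg h)] at this
  convert this using 4
  · ring
  · ring

/-- weak form of the `t`-lemma, allowing `ρ = 0`. -/
lemma t4 {g g' : ℝ → ℂ}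
    (hg : ContDiffOn ℝ (⊤ : ℕ∞) g (Set.Ioi 0)) (hg' : ∀ t > 0, HasDerivAt g (g' t) t) (T : ℝ)
    (hT : ∀ t, T < t → g t = 0) (ρ h ζ : ℝ) (hh : 0 < h) (hρ : 0 ≤ ρ) :
    ENNReal.ofReal (h * ρ * Theta0) *
      (∫⁻ t in Set.Ioi (0:ℝ), ENNReal.ofReal (‖g t‖ ^ 2)) ≤
    ∫⁻ t in Set.Ioi (0:ℝ), ENNReal.ofReal (h ^ 2 * ‖g' t‖ ^ 2 + (ζ + ρ * t) ^ 2 * ‖g t‖ ^ 2) := by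
  rcases hρ.eq_or_lt with h0 | h0
  · simp [← h0]
  · have G : GapC 0 := fun ξ u hu hc => by simpa using BI0 ξ u hu hc
    have := t3 le_rfl G hg hg' T hT (Real.sqrt (h * ρ)) ρ h ζ (by positivity) h0
      (Real.sq_sqrt (by positivity))
    rw [Real.sq_sqrt (by positivity)] at this
    simpa using this

lemma two_d_large {T : ℝ} {G Gs Gt : ℝ × ℝ → ℂ} (H : HP T G Gs Gt) (h n3 ρ ω : ℝ) (hh : 0 < h)
    (hρ : 0 ≤ ρ) (hn : n3 ≠ 0) :
    ENNReal.ofReal (h * Real.sqrt (Theta0 ^ 2 * ρ ^ 2 + n3 ^ 2)) * ∫⁻ z, ENNReal.ofReal (‖G z‖ ^ 2) ∂hpm ≤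
    ∫⁻ z, ENNReal.ofReal (h ^ 2 * ‖Gs z‖ ^ 2 + h ^ 2 * ‖Gt z‖ ^ 2 +
      (ω + n3 * z.1 + ρ * z.2) ^ 2 * ‖G z‖ ^ 2) ∂hpm := by
  have hT0 := theta0_nonneg
  set S := Real.sqrt (Theta0 ^ 2 * ρ ^ 2 + n3 ^ 2) with hS
  have hpos : 0 < Theta0 ^ 2 * ρ ^ 2 + n3 ^ 2 := by positivity
  have S0 : 0 < S := Real.sqrt_pos.2 hpos
  have S2 : S ^ 2 = Theta0 ^ 2 * ρ ^ 2 + n3 ^ 2 := Real.sq_sqrt hpos.le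
  set a := Theta0 * ρ / S with ha
  set b := |n3| / S with hb
  have a0 : 0 ≤ a := by positivity
  have b0 : 0 ≤ b := by positivity
  have hab : a ^ 2 + b ^ 2 = 1 := by
    rw [ha, hb, div_pow, div_pow, sq_abs, mul_pow, ← add_div, ← S2]; field_simp
  have hsum : a * (ρ * Theta0) + b * |n3| = S := by
    rw [ha, hb]; field_simp; rw [S2, sq_abs]
  obtain ⟨σ, hσ, hσ2⟩ : ∃ σ : ℝ, σ * n3 = |n3| ∧ σ ^ 2 = 1 := by
    rcases abs_cases n3 with h | h
    · exact ⟨1, by linarith, by norm_num⟩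
    · exact ⟨-1, by linarith, by norm_num⟩
  refine combine H h (h * S) (fun _ => h * (a * ρ) * Theta0) (fun _ => 0) (fun _ => h * (b * |n3|))
    (fun z => a ^ 2 * (ω + n3 * z.1 + ρ * z.2) ^ 2) (fun z => b ^ 2 * (ω + n3 * z.1 + ρ * z.2) ^ 2) _
    (by fun_prop) (by fun_prop) (by fun_prop) (by fun_prop) (by fun_prop)
    (fun _ => by positivity) (fun _ => le_rfl) (fun _ => by positivity) (fun _ => by positivity)
    (fun _ => by positivity) ?_ ?_ ?_ ?_
  · intro s
    have := t4 (H.ct s) (H.dt s) T (H.zt s) (a * ρ) h (a * (ω + n3 * s)) hh (by positivity)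
    simp only [add_zero]
    refine this.trans (le_of_eq ?_)
    congr 1; ext t; congr 1; ring
  · intro t ht
    have := s2 (H.ds t ht) (H.cs t ht) T (fun s hs => H.zs s t hs)
      (Φ := fun s => σ * b * (ω + n3 * s + ρ * t) / h) (Φ' := fun s => b * |n3| / h)
      (fun s => by
        have h1 : HasDerivAt (fun s => σ * b * (ω + n3 * s + ρ * t) / h) _ s :=
          ((((((hasDerivAt_id s).const_mul n3).const_add ω).add_const (ρ * t))).const_mul (σ * b)).div_const h
        refine h1.congr_deriv ?_
        rw [← hσ]; ring) continuous_const (fun _ => by positivity) h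
    refine le_trans (le_of_eq ?_) (this.trans (le_of_eq ?_))
    · congr 1; ext s; congr 1; field_simp
    · congr 1; ext s; congr 1
      have : h ^ 2 * (σ * b * (ω + n3 * s + ρ * t) / h) ^ 2 = σ ^ 2 * (b ^ 2 * (ω + n3 * s + ρ * t) ^ 2) := by
        field_simp
      rw [this, hσ2]; ring
  · intro s
    rw [← hsum]; apply le_of_eq; ring
  · intro z
    rw [← add_mul, hab, one_mul]

lemma two_d_small {c₁ : ℝ} (hc₁ : 0 < c₁) (hc₁1 : c₁ ≤ 1) (Gp : GapC c₁) {T : ℝ} {G Gs Gt : ℝ × ℝ → ℂ}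
    (H : HP T G Gs Gt) (h n3 ρ ω : ℝ) (hh : 0 < h)
    (hρ : 1 / 2 ≤ ρ) (hρ1 : ρ ≤ 1) (hn : n3 ≠ 0) (hn1 : |n3| ≤ 1 / 2) :
    ENNReal.ofReal (h * (ρ * Theta0 + c₁ / 12 * |n3|)) * ∫⁻ z, ENNReal.ofReal (‖G z‖ ^ 2) ∂hpm ≤
    ∫⁻ z, ENNReal.ofReal (h ^ 2 * ‖Gs z‖ ^ 2 + h ^ 2 * ‖Gt z‖ ^ 2 +
      (ω + n3 * z.1 + ρ * z.2) ^ 2 * ‖G z‖ ^ 2) ∂hpm := by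
  have hT0 := theta0_nonneg
  set q := Real.sqrt (h * ρ) with hq
  have q2 : q ^ 2 = h * ρ := Real.sq_sqrt (by positivity)
  have q0 : 0 < q := by positivity
  set κ := c₁ / 2 with hκ
  have κ0 : 0 < κ := by positivity
  set β := |n3| / h with hβ
  have np : 0 < |n3| := abs_pos.2 hn
  have β0 : 0 < β := by positivity
  let σ : ℝ → ℝ := fun s => s + (ω + Real.sqrt Theta0 * q) / n3
  let D : ℝ → ℝ := fun s => Real.sqrt (1 + β * σ s ^ 2)
  have D2 : ∀ s, D s ^ 2 = 1 + β * σ s ^ 2 := fun s => Real.sq_sqrt (by positivity)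
  have Dp : ∀ s, 0 < D s := fun s => Real.sqrt_pos.2 (by positivity)
  have cD : Continuous D := by fun_prop
  let Φ : ℝ → ℝ := fun s => κ * β * σ s / D s
  let Φ' : ℝ → ℝ := fun s => κ * β / D s ^ 3
  have hσ : ∀ s, HasDerivAt σ 1 s := fun s => (hasDerivAt_id s).add_const _
  have hD : ∀ s, HasDerivAt D (β * σ s / D s) s := fun s => by
    have h1 : HasDerivAt (fun s => 1 + β * σ s ^ 2) (2 * β * σ s) s :=
      ((((hσ s).pow 2).const_mul β).const_add 1).congr_deriv (by simp; ring)
    refine (h1.sqrt (by positivity)).congr_deriv ?_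
    simp only [D]
    field_simp
  have hΦ : ∀ s, HasDerivAt Φ (Φ' s) s := fun s => by
    have h1 : HasDerivAt Φ _ s := ((hσ s).const_mul (κ * β)).div (hD s) (Dp s).ne'
    refine h1.congr_deriv ?_
    simp only [Φ']
    have := (Dp s).ne'
    field_simp
    rw [D2]; ring
  have hV : ∀ s, (((ω + n3 * s) / q + Real.sqrt Theta0) ^ 2) = n3 ^ 2 * σ s ^ 2 / (h * ρ) := fun s => by
    rw [← q2]; simp only [σ]; field_simp; ring
  have hN : ∀ s, h ^ 2 * Φ s ^ 2 = κ ^ 2 * (n3 ^ 2 * σ s ^ 2) / (1 + β * σ s ^ 2) := fun s => by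
    simp only [Φ]
    have e : h ^ 2 * β ^ 2 = n3 ^ 2 := by rw [hβ, div_pow, sq_abs]; field_simp
    rw [div_pow, D2, mul_pow, mul_pow, ← e]
    ring
  let V : ℝ → ℝ := fun s => h * ρ * (Theta0 + c₁ * min 1 (n3 ^ 2 * σ s ^ 2 / (h * ρ))) - h ^ 2 * Φ s ^ 2
  have hmin : ∀ s, h ^ 2 * Φ s ^ 2 ≤ κ * (h * ρ * min 1 (n3 ^ 2 * σ s ^ 2 / (h * ρ))) := by
    intro s
    rw [hN]
    have hρ0 : 0 < h * ρ := by positivity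
    rw [mul_min_of_nonneg _ _ hρ0.le, mul_one, mul_div_cancel₀ _ hρ0.ne', mul_min_of_nonneg _ _ κ0.le]
    have hden : 0 < 1 + β * σ s ^ 2 := by positivity
    have hk1 : κ ≤ 1 / 2 := by linarith
    apply le_min
    · rw [div_le_iff₀ hden]
      have e : n3 ^ 2 * σ s ^ 2 = h * |n3| * (β * σ s ^ 2) := by
        rw [hβ, ← sq_abs n3]; field_simp
      rw [e]
      have h1 : h * |n3| * (β * σ s ^ 2) ≤ h * ρ * (1 + β * σ s ^ 2) := by
        have h2 : 0 ≤ β * σ s ^ 2 := by positivity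
        have h3 : h * |n3| ≤ h * ρ := by gcongr; linarith
        nlinarith
      have h0 : 0 ≤ h * |n3| * (β * σ s ^ 2) := by positivity
      calc κ ^ 2 * (h * |n3| * (β * σ s ^ 2)) ≤ κ * (h * |n3| * (β * σ s ^ 2)) := by
            gcongr; nlinarith
        _ ≤ κ * (h * ρ * (1 + β * σ s ^ 2)) := by gcongr
        _ = _ := by ring
    · calc κ ^ 2 * (n3 ^ 2 * σ s ^ 2) / (1 + β * σ s ^ 2) ≤ κ ^ 2 * (n3 ^ 2 * σ s ^ 2) / 1 := by
            gcongr
            have : 0 ≤ β * σ s ^ 2 := by positivity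
            linarith
        _ ≤ _ := by
            rw [div_one]; gcongr; nlinarith
  have hm0 : ∀ s, 0 ≤ h * ρ * min 1 (n3 ^ 2 * σ s ^ 2 / (h * ρ)) := fun s => by
    have : 0 ≤ min 1 (n3 ^ 2 * σ s ^ 2 / (h * ρ)) := le_min zero_le_one (by positivity)
    positivity
  have hVlow : ∀ s, h * ρ * Theta0 + κ * (h * ρ * min 1 (n3 ^ 2 * σ s ^ 2 / (h * ρ))) ≤ V s := fun s => by
    simp only [V]
    have h1 := hmin s
    have : c₁ = 2 * κ := by rw [hκ]; ring
    rw [this]; linarith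
  have cσ : Continuous σ := by fun_prop
  have cΦ : Continuous Φ := continuous_iff_continuousAt.2 fun s => (hΦ s).continuousAt
  have cΦ' : Continuous Φ' := continuous_const.div (cD.pow 3) (fun s => (pow_pos (Dp s) 3).ne')
  have Φ0 : ∀ s, 0 ≤ Φ' s := fun s => by
    have := Dp s
    simp only [Φ']; positivity
  refine combine H h _ V (fun s => h ^ 2 * Φ s ^ 2) (fun s => h ^ 2 * Φ' s)
    (fun z => (ω + n3 * z.1 + ρ * z.2) ^ 2) (fun _ => 0) _
    (Continuous.measurable (by fun_prop)) (Continuous.measurable (by fun_prop))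
    (Continuous.measurable (by fun_prop)) (by fun_prop) (by fun_prop)
    ?_ (fun _ => by positivity) (fun s => ?_) (fun _ => by positivity)
    (fun _ => le_rfl) ?_ ?_ ?_ ?_
  · intro s
    refine le_trans ?_ (hVlow s)
    have := hm0 s
    positivity
  · have := Φ0 s
    positivity
  · intro s
    have := t3 hc₁.le Gp (H.ct s) (H.dt s) T (H.zt s) q ρ h (ω + n3 * s) q0 (by linarith) q2
    rw [hV, q2] at this
    simp only [V]
    rw [sub_add_cancel]
    exact this
  · intro t ht
    have := s2 (H.ds t ht) (H.cs t ht) T (fun s hs => H.zs s t hs) hΦ cΦ' Φ0 h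
    simpa using this
  · intro s
    have h1 := hVlow s
    have h2 := hm0 s
    suffices c₁ / 12 * |n3| * h ≤ κ * (h * ρ * min 1 (n3 ^ 2 * σ s ^ 2 / (h * ρ))) + h ^ 2 * Φ' s by
      nlinarith
    rcases le_total (β * σ s ^ 2) 1 with hle | hge
    · have h3 : h * |n3| * κ / 6 ≤ h ^ 2 * Φ' s := by
        simp only [Φ', hβ]
        have hD3 : D s ^ 3 ≤ 6 := by
          have h4 : D s ^ 2 ≤ 2 := by rw [D2]; linarith
          have h5 : D s ≤ 2 := by nlinarith [Dp s]
          nlinarith [Dp s]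
        have := Dp s
        have e : h ^ 2 * (κ * (|n3| / h) / D s ^ 3) = h * |n3| * κ / D s ^ 3 := by field_simp
        rw [e]
        gcongr
      have h4 : 0 ≤ κ * (h * ρ * min 1 (n3 ^ 2 * σ s ^ 2 / (h * ρ))) := by positivity
      have e : c₁ / 12 * |n3| * h = h * |n3| * κ / 6 := by rw [hκ]; ring
      linarith
    · have hρ0 : 0 < h * ρ := by positivity
      have e : n3 ^ 2 * σ s ^ 2 = h * |n3| * (β * σ s ^ 2) := by
        rw [hβ, ← sq_abs n3]; field_simp
      have h3 : h * |n3| / 2 ≤ h * ρ * min 1 (n3 ^ 2 * σ s ^ 2 / (h * ρ)) := by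
        rw [mul_min_of_nonneg _ _ hρ0.le, mul_one, mul_div_cancel₀ _ hρ0.ne', e]
        have h5 : 0 < h * |n3| := by positivity
        apply le_min
        · nlinarith
        · nlinarith
      have h4 : 0 ≤ h ^ 2 * Φ' s := by
        have := Φ0 s
        positivity
      have h5 : κ * (h * |n3| / 2) ≤ κ * (h * ρ * min 1 (n3 ^ 2 * σ s ^ 2 / (h * ρ))) := by gcongr
      have h6 : 0 < h * |n3| * c₁ := by positivity
      have e2 : κ * (h * |n3| / 2) = h * |n3| * c₁ / 4 := by rw [hκ]; ring
      linarith
  · intro z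
    simp

def TwoD (c : ℝ) : Prop := ∀ (T : ℝ) (G Gs Gt : ℝ × ℝ → ℂ), HP T G Gs Gt → ∀ h n3 ρ ω : ℝ, 0 < h →
    0 ≤ ρ → n3 ^ 2 + ρ ^ 2 = 1 →
    ENNReal.ofReal (h * (Theta0 + c * |n3|)) * ∫⁻ z, ENNReal.ofReal (‖G z‖ ^ 2) ∂hpm ≤
    ∫⁻ z, ENNReal.ofReal (h ^ 2 * ‖Gs z‖ ^ 2 + h ^ 2 * ‖Gt z‖ ^ 2 +
      (ω + n3 * z.1 + ρ * z.2) ^ 2 * ‖G z‖ ^ 2) ∂hpm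

lemma two_d : ∃ c > 0, c ≤ 1 ∧ TwoD c := by
  obtain ⟨c₁, hc₁, hc₁1, Gp⟩ := gap_exists
  have hT0 := theta0_nonneg
  have hT1 := theta0_lt_one
  set c₂ := c₁ / 12 with hc₂
  have c₂0 : 0 < c₂ := by positivity
  have hTT : 0 < 1 - Theta0 ^ 2 := by nlinarith
  set c := min (c₂ / 2) ((1 - Theta0 ^ 2) * (c₂ / 2) / 3) with hc
  have c0 : 0 < c := by positivity
  have hcc : c ≤ c₂ / 2 := min_le_left _ _
  have hc1 : c ≤ 1 := by linarith
  refine ⟨c, c0, hc1, ?_⟩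
  intro T G Gs Gt H h n3 ρ ω hh hρ hnr
  have hn1 : |n3| ≤ 1 := by
    rw [← sq_le_one_iff_abs_le_one]; nlinarith
  have hρ1 : ρ ≤ 1 := by nlinarith
  have hρlow : 1 - |n3| ^ 2 ≤ ρ := by rw [sq_abs]; nlinarith
  have hn0 := abs_nonneg n3
  rcases eq_or_ne n3 0 with hz | hz
  · have hρe : ρ = 1 := by
      rw [hz] at hρlow; simp at hρlow; linarith
    have := combine H h (h * Theta0) (fun _ => h * ρ * Theta0) (fun _ => 0) (fun _ => 0)
      (fun z => (ω + n3 * z.1 + ρ * z.2) ^ 2) (fun _ => 0) (fun z => (ω + n3 * z.1 + ρ * z.2) ^ 2)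
      (by fun_prop) (by fun_prop) (by fun_prop) (by fun_prop) (by fun_prop)
      (fun _ => by positivity) (fun _ => le_rfl) (fun _ => le_rfl) (fun _ => by positivity)
      (fun _ => le_rfl) (fun s => by
        have := t4 (H.ct s) (H.dt s) T (H.zt s) ρ h (ω + n3 * s) hh hρ
        simpa using this) (fun t ht => by simp) (fun s => by rw [hρe]; simp) (fun z => by simp)
    rw [hz, abs_zero, mul_zero, add_zero]
    rw [hz] at this
    exact this
  rcases le_total |n3| (c₂ / 2) with hs | hs
  · have := two_d_small hc₁ hc₁1 Gp H h n3 ρ ω hh (by nlinarith) hρ1 hz (by linarith)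
    refine le_trans ?_ this
    refine mul_le_mul_left (ENNReal.ofReal_le_ofReal (mul_le_mul_of_nonneg_left ?_ hh.le)) _
    have h1 : |n3| ^ 2 ≤ c₂ / 2 * |n3| := by nlinarith
    have h2 : Theta0 * (1 - c₂ / 2 * |n3|) ≤ Theta0 * ρ := by gcongr; linarith
    have h3 : Theta0 * (c₂ / 2 * |n3|) ≤ 1 * (c₂ / 2 * |n3|) := by gcongr
    have h4 : c * |n3| ≤ c₂ / 2 * |n3| := by gcongr
    rw [← hc₂]
    linarith
  · refine le_trans ?_ (two_d_large H h n3 ρ ω hh hρ hz)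
    gcongr
    apply Real.le_sqrt_of_sq_le
    have e : Theta0 ^ 2 * ρ ^ 2 + n3 ^ 2 = Theta0 ^ 2 + (1 - Theta0 ^ 2) * |n3| ^ 2 := by
      have : ρ ^ 2 = 1 - n3 ^ 2 := by linarith
      rw [this, sq_abs]; ring
    rw [e]
    have h1 : 3 * c ≤ (1 - Theta0 ^ 2) * (c₂ / 2) := by
      have : c ≤ (1 - Theta0 ^ 2) * (c₂ / 2) / 3 := min_le_right _ _
      linarith
    have h2 : 3 * c ≤ (1 - Theta0 ^ 2) * |n3| := h1.trans (by gcongr)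
    have h3 : 3 * c * |n3| ≤ (1 - Theta0 ^ 2) * |n3| * |n3| := by gcongr
    have h4 : (c * |n3|) ^ 2 ≤ c * |n3| := by
      have : c * |n3| ≤ 1 := by nlinarith
      have : 0 ≤ c * |n3| := by positivity
      nlinarith
    have h5 : Theta0 * (c * |n3|) ≤ 1 * (c * |n3|) := by gcongr
    nlinarith

end MagAux

namespace MagAux

lemma hpm_eq : hpm = (volume : Measure (ℝ × ℝ)).restrict {p : ℝ × ℝ | 0 < p.2} := by
  have : {p : ℝ × ℝ | 0 < p.2} = Set.univ ×ˢ Set.Ioi 0 := by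
    ext p; simp
  rw [hpm, this, Measure.volume_eq_prod, ← Measure.prod_restrict, Measure.restrict_univ]

lemma measSet_hp : MeasurableSet {p : ℝ × ℝ | 0 < p.2} :=
  measurableSet_lt measurable_const measurable_snd

lemma plancherel_ofReal {f : ℝ → ℂ} (hf : ContDiff ℝ (⊤ : ℕ∞) f) (hc : HasCompactSupport f) :
    ∫⁻ ξ, ENNReal.ofReal (‖FourierTransform.fourier f ξ‖ ^ 2) = ∫⁻ r, ENNReal.ofReal (‖f r‖ ^ 2) := by
  set F := hc.toSchwartzMap hf with hF
  have h1 := SchwartzMap.integral_norm_sq_fourier F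
  have e : ∀ ξ, (FourierTransform.fourier F) ξ = FourierTransform.fourier f ξ := fun ξ => by
    rw [SchwartzMap.fourier_coe]; rfl
  have i1 : Integrable (fun ξ => ‖(FourierTransform.fourier F) ξ‖ ^ 2) :=
    (memLp_two_iff_integrable_sq_norm (SchwartzMap.continuous (FourierTransform.fourier F)).aestronglyMeasurable).1
      (SchwartzMap.memLp (FourierTransform.fourier F) 2 volume)
  have i2 : Integrable (fun ξ => ‖F ξ‖ ^ 2) :=
    (memLp_two_iff_integrable_sq_norm (SchwartzMap.continuous F).aestronglyMeasurable).1
      (SchwartzMap.memLp F 2 volume)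
  have := congrArg ENNReal.ofReal h1
  rw [ofReal_integral_eq_lintegral_ofReal i1 (Eventually.of_forall fun _ => by simp),
    ofReal_integral_eq_lintegral_ofReal i2 (Eventually.of_forall fun _ => by simp)] at this
  simp only [e] at this
  exact this

/-- Admissible functions on the model half space, coordinates `((s,t),r)`. -/
structure MW (R : ℝ) (W : (ℝ × ℝ) × ℝ → ℂ) : Prop where
  cd : ContDiffOn ℝ (⊤ : ℕ∞) W {z | 0 < z.1.2}
  z0 : ∀ z, z.1.2 ≤ 0 → W z = 0
  zR : ∀ z, R < ‖z‖ → W z = 0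

def FW (W : (ℝ × ℝ) × ℝ → ℂ) (ξ : ℝ) (p : ℝ × ℝ) : ℂ :=
  FourierTransform.fourier (fun r => W (p, r)) ξ

lemma isOpen_mh : IsOpen {z : (ℝ × ℝ) × ℝ | 0 < z.1.2} :=
  isOpen_lt continuous_const (by fun_prop)

lemma MW.meas {R : ℝ} {W : (ℝ × ℝ) × ℝ → ℂ} (H : MW R W) : Measurable W := by
  classical
  have : W = {z : (ℝ × ℝ) × ℝ | 0 < z.1.2}.piecewise W (fun _ => 0) := by
    ext z
    by_cases hz : z ∈ {z : (ℝ × ℝ) × ℝ | 0 < z.1.2}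
    · rw [Set.piecewise_eq_of_mem _ _ _ hz]
    · rw [Set.piecewise_eq_of_notMem _ _ _ hz]
      exact H.z0 z (not_lt.1 hz)
  rw [this]
  exact ContinuousOn.measurable_piecewise H.cd.continuousOn continuousOn_const isOpen_mh.measurableSet

lemma FW_eq (W : (ℝ × ℝ) × ℝ → ℂ) (ξ : ℝ) (p : ℝ × ℝ) :
    FW W ξ p = convolution (fun r => ((Real.fourierChar (-(r * ξ)) : Circle) : ℂ)) (fun x => W (p, -x))
      (ContinuousLinearMap.mul ℝ ℂ) volume 0 := by
  rw [FW, Real.fourier_real_eq, convolution]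
  congr 1; ext r
  simp [Circle.smul_def]

lemma MW.slice {R : ℝ} {W : (ℝ × ℝ) × ℝ → ℂ} (H : MW R W) (p : ℝ × ℝ) (hp : 0 < p.2) :
    ContDiff ℝ (⊤ : ℕ∞) (fun r => W (p, r)) ∧ HasCompactSupport (fun r => W (p, r)) := by
  constructor
  · rw [contDiff_iff_contDiffAt]
    intro r
    have h1 : ContDiffAt ℝ (⊤ : ℕ∞) W (p, r) := H.cd.contDiffAt (isOpen_mh.mem_nhds hp)
    exact h1.comp r (by fun_prop)
  · apply HasCompactSupport.intro (isCompact_closedBall (0:ℝ) R)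
    intro r hr
    apply H.zR
    rw [mem_closedBall_zero_iff, not_le] at hr
    exact hr.trans_le (le_max_right _ _)

lemma MW.FW_smooth {R : ℝ} {W : (ℝ × ℝ) × ℝ → ℂ} (H : MW R W) (ξ : ℝ) :
    ContDiffOn ℝ (⊤ : ℕ∞) (FW W ξ) {p | 0 < p.2} := by
  have e : FW W ξ = fun p => convolution (fun r => ((Real.fourierChar (-(r * ξ)) : Circle) : ℂ)) (fun x => W (p, -x))
      (ContinuousLinearMap.mul ℝ ℂ) volume 0 := by
    ext p; exact FW_eq W ξ p
  rw [e]
  refine contDiffOn_convolution_right_with_param_comp (n := ⊤) (g := fun p x => W (p, -x)) _ contDiffOn_const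
    (isOpen_lt continuous_const continuous_snd) (isCompact_closedBall (0:ℝ) R) ?_ ?_ ?_
  · intro p x _ hx
    apply H.zR
    rw [mem_closedBall_zero_iff, not_le] at hx
    refine hx.trans_le ?_
    simp [Prod.norm_def]
  · apply Continuous.locallyIntegrable
    fun_prop
  · refine H.cd.comp (t := {z | 0 < z.1.2}) (f := fun z : (ℝ × ℝ) × ℝ => (z.1, -z.2)) (by fun_prop) ?_
    rintro ⟨p, x⟩ ⟨hp, -⟩
    exact hp

lemma MW.FW_hasFDeriv {R : ℝ} {W : (ℝ × ℝ) × ℝ → ℂ} (H : MW R W) (ξ : ℝ) (p : ℝ × ℝ) (hp : 0 < p.2)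
    (v : ℝ × ℝ) :
    fderiv ℝ (FW W ξ) p v = FW (fun z => fderiv ℝ W z (v, 0)) ξ p := by
  have ho : IsOpen {p : ℝ × ℝ | 0 < p.2} := isOpen_lt continuous_const continuous_snd
  set f : ℝ → ℂ := fun r => ((Real.fourierChar (-(r * ξ)) : Circle) : ℂ) with hf
  have lf : LocallyIntegrable f volume := by
    apply Continuous.locallyIntegrable
    fun_prop
  let g : (ℝ × ℝ) → ℝ → ℂ := fun p x => W (p, -x)
  have hg : ContDiffOn ℝ (⊤ : ℕ∞) ↿g ({p | 0 < p.2} ×ˢ Set.univ) := by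
    refine H.cd.comp (t := {z | 0 < z.1.2}) (f := fun z : (ℝ × ℝ) × ℝ => (z.1, -z.2)) (by fun_prop) ?_
    rintro ⟨p, x⟩ ⟨hp, -⟩
    exact hp
  have hz : ∀ p : ℝ × ℝ, ∀ x, p ∈ {p : ℝ × ℝ | 0 < p.2} → x ∉ Metric.closedBall (0:ℝ) R → g p x = 0 := by
    intro p x _ hx
    apply H.zR
    rw [mem_closedBall_zero_iff, not_le] at hx
    refine hx.trans_le ?_
    simp [Prod.norm_def]
  have h1 := hasFDerivAt_convolution_right_with_param (ContinuousLinearMap.mul ℝ ℂ) ho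
    (isCompact_closedBall (0:ℝ) R) hz lf (hg.of_le (by simp)) (p, 0) hp
  have h2 : HasFDerivAt (fun p : ℝ × ℝ => (p, (0:ℝ))) (ContinuousLinearMap.inl ℝ (ℝ × ℝ) ℝ) p :=
    (ContinuousLinearMap.inl ℝ (ℝ × ℝ) ℝ).hasFDerivAt
  have h3 := h1.comp p h2
  have e : FW W ξ = (fun q : (ℝ × ℝ) × ℝ => convolution f (g q.1) (ContinuousLinearMap.mul ℝ ℂ) volume q.2) ∘
      (fun p : ℝ × ℝ => (p, (0:ℝ))) := by
    ext p; exact FW_eq W ξ p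
  rw [e, h3.fderiv]
  simp only [ContinuousLinearMap.comp_apply, ContinuousLinearMap.inl_apply]
  have hop : IsOpen ({p : ℝ × ℝ | 0 < p.2} ×ˢ (Set.univ : Set ℝ)) := ho.prod isOpen_univ
  have cg : Continuous (fun x : ℝ => fderiv ℝ ↿g (p, x)) := by
    have := hg.continuousOn_fderiv_of_isOpen hop (by simp)
    exact this.comp_continuous (by fun_prop) (fun x => ⟨hp, trivial⟩)
  have sg : HasCompactSupport (fun x : ℝ => fderiv ℝ ↿g (p, x)) := by
    apply HasCompactSupport.intro (isCompact_closedBall (0:ℝ) R)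
    intro x hx
    have : (↿g) =ᶠ[𝓝 (p, x)] fun _ => 0 := by
      have hm : {p : ℝ × ℝ | 0 < p.2} ×ˢ (Metric.closedBall (0:ℝ) R)ᶜ ∈ 𝓝 (p, x) :=
        (ho.prod Metric.isClosed_closedBall.isOpen_compl).mem_nhds ⟨hp, hx⟩
      filter_upwards [hm] with z hz'
      exact hz z.1 z.2 hz'.1 hz'.2
    rw [this.fderiv_eq]; simp
  rw [convolution_precompR_apply _ lf sg cg, FW_eq]
  congr 1
  ext x
  have hd : HasFDerivAt W (fderiv ℝ W (p, -x)) (p, -x) :=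
    ((H.cd.contDiffAt (isOpen_mh.mem_nhds (x := (p, -x)) hp)).differentiableAt (by simp)).hasFDerivAt
  have h4 : HasFDerivAt (fun z : (ℝ × ℝ) × ℝ => (z.1, -z.2))
      ((ContinuousLinearMap.fst ℝ (ℝ × ℝ) ℝ).prod (-ContinuousLinearMap.snd ℝ (ℝ × ℝ) ℝ)) (p, x) :=
    (ContinuousLinearMap.fst ℝ (ℝ × ℝ) ℝ).hasFDerivAt.prodMk (-ContinuousLinearMap.snd ℝ (ℝ × ℝ) ℝ).hasFDerivAt
  have h5 : HasFDerivAt ↿g _ (p, x) := HasFDerivAt.comp (g := W) (p, x) hd h4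
  rw [h5.fderiv]
  simp

lemma FW_meas {W : (ℝ × ℝ) × ℝ → ℂ} (hW : Measurable W) :
    Measurable (fun q : ℝ × (ℝ × ℝ) => FW W q.1 q.2) := by
  have e : (fun q : ℝ × (ℝ × ℝ) => FW W q.1 q.2) =
      fun q => ∫ r : ℝ, ((Real.fourierChar (-(r * q.1)) : Circle) : ℂ) * W (q.2, r) := by
    ext q
    rw [FW, Real.fourier_real_eq]
    congr 1
  rw [e]
  apply StronglyMeasurable.measurable
  apply StronglyMeasurable.integral_prod_right
  apply Measurable.stronglyMeasurable
  have h1 : Measurable (fun z : (ℝ × (ℝ × ℝ)) × ℝ => ((Real.fourierChar (-(z.2 * z.1.1)) : Circle) : ℂ)) :=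
    Continuous.measurable (by fun_prop)
  exact h1.mul (hW.comp (by fun_prop))

lemma MW.d_slice {R : ℝ} {W : (ℝ × ℝ) × ℝ → ℂ} (H : MW R W) (v : (ℝ × ℝ) × ℝ) (p : ℝ × ℝ) (hp : 0 < p.2) :
    ContDiff ℝ (⊤ : ℕ∞) (fun r => fderiv ℝ W (p, r) v) ∧ HasCompactSupport (fun r => fderiv ℝ W (p, r) v) := by
  constructor
  · rw [contDiff_iff_contDiffAt]
    intro r
    have h1 : ContDiffAt ℝ (⊤ : ℕ∞) W (p, r) := H.cd.contDiffAt (isOpen_mh.mem_nhds hp)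
    have h2 : ContDiffAt ℝ (⊤ : ℕ∞) (fun z => fderiv ℝ W z v) (p, r) :=
      (h1.fderiv_right (m := (⊤ : ℕ∞)) (by simp)).clm_apply contDiffAt_const
    exact h2.comp r (by fun_prop)
  · apply HasCompactSupport.intro (isCompact_closedBall (0:ℝ) R)
    intro r hr
    have : W =ᶠ[𝓝 (p, r)] fun _ => 0 := by
      have hm : Prod.snd ⁻¹' (Metric.closedBall (0:ℝ) R)ᶜ ∈ 𝓝 (p, r) :=
        (Metric.isClosed_closedBall.isOpen_compl.preimage continuous_snd).mem_nhds hr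
      filter_upwards [hm] with z hz
      apply H.zR
      rw [Set.mem_preimage, Set.mem_compl_iff, mem_closedBall_zero_iff, not_le] at hz
      exact hz.trans_le (le_max_right _ _)
    rw [this.fderiv_eq]; simp

lemma hp_of {R : ℝ} {G Gs Gt : ℝ × ℝ → ℂ} (mG : Measurable G) (mGs : Measurable Gs) (mGt : Measurable Gt)
    (hS : ContDiffOn ℝ (⊤ : ℕ∞) G {p | 0 < p.2}) (hz : ∀ p : ℝ × ℝ, R < ‖p‖ → G p = 0)
    (hs : ∀ p : ℝ × ℝ, 0 < p.2 → fderiv ℝ G p (1, 0) = Gs p)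
    (ht : ∀ p : ℝ × ℝ, 0 < p.2 → fderiv ℝ G p (0, 1) = Gt p) : HP R G Gs Gt := by
  have ho : IsOpen {p : ℝ × ℝ | 0 < p.2} := isOpen_lt continuous_const continuous_snd
  have hd : ∀ p : ℝ × ℝ, 0 < p.2 → HasFDerivAt G (fderiv ℝ G p) p := fun p hp =>
    ((hS.contDiffAt (ho.mem_nhds hp)).differentiableAt (by simp)).hasFDerivAt
  refine ⟨mG, mGs, mGt, ?_, ?_, ?_, ?_, ?_, ?_⟩
  · intro s
    exact hS.comp (t := {p : ℝ × ℝ | 0 < p.2}) (f := fun t : ℝ => (s, t)) (by fun_prop) (fun t ht => ht)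
  · intro s t ht'
    have h1 : HasDerivAt (fun t : ℝ => (s, t)) ((0:ℝ), (1:ℝ)) t :=
      (hasDerivAt_const t s).prodMk (hasDerivAt_id t)
    have h2 := (hd (s, t) ht').comp_hasDerivAt t h1
    rwa [ht (s, t) ht'] at h2
  · intro s t ht
    apply hz
    exact (ht.trans_le (le_abs_self t)).trans_le (le_max_right _ _)
  · intro t ht' s
    have h1 : HasDerivAt (fun s : ℝ => (s, t)) ((1:ℝ), (0:ℝ)) s :=
      (hasDerivAt_id s).prodMk (hasDerivAt_const s t)
    have h2 := (hd (s, t) ht').comp_hasDerivAt s h1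
    rwa [hs (s, t) ht'] at h2
  · intro t ht'
    have e : (fun s => Gs (s, t)) = fun s => fderiv ℝ G (s, t) (1, 0) := by
      ext s; rw [hs (s, t) ht']
    rw [e]
    have := hS.continuousOn_fderiv_of_isOpen ho (by simp)
    have h2 : Continuous (fun s : ℝ => fderiv ℝ G (s, t)) :=
      this.comp_continuous (by fun_prop) (fun x => ht')
    exact h2.clm_apply continuous_const
  · intro s t hs
    apply hz
    exact hs.trans_le (le_max_left _ _)

lemma MW.hp {R : ℝ} {W : (ℝ × ℝ) × ℝ → ℂ} (H : MW R W) (ξ : ℝ) :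
    HP R (FW W ξ) (FW (fun z => fderiv ℝ W z ((1, 0), 0)) ξ) (FW (fun z => fderiv ℝ W z ((0, 1), 0)) ξ) := by
  have hm1 : ∀ v, Measurable (fun z => fderiv ℝ W z v) := fun v => measurable_fderiv_apply_const ℝ W v
  have hz : ∀ p : ℝ × ℝ, R < ‖p‖ → FW W ξ p = 0 := by
    intro p hp
    have : (fun r => W (p, r)) = fun _ => 0 := by
      ext r; apply H.zR; exact hp.trans_le (le_max_left _ _)
    rw [FW, this, Real.fourier_real_eq]
    simp
  have mp : Measurable fun p : ℝ × ℝ => (ξ, p) := by fun_prop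
  have h1 := (FW_meas H.meas).comp mp
  have h2 := (FW_meas (hm1 ((1, 0), 0))).comp mp
  have h3 := (FW_meas (hm1 ((0, 1), 0))).comp mp
  exact hp_of h1 h2 h3 (H.FW_smooth ξ) hz (fun p hp => H.FW_hasFDeriv ξ p hp _)
    (fun p hp => H.FW_hasFDeriv ξ p hp _)

lemma fourier_aux {g g' : ℝ → ℂ} (ig : Integrable g) (dg : Differentiable ℝ g) (e : deriv g = g')
    (ig' : Integrable g') (h a ξ : ℝ) :
    FourierTransform.fourier (fun r => -(Complex.I * h) * g' r + (a : ℂ) * g r) ξ =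
      ((2 * Real.pi * h * ξ + a : ℝ) : ℂ) * FourierTransform.fourier g ξ := by
  have h1 := congrFun (Real.fourier_deriv ig dg (by rw [e]; exact ig')) ξ
  rw [e] at h1
  have h2 : FourierTransform.fourier (fun r => -(Complex.I * h) * g' r + (a : ℂ) * g r) ξ =
      -(Complex.I * h) * FourierTransform.fourier g' ξ + a * FourierTransform.fourier g ξ := by
    have h3 : (fun r => -(Complex.I * h) * g' r + (a : ℂ) * g r) = ((-(Complex.I * h)) • g') + (a : ℂ) • g := by
      ext r; simp
    rw [h3, Real.fourier_eq, Real.fourier_eq, Real.fourier_eq, ← integral_const_mul,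
      ← integral_const_mul, ← integral_add]
    · congr 1; ext r
      simp only [Circle.smul_def, smul_eq_mul, Pi.add_apply, Pi.smul_apply]; ring
    · exact ((Real.fourierIntegral_convergent_iff ξ).2 ig').const_mul _
    · exact ((Real.fourierIntegral_convergent_iff ξ).2 ig).const_mul _
  rw [h2, h1]
  simp only [smul_eq_mul]
  push_cast
  linear_combination (-2 * h * Real.pi * ξ * FourierTransform.fourier g ξ) * Complex.I_sq

set_option maxHeartbeats 1000000 in
/-- Model estimate on the half space. -/
lemma model {c : ℝ} (hc : TwoD c) {R : ℝ} {W : (ℝ × ℝ) × ℝ → ℂ} (H : MW R W) (h n3 ρ : ℝ) (hh : 0 < h)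
    (hρ : 0 ≤ ρ) (hnr : n3 ^ 2 + ρ ^ 2 = 1) :
    ENNReal.ofReal (h * (Theta0 + c * |n3|)) * ∫⁻ z, ENNReal.ofReal (‖W z‖ ^ 2) ∂(hpm.prod volume) ≤
    ∫⁻ z, ENNReal.ofReal (‖-(Complex.I * h) * fderiv ℝ W z (0, 1) + ((n3 * z.1.1 + ρ * z.1.2 : ℝ) : ℂ) * W z‖ ^ 2 +
      h ^ 2 * ‖fderiv ℝ W z ((1, 0), 0)‖ ^ 2 + h ^ 2 * ‖fderiv ℝ W z ((0, 1), 0)‖ ^ 2) ∂(hpm.prod volume) := by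
  have hm1 : ∀ v, Measurable (fun z => fderiv ℝ W z v) := fun v => measurable_fderiv_apply_const ℝ W v
  have hmW := H.meas
  have mG := FW_meas hmW
  have mGs := FW_meas (hm1 ((1, 0), 0))
  have mGt := FW_meas (hm1 ((0, 1), 0))
  have hmr := hm1 (0, 1)
  have hms := hm1 ((1, 0), 0)
  have hmt := hm1 ((0, 1), 0)
  have e1 : ∫⁻ z, ENNReal.ofReal (‖W z‖ ^ 2) ∂(hpm.prod volume) =
      ∫⁻ ξ, ∫⁻ p, ENNReal.ofReal (‖FW W ξ p‖ ^ 2) ∂hpm := by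
    have sw : ∫⁻ ξ, ∫⁻ p, ENNReal.ofReal (‖FW W ξ p‖ ^ 2) ∂hpm = ∫⁻ p, ∫⁻ ξ, ENNReal.ofReal (‖FW W ξ p‖ ^ 2) ∂volume ∂hpm := by
      apply lintegral_lintegral_swap
      apply Measurable.aemeasurable
      exact ((mG.norm).pow_const 2).ennreal_ofReal
    rw [sw, lintegral_prod _ (by fun_prop), hpm_eq]
    apply setLIntegral_congr_fun measSet_hp
    intro p hp
    exact (plancherel_ofReal (H.slice p hp).1 (H.slice p hp).2).symm
  have e2 : ∫⁻ z, ENNReal.ofReal (‖-(Complex.I * h) * fderiv ℝ W z (0, 1) + ((n3 * z.1.1 + ρ * z.1.2 : ℝ) : ℂ) * W z‖ ^ 2 +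
      h ^ 2 * ‖fderiv ℝ W z ((1, 0), 0)‖ ^ 2 + h ^ 2 * ‖fderiv ℝ W z ((0, 1), 0)‖ ^ 2) ∂(hpm.prod volume) =
      ∫⁻ ξ : ℝ, ∫⁻ p : ℝ × ℝ, ENNReal.ofReal (h ^ 2 * ‖FW (fun z => fderiv ℝ W z ((1, 0), 0)) ξ p‖ ^ 2 +
        h ^ 2 * ‖FW (fun z => fderiv ℝ W z ((0, 1), 0)) ξ p‖ ^ 2 +
        (2 * Real.pi * h * ξ + n3 * p.1 + ρ * p.2) ^ 2 * ‖FW W ξ p‖ ^ 2) ∂hpm := by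
    have sw : ∫⁻ ξ : ℝ, ∫⁻ p : ℝ × ℝ, ENNReal.ofReal (h ^ 2 * ‖FW (fun z => fderiv ℝ W z ((1, 0), 0)) ξ p‖ ^ 2 +
        h ^ 2 * ‖FW (fun z => fderiv ℝ W z ((0, 1), 0)) ξ p‖ ^ 2 +
        (2 * Real.pi * h * ξ + n3 * p.1 + ρ * p.2) ^ 2 * ‖FW W ξ p‖ ^ 2) ∂hpm =
        ∫⁻ p : ℝ × ℝ, ∫⁻ ξ : ℝ, ENNReal.ofReal (h ^ 2 * ‖FW (fun z => fderiv ℝ W z ((1, 0), 0)) ξ p‖ ^ 2 +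
        h ^ 2 * ‖FW (fun z => fderiv ℝ W z ((0, 1), 0)) ξ p‖ ^ 2 +
        (2 * Real.pi * h * ξ + n3 * p.1 + ρ * p.2) ^ 2 * ‖FW W ξ p‖ ^ 2) ∂volume ∂hpm := by
      apply lintegral_lintegral_swap
      apply Measurable.aemeasurable
      apply Measurable.ennreal_ofReal
      exact (((mGs.norm.pow_const 2).const_mul _).add ((mGt.norm.pow_const 2).const_mul _)).add
        (Measurable.mul (by fun_prop) (mG.norm.pow_const 2))
    rw [sw, lintegral_prod _ (by fun_prop), hpm_eq]
    apply setLIntegral_congr_fun measSet_hp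
    intro p hp
    simp only
    obtain ⟨sW, cW⟩ := H.slice p hp
    obtain ⟨sr, cr⟩ := H.d_slice (0, 1) p hp
    obtain ⟨ss, cs⟩ := H.d_slice ((1, 0), 0) p hp
    obtain ⟨st, ct⟩ := H.d_slice ((0, 1), 0) p hp
    set a : ℝ := n3 * p.1 + ρ * p.2 with ha
    set f : ℝ → ℂ := fun r => -(Complex.I * h) * fderiv ℝ W (p, r) (0, 1) + (a : ℂ) * W (p, r) with hf
    have sf : ContDiff ℝ (⊤ : ℕ∞) f := (contDiff_const.mul sr).add (contDiff_const.mul sW)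
    have cf : HasCompactSupport f := (cr.mul_left).add (cW.mul_left)
    have hdr : deriv (fun r => W (p, r)) = fun r => fderiv ℝ W (p, r) (0, 1) := by
      ext r
      have hd : HasFDerivAt W (fderiv ℝ W (p, r)) (p, r) :=
        ((H.cd.contDiffAt (isOpen_mh.mem_nhds (x := (p, r)) hp)).differentiableAt (by simp)).hasFDerivAt
      have h1 : HasDerivAt (fun r : ℝ => (p, r)) ((0 : ℝ × ℝ), (1:ℝ)) r :=
        (hasDerivAt_const r p).prodMk (hasDerivAt_id r)
      exact (hd.comp_hasDerivAt r h1).deriv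
    have iW : Integrable (fun r => W (p, r)) := sW.continuous.integrable_of_hasCompactSupport cW
    have ir : Integrable (fun r => fderiv ℝ W (p, r) (0, 1)) := sr.continuous.integrable_of_hasCompactSupport cr
    have ff : ∀ ξ, FourierTransform.fourier f ξ = ((2 * Real.pi * h * ξ + a : ℝ) : ℂ) * FW W ξ p := by
      intro ξ
      exact fourier_aux iW (sW.differentiable (by simp)) hdr ir h a ξ
    have P1 := plancherel_ofReal sf cf
    have P2 := plancherel_ofReal ss cs
    have P3 := plancherel_ofReal st ct
    have m1 : Measurable (fun r => ENNReal.ofReal (‖f r‖ ^ 2)) := by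
      have := sf.continuous.measurable
      fun_prop
    have m2 : Measurable (fun r => ENNReal.ofReal (‖fderiv ℝ W (p, r) ((1, 0), 0)‖ ^ 2)) := by
      have := ss.continuous.measurable
      fun_prop
    have m4 : Measurable (fun ξ => ENNReal.ofReal (‖FW (fun z => fderiv ℝ W z ((1, 0), 0)) ξ p‖ ^ 2)) :=
      ((mGs.comp (by fun_prop : Measurable fun ξ : ℝ => (ξ, p))).norm.pow_const 2).ennreal_ofReal
    have m5 : Measurable (fun ξ => ENNReal.ofReal (‖FW (fun z => fderiv ℝ W z ((0, 1), 0)) ξ p‖ ^ 2)) :=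
      ((mGt.comp (by fun_prop : Measurable fun ξ : ℝ => (ξ, p))).norm.pow_const 2).ennreal_ofReal
    have m3 : Measurable (fun r => ENNReal.ofReal (‖fderiv ℝ W (p, r) ((0, 1), 0)‖ ^ 2)) := by
      have := st.continuous.measurable
      fun_prop
    have L : ∀ r, ENNReal.ofReal (‖f r‖ ^ 2 +
      h ^ 2 * ‖fderiv ℝ W (p, r) ((1, 0), 0)‖ ^ 2 + h ^ 2 * ‖fderiv ℝ W (p, r) ((0, 1), 0)‖ ^ 2) =
      ENNReal.ofReal (‖f r‖ ^ 2) + (ENNReal.ofReal (h ^ 2) * ENNReal.ofReal (‖fderiv ℝ W (p, r) ((1, 0), 0)‖ ^ 2) +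
      ENNReal.ofReal (h ^ 2) * ENNReal.ofReal (‖fderiv ℝ W (p, r) ((0, 1), 0)‖ ^ 2)) := by
      intro r
      rw [← ENNReal.ofReal_mul (by positivity), ← ENNReal.ofReal_mul (by positivity),
        ← ENNReal.ofReal_add (by positivity) (by positivity), ← ENNReal.ofReal_add (by positivity) (by positivity),
        add_assoc]
    have Rr : ∀ ξ, ENNReal.ofReal (h ^ 2 * ‖FW (fun z => fderiv ℝ W z ((1, 0), 0)) ξ p‖ ^ 2 +
        h ^ 2 * ‖FW (fun z => fderiv ℝ W z ((0, 1), 0)) ξ p‖ ^ 2 +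
        (2 * Real.pi * h * ξ + n3 * p.1 + ρ * p.2) ^ 2 * ‖FW W ξ p‖ ^ 2) =
        (ENNReal.ofReal (h ^ 2) * ENNReal.ofReal (‖FW (fun z => fderiv ℝ W z ((1, 0), 0)) ξ p‖ ^ 2) +
        ENNReal.ofReal (h ^ 2) * ENNReal.ofReal (‖FW (fun z => fderiv ℝ W z ((0, 1), 0)) ξ p‖ ^ 2)) +
        ENNReal.ofReal (‖FourierTransform.fourier f ξ‖ ^ 2) := by
      intro ξ
      rw [ff, norm_mul, mul_pow, Complex.norm_real, Real.norm_eq_abs, sq_abs,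
        ← ENNReal.ofReal_mul (by positivity), ← ENNReal.ofReal_mul (by positivity),
        ← ENNReal.ofReal_add (by positivity) (by positivity), ← ENNReal.ofReal_add (by positivity) (by positivity),
        ha, add_assoc (2 * Real.pi * h * ξ)]
    have m6 : Measurable (fun ξ => ENNReal.ofReal (h ^ 2) * ENNReal.ofReal (‖FW (fun z => fderiv ℝ W z ((1, 0), 0)) ξ p‖ ^ 2) +
        ENNReal.ofReal (h ^ 2) * ENNReal.ofReal (‖FW (fun z => fderiv ℝ W z ((0, 1), 0)) ξ p‖ ^ 2)) :=
      (m4.const_mul _).add (m5.const_mul _)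
    rw [lintegral_congr L, lintegral_congr Rr, lintegral_add_left m1, lintegral_add_left (m2.const_mul _),
      lintegral_const_mul _ m2, lintegral_const_mul _ m3,
      lintegral_add_left m6, lintegral_add_left (m4.const_mul _),
      lintegral_const_mul _ m4, lintegral_const_mul _ m5, P1]
    have q2 : ∫⁻ ξ, ENNReal.ofReal (‖FW (fun z => fderiv ℝ W z ((1, 0), 0)) ξ p‖ ^ 2) =
      ∫⁻ r, ENNReal.ofReal (‖fderiv ℝ W (p, r) ((1, 0), 0)‖ ^ 2) := P2
    have q3 : ∫⁻ ξ, ENNReal.ofReal (‖FW (fun z => fderiv ℝ W z ((0, 1), 0)) ξ p‖ ^ 2) =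
      ∫⁻ r, ENNReal.ofReal (‖fderiv ℝ W (p, r) ((0, 1), 0)‖ ^ 2) := P3
    rw [q2, q3, add_comm]
  rw [e1, e2, ← lintegral_const_mul' _ _ ENNReal.ofReal_ne_top]
  apply lintegral_mono
  intro ξ
  exact hc R _ _ _ (H.hp ξ) h n3 ρ (2 * Real.pi * h * ξ) hh hρ hnr

end MagAux

namespace MagAux

def hs (L : E3 →L[ℝ] ℂ) : ℝ := ∑ j : Fin 3, ‖L (EuclideanSpace.single j 1)‖ ^ 2

lemma hs_nonneg (L : E3 →L[ℝ] ℂ) : 0 ≤ hs L := Finset.sum_nonneg fun _ _ => by positivity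

lemma norm_dual_sq (l : E3 →L[ℝ] ℝ) : ‖l‖ ^ 2 = ∑ j : Fin 3, (l (EuclideanSpace.single j 1)) ^ 2 := by
  obtain ⟨a, rfl⟩ := (InnerProductSpace.toDual ℝ E3).surjective l
  rw [LinearIsometryEquiv.norm_map, EuclideanSpace.norm_sq_eq]
  apply Finset.sum_congr rfl
  intro j _
  rw [InnerProductSpace.toDual_apply_apply, EuclideanSpace.inner_single_right]
  simp

lemma hs_eq (L : E3 →L[ℝ] ℂ) : hs L = ‖Complex.reCLM ∘L L‖ ^ 2 + ‖Complex.imCLM ∘L L‖ ^ 2 := by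
  rw [norm_dual_sq, norm_dual_sq, ← Finset.sum_add_distrib, hs]
  apply Finset.sum_congr rfl
  intro j _
  rw [Complex.sq_norm, Complex.normSq_apply]
  simp [sq]

lemma dual_comp_ge (l : E3 →L[ℝ] ℝ) (Q : E3 ≃ₗᵢ[ℝ] E3) (T : E3 →L[ℝ] E3) (e : ℝ)
    (he : ‖T - (Q.toContinuousLinearEquiv : E3 →L[ℝ] E3)‖ ≤ e) : (1 - e) * ‖l‖ ≤ ‖l ∘L T‖ := by
  have h1 : l ∘L T = l ∘L (Q.toContinuousLinearEquiv : E3 →L[ℝ] E3) +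
      l ∘L (T - (Q.toContinuousLinearEquiv : E3 →L[ℝ] E3)) := by
    ext x; simp
  have h2 : ‖l ∘L (Q.toContinuousLinearEquiv : E3 →L[ℝ] E3)‖ = ‖l‖ := by
    apply le_antisymm
    · refine ContinuousLinearMap.opNorm_le_bound _ (norm_nonneg _) fun x => ?_
      have := l.le_opNorm (Q x)
      rwa [Q.norm_map] at this
    · refine ContinuousLinearMap.opNorm_le_bound _ (norm_nonneg _) fun x => ?_
      have := (l ∘L (Q.toContinuousLinearEquiv : E3 →L[ℝ] E3)).le_opNorm (Q.symm x)
      rw [Q.symm.norm_map] at this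
      simpa using this
  have h3 : ‖l ∘L (T - (Q.toContinuousLinearEquiv : E3 →L[ℝ] E3))‖ ≤ ‖l‖ * e :=
    (ContinuousLinearMap.opNorm_comp_le _ _).trans (mul_le_mul_of_nonneg_left he (norm_nonneg _))
  have h4 := norm_sub_le_norm_add (l ∘L (Q.toContinuousLinearEquiv : E3 →L[ℝ] E3)) (l ∘L (T - (Q.toContinuousLinearEquiv : E3 →L[ℝ] E3)))
  rw [← h1, h2] at h4
  linarith

lemma hs_comp_ge (L : E3 →L[ℝ] ℂ) (Q : E3 ≃ₗᵢ[ℝ] E3) (T : E3 →L[ℝ] E3) (e : ℝ) (e1 : e ≤ 1)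
    (he : ‖T - (Q.toContinuousLinearEquiv : E3 →L[ℝ] E3)‖ ≤ e) : (1 - e) ^ 2 * hs L ≤ hs (L ∘L T) := by
  rw [hs_eq, hs_eq]
  have h1 := dual_comp_ge (Complex.reCLM ∘L L) Q T e he
  have h2 := dual_comp_ge (Complex.imCLM ∘L L) Q T e he
  have p1 : 0 ≤ (1 - e) * ‖Complex.reCLM ∘L L‖ := mul_nonneg (by linarith) (norm_nonneg _)
  have p2 : 0 ≤ (1 - e) * ‖Complex.imCLM ∘L L‖ := mul_nonneg (by linarith) (norm_nonneg _)
  have q1 := pow_le_pow_left₀ p1 h1 2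
  have q2 := pow_le_pow_left₀ p2 h2 2
  rw [← ContinuousLinearMap.comp_assoc, ← ContinuousLinearMap.comp_assoc]
  nlinarith

lemma hs_sub_ge (L N : E3 →L[ℝ] ℂ) (ε : ℝ) (he : 0 < ε) :
    (1 - ε) * hs L ≤ hs (L - N) + ε⁻¹ * hs N := by
  unfold hs
  rw [Finset.mul_sum, Finset.mul_sum, ← Finset.sum_add_distrib]
  apply Finset.sum_le_sum
  intro j _
  set a := L (EuclideanSpace.single j 1)
  set b := N (EuclideanSpace.single j 1)
  have h0 : (L - N) (EuclideanSpace.single j 1) = a - b := rfl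
  rw [h0]
  have h1 : ‖a‖ ≤ ‖a - b‖ + ‖b‖ := by simpa using norm_add_le (a - b) b
  have h2 : (‖a‖ - ‖b‖) ^ 2 ≤ ‖a - b‖ ^ 2 := by
    rw [← sq_abs, ]
    exact pow_le_pow_left₀ (abs_nonneg _) (abs_norm_sub_norm_le a b) 2
  have h3 : ε⁻¹ * (ε * ‖a‖ - ‖b‖) ^ 2 = ε * ‖a‖ ^ 2 - 2 * ‖a‖ * ‖b‖ + ε⁻¹ * ‖b‖ ^ 2 := by
    field_simp; ring
  have h4 : 0 ≤ ε⁻¹ * (ε * ‖a‖ - ‖b‖) ^ 2 := by positivity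
  nlinarith [sq_nonneg ‖b‖]

lemma hs_smul (w : ℂ) (L : E3 →L[ℝ] ℂ) : hs (w • L) = ‖w‖ ^ 2 * hs L := by
  simp [hs, Finset.mul_sum, mul_pow]

lemma hs_ofReal (l : E3 →L[ℝ] ℝ) : hs (Complex.ofRealCLM ∘L l) = ‖l‖ ^ 2 := by
  rw [norm_dual_sq, hs]
  simp

lemma hs_zero : hs 0 = 0 := by simp [hs]

lemma hs_cont : Continuous hs := by
  unfold hs
  fun_prop

/-- Magnetic differential with one-form potential. -/
def MD (a : E3 → E3 →L[ℝ] ℝ) (h : ℝ) (v : E3 → ℂ) (x : E3) : E3 →L[ℝ] ℂ :=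
  (-(Complex.I * h)) • fderiv ℝ v x - (v x) • (Complex.ofRealCLM ∘L a x)

def H3 : Set E3 := {z | 0 < z 2}

lemma isOpen_H3 : IsOpen H3 := isOpen_lt continuous_const (by fun_prop)

structure MWE (R : ℝ) (W : E3 → ℂ) : Prop where
  cd : ContDiffOn ℝ (⊤ : ℕ∞) W H3
  z0 : ∀ z, z ∉ H3 → W z = 0
  zR : ∀ z, R < ‖z‖ → W z = 0

def alph (n3 ρ : ℝ) (z : E3) : E3 →L[ℝ] ℝ := (-(n3 * z 1 + ρ * z 2)) • (EuclideanSpace.proj 0 : E3 →L[ℝ] ℝ)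

def jE (z : E3) : (ℝ × ℝ) × ℝ := ((z 1, z 2), z 0)

lemma jE_mp : MeasurePreserving jE volume volume := by
  have h1 := EuclideanSpace.volume_preserving_symm_measurableEquiv_toLp (Fin 3)
  have h2 := volume_preserving_piFinSuccAbove (fun _ : Fin 3 => ℝ) 0
  have h3 := (MeasurePreserving.id (volume : Measure ℝ)).prod (volume_preserving_piFinTwo (fun _ : Fin 2 => ℝ))
  have h4 : MeasurePreserving (Prod.swap : ℝ × (ℝ × ℝ) → (ℝ × ℝ) × ℝ) volume volume := Measure.measurePreserving_swap
  exact h4.comp (h3.comp (h2.comp h1))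

def jI : ((ℝ × ℝ) × ℝ) →L[ℝ] E3 :=
  (ContinuousLinearMap.snd ℝ (ℝ × ℝ) ℝ).smulRight (EuclideanSpace.single 0 1) +
  ((ContinuousLinearMap.fst ℝ ℝ ℝ) ∘L (ContinuousLinearMap.fst ℝ (ℝ × ℝ) ℝ)).smulRight (EuclideanSpace.single 1 1) +
  ((ContinuousLinearMap.snd ℝ ℝ ℝ) ∘L (ContinuousLinearMap.fst ℝ (ℝ × ℝ) ℝ)).smulRight (EuclideanSpace.single 2 1)

lemma jI_0 (p : (ℝ × ℝ) × ℝ) : jI p 0 = p.2 := by simp [jI]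
lemma jI_1 (p : (ℝ × ℝ) × ℝ) : jI p 1 = p.1.1 := by simp [jI]
lemma jI_2 (p : (ℝ × ℝ) × ℝ) : jI p 2 = p.1.2 := by simp [jI]

lemma jI_jE (z : E3) : jI (jE z) = z := by
  ext i
  fin_cases i
  · exact jI_0 _
  · exact jI_1 _
  · exact jI_2 _

lemma modelE {c : ℝ} (hc : TwoD c) {R : ℝ} {W : E3 → ℂ} (H : MWE R W) (h n3 ρ : ℝ) (hh : 0 < h)
    (hρ : 0 ≤ ρ) (hnr : n3 ^ 2 + ρ ^ 2 = 1) :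
    ENNReal.ofReal (h * (Theta0 + c * |n3|)) * ∫⁻ z in H3, ENNReal.ofReal (‖W z‖ ^ 2) ≤
    ∫⁻ z in H3, ENNReal.ofReal (hs (MD (alph n3 ρ) h W z)) := by
  have hM : MW (R * 1) (fun p => W (jI p)) := by
    refine ⟨?_, ?_, ?_⟩
    · refine H.cd.comp jI.contDiff.contDiffOn ?_
      intro p hp
      show 0 < jI p 2
      rw [jI_2]; exact hp
    · intro p hp
      apply H.z0
      show ¬ (0 < jI p 2)
      rw [jI_2]; exact not_lt.2 hp
    · intro p hp
      apply H.zR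
      rw [mul_one] at hp
      refine hp.trans_le ?_
      have a0 := PiLp.norm_apply_le (jI p) 0
      have a1 := PiLp.norm_apply_le (jI p) 1
      have a2 := PiLp.norm_apply_le (jI p) 2
      rw [jI_0] at a0; rw [jI_1] at a1; rw [jI_2] at a2
      exact max_le (max_le a1 a2) a0
  have key := model hc hM h n3 ρ hh hρ hnr
  have hmu : hpm.prod (volume : Measure ℝ) = (volume : Measure ((ℝ × ℝ) × ℝ)).restrict {p | 0 < p.1.2} := by
    have : {p : (ℝ × ℝ) × ℝ | 0 < p.1.2} = {p : ℝ × ℝ | 0 < p.2} ×ˢ Set.univ := by ext p; simp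
    rw [this, Measure.volume_eq_prod, hpm_eq, ← Measure.prod_restrict, Measure.restrict_univ]
  have hms : MeasurableSet {p : (ℝ × ℝ) × ℝ | 0 < p.1.2} := isOpen_mh.measurableSet
  have hm1 : ∀ v, Measurable (fun z => fderiv ℝ (fun p => W (jI p)) z v) :=
    fun v => measurable_fderiv_apply_const ℝ _ v
  have hmW := hM.meas
  have hmr := hm1 (0, 1)
  have hms' := hm1 ((1, 0), 0)
  have hmt := hm1 ((0, 1), 0)
  have hpre : jE ⁻¹' {p : (ℝ × ℝ) × ℝ | 0 < p.1.2} = H3 := rfl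
  have mm1 : Measurable fun z => ENNReal.ofReal (‖W (jI z)‖ ^ 2) := (hmW.norm.pow_const 2).ennreal_ofReal
  have mm2 : Measurable fun z : (ℝ × ℝ) × ℝ => ENNReal.ofReal
      (‖-(Complex.I * h) * fderiv ℝ (fun p => W (jI p)) z (0, 1) + ((n3 * z.1.1 + ρ * z.1.2 : ℝ) : ℂ) * W (jI z)‖ ^ 2 +
        h ^ 2 * ‖fderiv ℝ (fun p => W (jI p)) z ((1, 0), 0)‖ ^ 2 +
      h ^ 2 * ‖fderiv ℝ (fun p => W (jI p)) z ((0, 1), 0)‖ ^ 2) := by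
    have q : Measurable fun z : (ℝ × ℝ) × ℝ => ((n3 * z.1.1 + ρ * z.1.2 : ℝ) : ℂ) := by fun_prop
    exact (((((hmr.const_mul _).add (q.mul hmW)).norm.pow_const 2).add
      ((hms'.norm.pow_const 2).const_mul _)).add ((hmt.norm.pow_const 2).const_mul _)).ennreal_ofReal
  rw [hmu, ← jE_mp.setLIntegral_comp_preimage hms mm1,
    ← jE_mp.setLIntegral_comp_preimage hms mm2, hpre] at key
  simp only [jI_jE] at key
  refine key.trans (le_of_eq ?_)
  apply setLIntegral_congr_fun isOpen_H3.measurableSet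
  intro z hz
  have hd : HasFDerivAt W (fderiv ℝ W z) (jI (jE z)) := by
    rw [jI_jE]
    exact ((H.cd.contDiffAt (isOpen_H3.mem_nhds hz)).differentiableAt (by simp)).hasFDerivAt
  have hd2 : fderiv ℝ (fun p => W (jI p)) (jE z) = fderiv ℝ W z ∘L jI :=
    (hd.comp (jE z) jI.hasFDerivAt).fderiv
  have i0 : jI (0, 1) = EuclideanSpace.single 0 1 := by simp [jI]
  have i1 : jI ((1, 0), 0) = EuclideanSpace.single 1 1 := by simp [jI]
  have i2 : jI ((0, 1), 0) = EuclideanSpace.single 2 1 := by simp [jI]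
  simp only [hd2, ContinuousLinearMap.comp_apply, i0, i1, i2, hs, Fin.sum_univ_three]
  congr 2
  · congr 1
    · congr 2
      simp [MD, alph, jE]
      ring
    · simp [MD, alph, mul_pow]
  · simp [MD, alph, mul_pow]

end MagAux

namespace MagAux

lemma near_iso_bounds (Q : E3 ≃ₗᵢ[ℝ] E3) (T : E3 →L[ℝ] E3) (e : ℝ)
    (he : ‖T - (Q.toContinuousLinearEquiv : E3 →L[ℝ] E3)‖ ≤ e) (x : E3) :
    (1 - e) * ‖x‖ ≤ ‖T x‖ ∧ ‖T x‖ ≤ (1 + e) * ‖x‖ := by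
  have h1 : ‖(T - (Q.toContinuousLinearEquiv : E3 →L[ℝ] E3)) x‖ ≤ e * ‖x‖ :=
    (ContinuousLinearMap.le_opNorm _ _).trans (mul_le_mul_of_nonneg_right he (norm_nonneg _))
  have h2 : (T - (Q.toContinuousLinearEquiv : E3 →L[ℝ] E3)) x = T x - Q x := rfl
  have h3 := Q.norm_map x
  rw [h2] at h1
  have h4 := abs_le.1 ((abs_norm_sub_norm_le (T x) (Q x)).trans h1)
  constructor <;> linarith [h4.1, h4.2]

lemma det_bounds (Q : E3 ≃ₗᵢ[ℝ] E3) (T : E3 →L[ℝ] E3) (e : ℝ) (e1 : e < 1)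
    (he : ‖T - (Q.toContinuousLinearEquiv : E3 →L[ℝ] E3)‖ ≤ e) :
    (1 - e) ^ 3 ≤ |T.det| ∧ |T.det| ≤ (1 + e) ^ 3 := by
  have e0 : 0 ≤ e := (norm_nonneg _).trans he
  have hb := near_iso_bounds Q T e he
  have hinj : Function.Injective (T : E3 →ₗ[ℝ] E3) := by
    rw [← LinearMap.ker_eq_bot, LinearMap.ker_eq_bot']
    intro x hx
    have := (hb x).1
    have hx' : T x = 0 := hx
    rw [hx', norm_zero] at this
    have : ‖x‖ ≤ 0 := by
      by_contra hcon
      push Not at hcon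
      nlinarith
    simpa using this
  have hsurj : Function.Surjective (T : E3 →ₗ[ℝ] E3) := LinearMap.injective_iff_surjective.1 hinj
  have hm := Measure.addHaar_image_continuousLinearMap (volume : Measure E3) T (Metric.closedBall 0 1)
  have s1 : T '' Metric.closedBall 0 1 ⊆ Metric.closedBall 0 (1 + e) := by
    rintro _ ⟨x, hx, rfl⟩
    rw [mem_closedBall_zero_iff] at hx ⊢
    exact ((hb x).2).trans (by nlinarith [norm_nonneg x])
  have s2 : Metric.closedBall 0 (1 - e) ⊆ T '' Metric.closedBall 0 1 := by
    intro y hy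
    obtain ⟨x, rfl⟩ := hsurj y
    refine ⟨x, ?_, rfl⟩
    rw [mem_closedBall_zero_iff] at hy ⊢
    have h1 : ‖T x‖ ≤ 1 - e := hy
    have := (hb x).1
    by_contra hcon
    push Not at hcon
    nlinarith
  have b1 := measure_mono (μ := (volume : Measure E3)) s1
  have b2 := measure_mono (μ := (volume : Measure E3)) s2
  rw [hm] at b1 b2
  have fr : Module.finrank ℝ E3 = 3 := by simp
  have v0 : (volume : Measure E3) (Metric.ball 0 1) ≠ 0 := (Metric.measure_ball_pos _ _ one_pos).ne'
  have v1 : (volume : Measure E3) (Metric.ball 0 1) ≠ ⊤ := Metric.isBounded_ball.measure_lt_top.ne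
  rw [Measure.addHaar_closedBall _ _ zero_le_one, Measure.addHaar_closedBall _ _ (by linarith), fr, one_pow,
    ENNReal.ofReal_one, one_mul, ENNReal.mul_le_mul_iff_left v0 v1,
    ENNReal.ofReal_le_ofReal_iff (by positivity)] at b1
  rw [Measure.addHaar_closedBall _ _ zero_le_one, Measure.addHaar_closedBall _ _ (by linarith), fr, one_pow,
    ENNReal.ofReal_one, one_mul, ENNReal.mul_le_mul_iff_left v0 v1,
    ENNReal.ofReal_le_ofReal_iff (abs_nonneg _)] at b2
  exact ⟨b2, b1⟩

structure FD (Ω B K : Set E3) (κ : E3 → E3) (Q : E3 ≃ₗᵢ[ℝ] E3) (e : ℝ) (G : E3 → ℂ) : Prop where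
  oΩ : IsOpen Ω
  oB : IsOpen B
  cB : Convex ℝ B
  cK : IsCompact K
  KB : K ⊆ B
  sκ : ContDiff ℝ (⊤ : ℕ∞) κ
  e1 : e < 1
  hT : ∀ x ∈ B, ‖fderiv ℝ κ x - (Q.toContinuousLinearEquiv : E3 →L[ℝ] E3)‖ ≤ e
  hΩ : ∀ x ∈ B, x ∈ Ω ↔ κ x ∈ H3
  sG : ContDiffOn ℝ (⊤ : ℕ∞) G (Ω ∩ B)
  zG : ∀ x ∈ Ω ∩ B, x ∉ K → G x = 0

lemma FD.inj {Ω B K : Set E3} {κ : E3 → E3} {Q : E3 ≃ₗᵢ[ℝ] E3} {e : ℝ} {G : E3 → ℂ} (D : FD Ω B K κ Q e G) :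
    Set.InjOn κ B := by
  intro x hx y hy hxy
  have h1 := Convex.norm_image_sub_le_of_norm_fderiv_le' (𝕜 := ℝ) (f := κ) (x := x) (y := y)
    (fun x _ => (D.sκ.differentiable (by simp)) x) D.hT D.cB hx hy
  rw [hxy, sub_self, zero_sub, norm_neg] at h1
  have h2 : ‖(Q.toContinuousLinearEquiv : E3 →L[ℝ] E3) (y - x)‖ = ‖y - x‖ := Q.norm_map _
  rw [h2] at h1
  have h3 : ‖y - x‖ = 0 := by
    by_contra hne
    have : 0 < ‖y - x‖ := lt_of_le_of_ne (norm_nonneg _) (Ne.symm hne)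
    nlinarith [D.e1]
  exact (sub_eq_zero.1 (norm_eq_zero.1 h3)).symm

open Classical in
def WF (S : Set E3) (κ : E3 → E3) (G : E3 → ℂ) (z : E3) : ℂ :=
  if z ∈ κ '' S then G (Function.invFunOn κ S z) else 0

lemma FD.WF_κ {Ω B K : Set E3} {κ : E3 → E3} {Q : E3 ≃ₗᵢ[ℝ] E3} {e : ℝ} {G : E3 → ℂ} (D : FD Ω B K κ Q e G)
    {x : E3} (hx : x ∈ Ω ∩ B) : WF (Ω ∩ B) κ G (κ x) = G x := by
  have hm : κ x ∈ κ '' (Ω ∩ B) := ⟨x, hx, rfl⟩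
  rw [WF, if_pos hm]
  have i := D.inj.mono (Set.inter_subset_right : Ω ∩ B ⊆ B)
  rw [i.leftInvOn_invFunOn hx]

lemma WF_not {S : Set E3} {κ : E3 → E3} {G : E3 → ℂ} {z : E3} (hz : z ∉ κ '' S) : WF S κ G z = 0 := by
  rw [WF, if_neg hz]

lemma FD.WF_K {Ω B K : Set E3} {κ : E3 → E3} {Q : E3 ≃ₗᵢ[ℝ] E3} {e : ℝ} {G : E3 → ℂ} (D : FD Ω B K κ Q e G)
    {z : E3} (hz : z ∉ κ '' K) : WF (Ω ∩ B) κ G z = 0 := by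
  by_cases h : z ∈ κ '' (Ω ∩ B)
  · obtain ⟨x, hx, rfl⟩ := h
    rw [D.WF_κ hx]
    exact D.zG x hx fun hk => hz ⟨x, hk, rfl⟩
  · exact WF_not h

lemma FD.WF_zero {Ω B K : Set E3} {κ : E3 → E3} {Q : E3 ≃ₗᵢ[ℝ] E3} {e : ℝ} {G : E3 → ℂ} (D : FD Ω B K κ Q e G)
    {z : E3} (hz : z ∈ H3) (hn : z ∉ κ '' (Ω ∩ B)) : WF (Ω ∩ B) κ G =ᶠ[𝓝 z] fun _ => 0 := by
  have hK : z ∉ κ '' K := by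
    rintro ⟨x, hx, rfl⟩
    exact hn ⟨x, ⟨(D.hΩ x (D.KB hx)).2 hz, D.KB hx⟩, rfl⟩
  have hc : IsClosed (κ '' K) := (D.cK.image D.sκ.continuous).isClosed
  filter_upwards [hc.isOpen_compl.mem_nhds hK] with w hw
  exact D.WF_K hw

lemma FD.WF_smooth {Ω B K : Set E3} {κ : E3 → E3} {Q : E3 ≃ₗᵢ[ℝ] E3} {e : ℝ} {G : E3 → ℂ} (D : FD Ω B K κ Q e G)
    {x : E3} (hx : x ∈ Ω ∩ B) : ContDiffAt ℝ (⊤ : ℕ∞) (WF (Ω ∩ B) κ G) (κ x) := by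
  have hdet : (fderiv ℝ κ x).det ≠ 0 := by
    have := (det_bounds Q _ e D.e1 (D.hT x hx.2)).1
    have h1 : 0 < (1 - e) ^ 3 := pow_pos (by linarith [D.e1]) 3
    exact abs_pos.1 (h1.trans_le this)
  set T := (fderiv ℝ κ x).toContinuousLinearEquivOfDetNeZero hdet
  have hκ : ContDiffAt ℝ (⊤ : ℕ∞) κ x := D.sκ.contDiffAt
  have hd : HasFDerivAt κ (T : E3 →L[ℝ] E3) x := (D.sκ.differentiable (by simp) x).hasFDerivAt
  have hn : ((⊤ : ℕ∞) : WithTop ℕ∞) ≠ 0 := by simp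
  set li := hκ.localInverse hd hn
  have l1 : ContDiffAt ℝ (⊤ : ℕ∞) li (κ x) := hκ.to_localInverse hd hn
  have l2 : li (κ x) = x := hκ.localInverse_apply_image hd hn
  have l3 : ∀ᶠ w in 𝓝 (κ x), κ (li w) = w := (hκ.hasStrictFDerivAt' hd hn).eventually_right_inverse
  have oS : IsOpen (Ω ∩ B) := D.oΩ.inter D.oB
  have l4 : ∀ᶠ w in 𝓝 (κ x), li w ∈ Ω ∩ B := by
    apply l1.continuousAt.eventually_mem
    rw [l2]; exact oS.mem_nhds hx
  have l5 : WF (Ω ∩ B) κ G =ᶠ[𝓝 (κ x)] fun w => G (li w) := by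
    filter_upwards [l3, l4] with w h3 h4
    conv_lhs => rw [← h3]
    exact D.WF_κ h4
  refine ContDiffAt.congr_of_eventuallyEq ?_ l5
  have l6 : ContDiffAt ℝ (⊤ : ℕ∞) G (li (κ x)) := by
    rw [l2]; exact D.sG.contDiffAt (oS.mem_nhds hx)
  exact l6.comp (κ x) l1

lemma FD.mwe {Ω B K : Set E3} {κ : E3 → E3} {Q : E3 ≃ₗᵢ[ℝ] E3} {e : ℝ} {G : E3 → ℂ} (D : FD Ω B K κ Q e G) :
    ∃ R, MWE R (WF (Ω ∩ B) κ G) := by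
  obtain ⟨R, hR⟩ := (D.cK.image D.sκ.continuous).isBounded.exists_norm_le
  refine ⟨R, ?_, ?_, ?_⟩
  · intro z hz
    apply ContDiffAt.contDiffWithinAt
    by_cases h : z ∈ κ '' (Ω ∩ B)
    · obtain ⟨x, hx, rfl⟩ := h
      exact D.WF_smooth hx
    · exact contDiffAt_const.congr_of_eventuallyEq (D.WF_zero hz h)
  · intro z hz
    apply WF_not
    rintro ⟨x, hx, rfl⟩
    exact hz ((D.hΩ x hx.2).1 hx.1)
  · intro z hz
    apply D.WF_K
    intro hk
    exact absurd (hR z hk) (not_le.2 hz)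

lemma phase_deriv {φ : E3 → ℝ} {w : E3 → ℂ} {φ' : E3 →L[ℝ] ℝ} {w' : E3 →L[ℝ] ℂ} {x : E3} (h : ℝ) (hh : h ≠ 0)
    (hφ : HasFDerivAt φ φ' x) (hw : HasFDerivAt w w' x) (a : E3 →L[ℝ] ℝ) :
    (-(Complex.I * h)) • fderiv ℝ (fun x => Complex.exp (Complex.I * (φ x / h : ℝ)) * w x) x -
      (Complex.exp (Complex.I * (φ x / h : ℝ)) * w x) • (Complex.ofRealCLM ∘L a) =
    Complex.exp (Complex.I * (φ x / h : ℝ)) • ((-(Complex.I * h)) • w' - w x • (Complex.ofRealCLM ∘L (a - φ'))) := by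
  have h1 : HasFDerivAt (fun x => Complex.exp (Complex.I * (φ x / h : ℝ)))
      (Complex.exp (Complex.I * (φ x / h : ℝ)) • (Complex.I • (Complex.ofRealCLM ∘L (h⁻¹ • φ')))) x := by
    have h2 : HasFDerivAt (fun x => ((φ x / h : ℝ) : ℂ)) (Complex.ofRealCLM ∘L (h⁻¹ • φ')) x := by
      have h3 : HasFDerivAt (fun x => φ x / h) (h⁻¹ • φ') x := by
        simpa [div_eq_inv_mul] using hφ.const_mul h⁻¹
      exact Complex.ofRealCLM.hasFDerivAt.comp x h3
    exact (h2.const_mul Complex.I).cexp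
  rw [(h1.fun_mul hw).fderiv]
  ext v
  have hh' : (h : ℂ) ≠ 0 := by exact_mod_cast hh
  simp
  field_simp
  linear_combination (-(φ' v) * (w x) : ℂ) * Complex.I_sq

lemma FD.MD_eq {Ω B K : Set E3} {κ : E3 → E3} {Q : E3 ≃ₗᵢ[ℝ] E3} {e : ℝ} {v : E3 → ℂ} {φ : E3 → ℝ} {h : ℝ}
    (D : FD Ω B K κ Q e (fun x => Complex.exp (-(Complex.I * (φ x / h : ℝ))) * v x)) (hh : h ≠ 0)
    (sφ : ContDiff ℝ (⊤ : ℕ∞) φ) (a al : E3 → E3 →L[ℝ] ℝ) {x : E3} (hx : x ∈ Ω ∩ B) (W : E3 → ℂ)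
    (hW : W = WF (Ω ∩ B) κ (fun x => Complex.exp (-(Complex.I * (φ x / h : ℝ))) * v x)) :
    MD a h v x = Complex.exp (Complex.I * (φ x / h : ℝ)) • (MD al h W (κ x) ∘L fderiv ℝ κ x -
      W (κ x) • (Complex.ofRealCLM ∘L (a x - fderiv ℝ φ x - al (κ x) ∘L fderiv ℝ κ x))) := by
  have oS : IsOpen (Ω ∩ B) := D.oΩ.inter D.oB
  have hv : ∀ y ∈ Ω ∩ B, v y = Complex.exp (Complex.I * (φ y / h : ℝ)) * W (κ y) := by
    intro y hy
    rw [hW, D.WF_κ hy, ← mul_assoc, ← Complex.exp_add]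
    simp
  have hev : v =ᶠ[𝓝 x] fun y => Complex.exp (Complex.I * (φ y / h : ℝ)) * W (κ y) := by
    filter_upwards [oS.mem_nhds hx] with y hy using hv y hy
  have hdW : HasFDerivAt W (fderiv ℝ W (κ x)) (κ x) := by
    have := D.WF_smooth hx
    rw [← hW] at this
    exact (this.differentiableAt (by simp)).hasFDerivAt
  have hdκ : HasFDerivAt κ (fderiv ℝ κ x) x := (D.sκ.differentiable (by simp) x).hasFDerivAt
  have hdφ : HasFDerivAt φ (fderiv ℝ φ x) x := (sφ.differentiable (by simp) x).hasFDerivAt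
  have key := phase_deriv h hh hdφ (hdW.comp x hdκ) (a x)
  rw [MD, hev.fderiv_eq, hv x hx]
  simp only [Function.comp_apply] at key
  rw [key]
  congr 1
  ext w
  simp [MD]
  ring

end MagAux

namespace MagAux

lemma norm_exp_I (t : ℝ) : ‖Complex.exp (Complex.I * t)‖ = 1 := by
  rw [mul_comm]; exact Complex.norm_exp_ofReal_mul_I t

lemma norm_exp_neg_I (t : ℝ) : ‖Complex.exp (-(Complex.I * t))‖ = 1 := by
  have : -(Complex.I * (t:ℂ)) = Complex.I * ((-t : ℝ) : ℂ) := by push_cast; ring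
  rw [this]; exact norm_exp_I _

lemma LL {c : ℝ} (hc : TwoD c) (h n3 ρ : ℝ) (hh : 0 < h) (hm0 : 0 ≤ Theta0 + c * |n3|)
    (hρ : 0 ≤ ρ) (hnr : n3 ^ 2 + ρ ^ 2 = 1)
    {Ω B K : Set E3} {κ : E3 → E3} {Q : E3 ≃ₗᵢ[ℝ] E3} {e : ℝ} {v : E3 → ℂ} {φ : E3 → ℝ}
    (D : FD Ω B K κ Q e (fun x => Complex.exp (-(Complex.I * (φ x / h : ℝ))) * v x))
    (sφ : ContDiff ℝ (⊤ : ℕ∞) φ) (sv : ContDiffOn ℝ (⊤ : ℕ∞) v (Ω ∩ B)) (a : E3 → E3 →L[ℝ] ℝ) (b : ℝ)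
    (hb : ∀ x ∈ Ω ∩ B, ‖a x - fderiv ℝ φ x - alph n3 ρ (κ x) ∘L fderiv ℝ κ x‖ ≤ b) (ε : ℝ) (e0 : 0 < ε)
    (e1 : ε ≤ 1) :
    ENNReal.ofReal ((1 - ε) * (1 - e) ^ 2 * (1 - e) ^ 3 * (h * (Theta0 + c * |n3|))) *
      ∫⁻ x in Ω ∩ B, ENNReal.ofReal (‖v x‖ ^ 2) ≤
    ENNReal.ofReal ((1 + e) ^ 3) * ((∫⁻ x in Ω ∩ B, ENNReal.ofReal (hs (MD a h v x))) +
      ENNReal.ofReal (b ^ 2 / ε) * ∫⁻ x in Ω ∩ B, ENNReal.ofReal (‖v x‖ ^ 2)) := by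
  rcases (Ω ∩ B).eq_empty_or_nonempty with hE | ⟨x₁, hx₁⟩
  · simp [hE]
  have ee0 : 0 ≤ e := (norm_nonneg _).trans (D.hT x₁ hx₁.2)
  have oS : IsOpen (Ω ∩ B) := D.oΩ.inter D.oB
  obtain ⟨W, hW⟩ : ∃ W, W = WF (Ω ∩ B) κ (fun x => Complex.exp (-(Complex.I * (φ x / h : ℝ))) * v x) := ⟨_, rfl⟩
  have hWn : ∀ x ∈ Ω ∩ B, ‖W (κ x)‖ = ‖v x‖ := by
    intro x hx
    rw [hW, D.WF_κ hx, norm_mul, norm_exp_neg_I, one_mul]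
  have pt : ∀ x ∈ Ω ∩ B, (1 - ε) * (1 - e) ^ 2 * hs (MD (alph n3 ρ) h W (κ x)) ≤
      hs (MD a h v x) + b ^ 2 / ε * ‖v x‖ ^ 2 := by
    intro x hx
    rw [D.MD_eq hh.ne' sφ a (alph n3 ρ) hx W hW, hs_smul, norm_exp_I, one_pow, one_mul]
    have h1 := hs_comp_ge (MD (alph n3 ρ) h W (κ x)) Q (fderiv ℝ κ x) e D.e1.le (D.hT x hx.2)
    have h2 := hs_sub_ge (MD (alph n3 ρ) h W (κ x) ∘L fderiv ℝ κ x)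
      (W (κ x) • (Complex.ofRealCLM ∘L (a x - fderiv ℝ φ x - alph n3 ρ (κ x) ∘L fderiv ℝ κ x))) ε e0
    rw [hs_smul (W (κ x)), hs_ofReal, hWn x hx] at h2
    have h3 := pow_le_pow_left₀ (norm_nonneg _) (hb x hx) 2
    have h4 := mul_le_mul_of_nonneg_left h1 (by linarith : (0:ℝ) ≤ 1 - ε)
    have h5 : ε⁻¹ * (‖v x‖ ^ 2 * ‖a x - fderiv ℝ φ x - alph n3 ρ (κ x) ∘L fderiv ℝ κ x‖ ^ 2) ≤
        b ^ 2 / ε * ‖v x‖ ^ 2 := by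
      rw [div_eq_inv_mul, mul_assoc, mul_comm (b ^ 2)]
      gcongr
    linarith
  have hdκ : ∀ x ∈ Ω ∩ B, HasFDerivWithinAt κ (fderiv ℝ κ x) (Ω ∩ B) x := fun x _ =>
    (D.sκ.differentiable (by simp) x).hasFDerivAt.hasFDerivWithinAt
  have inj := D.inj.mono (Set.inter_subset_right : Ω ∩ B ⊆ B)
  have mI : MeasurableSet (κ '' (Ω ∩ B)) := measurable_image_of_fderivWithin oS.measurableSet hdκ inj
  have hsub : κ '' (Ω ∩ B) ⊆ H3 := by
    rintro _ ⟨x, hx, rfl⟩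
    exact (D.hΩ x hx.2).1 hx.1
  obtain ⟨R, hR⟩ := D.mwe
  rw [← hW] at hR
  have mod := modelE hc hR h n3 ρ hh hρ hnr
  have mod2 : ENNReal.ofReal (h * (Theta0 + c * |n3|)) * ∫⁻ z in κ '' (Ω ∩ B), ENNReal.ofReal (‖W z‖ ^ 2) ≤
    ∫⁻ z in κ '' (Ω ∩ B), ENNReal.ofReal (hs (MD (alph n3 ρ) h W z)) := by
    refine (mul_le_mul_right (lintegral_mono_set hsub) _).trans (mod.trans ?_)
    rw [← lintegral_indicator isOpen_H3.measurableSet, ← lintegral_indicator mI]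
    apply lintegral_mono
    intro z
    by_cases hz : z ∈ H3
    · by_cases hk : z ∈ κ '' (Ω ∩ B)
      · rw [Set.indicator_of_mem hz, Set.indicator_of_mem hk]
      · rw [Set.indicator_of_mem hz, Set.indicator_of_notMem hk]
        have := D.WF_zero hz hk
        rw [← hW] at this
        have e2 : MD (alph n3 ρ) h W z = 0 := by
          rw [MD, this.fderiv_eq, this.eq_of_nhds]
          have e9 : fderiv ℝ (fun _ : E3 => (0:ℂ)) z = 0 := by simp
          first
            | rw [e9, smul_zero, zero_smul, sub_zero]
            | (ext w; simp)
        rw [e2, hs_zero]; simp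
    · rw [Set.indicator_of_notMem hz]; exact zero_le
  rw [lintegral_image_eq_lintegral_abs_det_fderiv_mul volume oS.measurableSet hdκ inj,
    lintegral_image_eq_lintegral_abs_det_fderiv_mul volume oS.measurableSet hdκ inj] at mod2
  have A1 : ENNReal.ofReal ((1 - e) ^ 3) * ∫⁻ x in Ω ∩ B, ENNReal.ofReal (‖v x‖ ^ 2) ≤
      ∫⁻ x in Ω ∩ B, ENNReal.ofReal |(fderiv ℝ κ x).det| * ENNReal.ofReal (‖W (κ x)‖ ^ 2) := by
    rw [← lintegral_const_mul' _ _ ENNReal.ofReal_ne_top]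
    apply setLIntegral_mono' oS.measurableSet
    intro x hx
    rw [hWn x hx]
    exact mul_le_mul_left (ENNReal.ofReal_le_ofReal (det_bounds Q _ e D.e1 (D.hT x hx.2)).1) _
  have A2 : ENNReal.ofReal ((1 - ε) * (1 - e) ^ 2) *
      ∫⁻ x in Ω ∩ B, ENNReal.ofReal |(fderiv ℝ κ x).det| * ENNReal.ofReal (hs (MD (alph n3 ρ) h W (κ x))) ≤
      ENNReal.ofReal ((1 + e) ^ 3) * ((∫⁻ x in Ω ∩ B, ENNReal.ofReal (hs (MD a h v x))) +
      ENNReal.ofReal (b ^ 2 / ε) * ∫⁻ x in Ω ∩ B, ENNReal.ofReal (‖v x‖ ^ 2)) := by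
    have mv : AEMeasurable (fun x => ENNReal.ofReal (b ^ 2 / ε) * ENNReal.ofReal (‖v x‖ ^ 2)) (volume.restrict (Ω ∩ B)) := by
      have := sv.continuousOn.aemeasurable (μ := volume) oS.measurableSet
      exact ((this.norm.pow_const 2).ennreal_ofReal).const_mul _
    have c1 : ENNReal.ofReal (b ^ 2 / ε) * ∫⁻ x in Ω ∩ B, ENNReal.ofReal (‖v x‖ ^ 2) =
        ∫⁻ x in Ω ∩ B, ENNReal.ofReal (b ^ 2 / ε) * ENNReal.ofReal (‖v x‖ ^ 2) :=
      (lintegral_const_mul' _ _ ENNReal.ofReal_ne_top).symm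
    rw [c1, ← lintegral_add_right' _ mv, ← lintegral_const_mul' _ _ ENNReal.ofReal_ne_top, ← lintegral_const_mul' _ _ ENNReal.ofReal_ne_top]
    apply setLIntegral_mono' oS.measurableSet
    intro x hx
    have q := pt x hx
    have e3 : 0 ≤ 1 - e := by linarith [D.e1]
    have e4 : 0 ≤ 1 - ε := by linarith
    rw [mul_left_comm, ← ENNReal.ofReal_mul (p := (1 - ε) * (1 - e) ^ 2) (by positivity), ← ENNReal.ofReal_mul (p := b ^ 2 / ε) (by positivity),
      ← ENNReal.ofReal_add (hs_nonneg _) (by positivity)]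
    exact mul_le_mul' (ENNReal.ofReal_le_ofReal (det_bounds Q _ e D.e1 (D.hT x hx.2)).2) (ENNReal.ofReal_le_ofReal q)
  refine le_trans ?_ ((mul_le_mul_right mod2 _).trans A2)
  have e3 : 0 ≤ 1 - e := by linarith [D.e1]
  have e4 : 0 ≤ 1 - ε := by linarith
  have e5 : (1 - ε) * (1 - e) ^ 2 * (1 - e) ^ 3 * (h * (Theta0 + c * |n3|)) =
    (1 - ε) * (1 - e) ^ 2 * ((h * (Theta0 + c * |n3|)) * (1 - e) ^ 3) := by ring
  have e6 : 0 ≤ h * (Theta0 + c * |n3|) := mul_nonneg hh.le hm0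
  rw [e5, ENNReal.ofReal_mul (p := (1 - ε) * (1 - e) ^ 2) (by positivity),
    ENNReal.ofReal_mul (p := h * (Theta0 + c * |n3|)) e6, mul_assoc, mul_assoc]
  exact mul_le_mul_right (mul_le_mul_right A1 _) _

end MagAux

namespace MagAux

lemma LLr {c : ℝ} (hc : TwoD c) (h n3 ρ : ℝ) (hh : 0 < h) (hm0 : 0 ≤ Theta0 + c * |n3|) (hm2 : Theta0 + c * |n3| ≤ 2)
    (hρ : 0 ≤ ρ) (hnr : n3 ^ 2 + ρ ^ 2 = 1)
    {Ω B K : Set E3} {κ : E3 → E3} {Q : E3 ≃ₗᵢ[ℝ] E3} {e : ℝ} (he0 : 0 ≤ e) {v : E3 → ℂ} {φ : E3 → ℝ}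
    (D : FD Ω B K κ Q e (fun x => Complex.exp (-(Complex.I * (φ x / h : ℝ))) * v x))
    (sφ : ContDiff ℝ (⊤ : ℕ∞) φ) (sv : ContDiffOn ℝ (⊤ : ℕ∞) v (Ω ∩ B)) (a : E3 → E3 →L[ℝ] ℝ) (b : ℝ)
    (hb : ∀ x ∈ Ω ∩ B, ‖a x - fderiv ℝ φ x - alph n3 ρ (κ x) ∘L fderiv ℝ κ x‖ ≤ b) (ε : ℝ) (e0 : 0 < ε)
    (e1 : ε ≤ 1) :
    ENNReal.ofReal (h * (Theta0 + c * |n3|)) * (∫⁻ x in Ω ∩ B, ENNReal.ofReal (‖v x‖ ^ 2)) ≤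
    (∫⁻ x in Ω ∩ B, ENNReal.ofReal (hs (MD a h v x))) +
      ENNReal.ofReal (b ^ 2 / ε + 2 * h * (ε + 8 * e)) * ∫⁻ x in Ω ∩ B, ENNReal.ofReal (‖v x‖ ^ 2) := by
  have key := LL hc h n3 ρ hh hm0 hρ hnr D sφ sv a b hb ε e0 e1
  have he1 := D.e1
  set X := ∫⁻ x in Ω ∩ B, ENNReal.ofReal (‖v x‖ ^ 2)
  set Y := ∫⁻ x in Ω ∩ B, ENNReal.ofReal (hs (MD a h v x))
  set T := Theta0 + c * |n3|
  set P := (1 - ε) * (1 - e) ^ 2 * (1 - e) ^ 3 * (h * T)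
  have q0 : 0 < (1 + e) ^ 3 := by positivity
  have k2 : ENNReal.ofReal (((1 + e) ^ 3)⁻¹ * P) * X ≤ Y + ENNReal.ofReal (b ^ 2 / ε) * X := by
    have := mul_le_mul_right key (ENNReal.ofReal (((1 + e) ^ 3)⁻¹))
    rwa [← mul_assoc, ← mul_assoc, ← ENNReal.ofReal_mul (by positivity), ← ENNReal.ofReal_mul (by positivity),
      inv_mul_cancel₀ q0.ne', ENNReal.ofReal_one, one_mul] at this
  have hT : 0 ≤ h * T := mul_nonneg hh.le hm0
  have k3 : h * T ≤ ((1 + e) ^ 3)⁻¹ * P + 2 * h * (ε + 8 * e) := by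
    have i1 : (1 - e) ^ 3 ≤ ((1 + e) ^ 3)⁻¹ := by
      rw [le_inv_comm₀ (by apply pow_pos; linarith) q0, ← inv_pow]
      apply pow_le_pow_left₀ (by linarith)
      rw [le_inv_comm₀ (by linarith) (by linarith)]
      rw [le_inv_comm₀ (by linarith) (by linarith), ← one_div, le_div_iff₀ (by linarith)]
      nlinarith
    have bern : 1 - 8 * e ≤ (1 - e) ^ 8 := by
      have := one_add_mul_le_pow (a := -e) (by linarith) 8
      push_cast at this
      calc 1 - 8 * e = 1 + 8 * -e := by ring
        _ ≤ _ := this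
        _ = _ := by ring
    have i2 : (1 - ε - 8 * e) ≤ (1 - ε) * (1 - e) ^ 8 := by
      have := mul_le_mul_of_nonneg_left bern (by linarith : (0:ℝ) ≤ 1 - ε)
      nlinarith [mul_nonneg e0.le he0]
    have i3 : (1 - ε) * (1 - e) ^ 8 * (h * T) ≤ ((1 + e) ^ 3)⁻¹ * P := by
      have p1 : 0 ≤ P := by
        have : 0 ≤ 1 - e := by linarith
        have : 0 ≤ 1 - ε := by linarith
        positivity
      calc _ = (1 - e) ^ 3 * P := by simp only [P]; ring
        _ ≤ _ := mul_le_mul_of_nonneg_right i1 p1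
    have i4 := mul_le_mul_of_nonneg_right i2 hT
    have i5 : h * T * (ε + 8 * e) ≤ 2 * h * (ε + 8 * e) := by
      apply mul_le_mul_of_nonneg_right _ (by positivity)
      nlinarith
    nlinarith
  have p2 : 0 ≤ ((1 + e) ^ 3)⁻¹ * P := by
    have : 0 ≤ 1 - e := by linarith
    have : 0 ≤ 1 - ε := by linarith
    positivity
  calc ENNReal.ofReal (h * T) * X ≤ ENNReal.ofReal (((1 + e) ^ 3)⁻¹ * P + 2 * h * (ε + 8 * e)) * X :=
        mul_le_mul_left (ENNReal.ofReal_le_ofReal k3) _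
    _ = ENNReal.ofReal (((1 + e) ^ 3)⁻¹ * P) * X + ENNReal.ofReal (2 * h * (ε + 8 * e)) * X := by
        rw [ENNReal.ofReal_add p2 (by positivity), add_mul]
    _ ≤ Y + ENNReal.ofReal (b ^ 2 / ε) * X + ENNReal.ofReal (2 * h * (ε + 8 * e)) * X := by gcongr
    _ = _ := by rw [ENNReal.ofReal_add (by positivity) (by positivity), add_mul, add_assoc]

def QM (c d n3 ρ : ℝ) : E3 →ₗ[ℝ] E3 where
  toFun w := !₂[-d * w 0 + c * w 1, -c * n3 * w 0 - d * n3 * w 1 + ρ * w 2, -ρ * c * w 0 - ρ * d * w 1 - n3 * w 2]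
  map_add' u w := by
    ext i; fin_cases i <;> simp <;> ring
  map_smul' t w := by
    ext i; fin_cases i <;> simp <;> ring

lemma QM_norm {c d n3 ρ : ℝ} (h1 : c ^ 2 + d ^ 2 = 1) (h2 : n3 ^ 2 + ρ ^ 2 = 1) (w : E3) : ‖QM c d n3 ρ w‖ = ‖w‖ := by
  rw [← sq_eq_sq₀ (norm_nonneg _) (norm_nonneg _), EuclideanSpace.norm_sq_eq, EuclideanSpace.norm_sq_eq]
  simp only [Fin.sum_univ_three, Real.norm_eq_abs, sq_abs, QM, LinearMap.coe_mk, AddHom.coe_mk]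
  simp
  linear_combination ((c * w 0 + d * w 1) ^ 2 + w 2 ^ 2) * h2 + (w 0 ^ 2 + w 1 ^ 2) * h1

def QI (c d n3 ρ : ℝ) (h1 : c ^ 2 + d ^ 2 = 1) (h2 : n3 ^ 2 + ρ ^ 2 = 1) : E3 ≃ₗᵢ[ℝ] E3 :=
  LinearIsometry.toLinearIsometryEquiv ⟨QM c d n3 ρ, QM_norm h1 h2⟩ rfl

lemma QI_0 {c d n3 ρ : ℝ} (h1 : c ^ 2 + d ^ 2 = 1) (h2 : n3 ^ 2 + ρ ^ 2 = 1) (w : E3) :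
    QI c d n3 ρ h1 h2 w 0 = -d * w 0 + c * w 1 := by
  show QM c d n3 ρ w 0 = _
  simp [QM]
lemma QI_1 {c d n3 ρ : ℝ} (h1 : c ^ 2 + d ^ 2 = 1) (h2 : n3 ^ 2 + ρ ^ 2 = 1) (w : E3) :
    QI c d n3 ρ h1 h2 w 1 = -c * n3 * w 0 - d * n3 * w 1 + ρ * w 2 := by
  show QM c d n3 ρ w 1 = _
  simp [QM]
lemma QI_2 {c d n3 ρ : ℝ} (h1 : c ^ 2 + d ^ 2 = 1) (h2 : n3 ^ 2 + ρ ^ 2 = 1) (w : E3) :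
    QI c d n3 ρ h1 h2 w 2 = -ρ * c * w 0 - ρ * d * w 1 - n3 * w 2 := by
  show QM c d n3 ρ w 2 = _
  simp [QM]

lemma E3_decomp (w : E3) : w = w 0 • EuclideanSpace.single 0 1 + w 1 • EuclideanSpace.single 1 1 +
    w 2 • EuclideanSpace.single 2 1 := by
  ext i; fin_cases i <;> simp

lemma fderiv_comp_coord {A : E3 → E3} (hA : ContDiff ℝ (⊤ : ℕ∞) A) (x w : E3) (j : Fin 3) :
    fderiv ℝ (fun y => A y j) x w = (fderiv ℝ A x w) j := by
  have h1 := (hA.differentiable (by simp) x).hasFDerivAt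
  have h2 := ((EuclideanSpace.proj j : E3 →L[ℝ] ℝ).hasFDerivAt (x := A x)).comp x h1
  have h3 : fderiv ℝ (fun y => A y j) x = (EuclideanSpace.proj j : E3 →L[ℝ] ℝ) ∘L fderiv ℝ A x := h2.fderiv
  rw [h3]; rfl

lemma curl_sym {A : E3 → E3} (hA : ContDiff ℝ (⊤ : ℕ∞) A) (hcurl : HasUnitCurl A) (x w y : E3) :
    inner ℝ (fderiv ℝ A x w) y - inner ℝ (fderiv ℝ A x y) w = w 0 * y 1 - w 1 * y 0 := by
  obtain ⟨h1, h2, h3⟩ := hcurl x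
  simp only [fderiv_comp_coord hA] at h1 h2 h3
  have hw : ∀ j, (fderiv ℝ A x w) j = w 0 * (fderiv ℝ A x (EuclideanSpace.single 0 1)) j +
      w 1 * (fderiv ℝ A x (EuclideanSpace.single 1 1)) j + w 2 * (fderiv ℝ A x (EuclideanSpace.single 2 1)) j := by
    intro j
    conv_lhs => rw [E3_decomp w]
    simp only [map_add, map_smul]
    simp
  have hy : ∀ j, (fderiv ℝ A x y) j = y 0 * (fderiv ℝ A x (EuclideanSpace.single 0 1)) j +
      y 1 * (fderiv ℝ A x (EuclideanSpace.single 1 1)) j + y 2 * (fderiv ℝ A x (EuclideanSpace.single 2 1)) j := by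
    intro j
    conv_lhs => rw [E3_decomp y]
    simp only [map_add, map_smul]
    simp
  simp only [PiLp.inner_apply, Fin.sum_univ_three, hw, hy]
  simp
  linear_combination (w 1 * y 2 - w 2 * y 1) * h1 + (w 2 * y 0 - w 0 * y 2) * h2 + (w 0 * y 1 - w 1 * y 0) * h3

end MagAux

namespace MagAux

def Afl (A : E3 → E3) (x : E3) : E3 →L[ℝ] ℝ := innerSL ℝ (A x)

def gph (A : E3 → E3) (c d : ℝ) (x₀ x : E3) : ℝ :=
  inner ℝ (A x₀) (x - x₀) + (1 / 2) * (inner ℝ (fderiv ℝ A x₀ (x - x₀)) (x - x₀) -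
    (c * (x - x₀) 0 + d * (x - x₀) 1) * (-d * (x - x₀) 0 + c * (x - x₀) 1))

lemma gph_smooth (A : E3 → E3) (c d : ℝ) (x₀ : E3) : ContDiff ℝ (⊤ : ℕ∞) (gph A c d x₀) := by
  unfold gph
  have h1 : ContDiff ℝ (⊤ : ℕ∞) (fun x : E3 => x - x₀) := contDiff_id.sub contDiff_const
  have hj : ∀ j : Fin 3, ContDiff ℝ (⊤ : ℕ∞) (fun x : E3 => (x - x₀) j) := fun j =>
    (EuclideanSpace.proj j : E3 →L[ℝ] ℝ).contDiff.comp h1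
  have h2 : ContDiff ℝ (⊤ : ℕ∞) (fun x : E3 => fderiv ℝ A x₀ (x - x₀)) := (fderiv ℝ A x₀).contDiff.comp h1
  exact (contDiff_const.inner ℝ h1).add (contDiff_const.mul ((h2.inner ℝ h1).sub
    (((contDiff_const.mul (hj 0)).add (contDiff_const.mul (hj 1))).mul
    ((contDiff_const.mul (hj 0)).add (contDiff_const.mul (hj 1))))))

lemma gph_fderiv {A : E3 → E3} (hA : ContDiff ℝ (⊤ : ℕ∞) A) (hcurl : HasUnitCurl A) (c d : ℝ)
    (hcd : c ^ 2 + d ^ 2 = 1) (x₀ x w : E3) :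
    fderiv ℝ (gph A c d x₀) x w = inner ℝ (A x₀) w + inner ℝ (fderiv ℝ A x₀ (x - x₀)) w -
      (c * (x - x₀) 0 + d * (x - x₀) 1) * (-d * w 0 + c * w 1) := by
  have h1 : HasFDerivAt (fun x : E3 => x - x₀) (ContinuousLinearMap.id ℝ E3) x := (hasFDerivAt_id x).sub_const x₀
  have hj : ∀ j : Fin 3, HasFDerivAt (fun x : E3 => (x - x₀) j) (EuclideanSpace.proj j : E3 →L[ℝ] ℝ) x := by
    intro j
    have q : HasFDerivAt (fun x : E3 => x j) (EuclideanSpace.proj j : E3 →L[ℝ] ℝ) (x - x₀) :=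
      (EuclideanSpace.proj j : E3 →L[ℝ] ℝ).hasFDerivAt
    exact q.comp x h1
  have h2 : HasFDerivAt (fun x : E3 => fderiv ℝ A x₀ (x - x₀)) (fderiv ℝ A x₀) x :=
    ((fderiv ℝ A x₀).hasFDerivAt (x := x - x₀)).comp x h1
  have hh := ((hasFDerivAt_const (A x₀) x).inner ℝ h1).add (((h2.inner ℝ h1).sub
    ((((hj 0).const_mul c).add ((hj 1).const_mul d)).mul
    (((hj 0).const_mul (-d)).add ((hj 1).const_mul c)))).const_mul (1 / 2))
  have h3 : fderiv ℝ (gph A c d x₀) x = _ := hh.fderiv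
  rw [h3]
  have cs := curl_sym hA hcurl x₀ w (x - x₀)
  simp at cs ⊢
  linear_combination (1 / 2) * cs - (1 / 2) * (w 0 * (x 1 - x₀ 1) - w 1 * (x 0 - x₀ 0)) * hcd

def kap (Q : E3 ≃ₗᵢ[ℝ] E3) (x₀ : E3) (g : E3 → ℝ) (x : E3) : E3 := Q (x - x₀) + g x • EuclideanSpace.single 2 1

lemma kap_fderiv (Q : E3 ≃ₗᵢ[ℝ] E3) (x₀ : E3) {g : E3 → ℝ} (sg : ContDiff ℝ (⊤ : ℕ∞) g) (x : E3) :
    fderiv ℝ (kap Q x₀ g) x = (Q.toContinuousLinearEquiv : E3 →L[ℝ] E3) +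
      (fderiv ℝ g x).smulRight (EuclideanSpace.single 2 1) := by
  have h1 : HasFDerivAt (fun x : E3 => x - x₀) (ContinuousLinearMap.id ℝ E3) x := (hasFDerivAt_id x).sub_const x₀
  have h2 : HasFDerivAt (fun x : E3 => (Q.toContinuousLinearEquiv : E3 →L[ℝ] E3) (x - x₀))
      (Q.toContinuousLinearEquiv : E3 →L[ℝ] E3) x := by
    have q : HasFDerivAt (fun x : E3 => (Q.toContinuousLinearEquiv : E3 →L[ℝ] E3) x)
      (Q.toContinuousLinearEquiv : E3 →L[ℝ] E3) (x - x₀) := (Q.toContinuousLinearEquiv : E3 →L[ℝ] E3).hasFDerivAt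
    exact q.comp x h1
  have h3 := (sg.differentiable (by simp) x).hasFDerivAt.smul_const (EuclideanSpace.single (2 : Fin 3) (1:ℝ))
  exact (h2.add h3).fderiv

lemma kap_smooth (Q : E3 ≃ₗᵢ[ℝ] E3) (x₀ : E3) {g : E3 → ℝ} (sg : ContDiff ℝ (⊤ : ℕ∞) g) :
    ContDiff ℝ (⊤ : ℕ∞) (kap Q x₀ g) := by
  have h1 : ContDiff ℝ (⊤ : ℕ∞) (fun x : E3 => x - x₀) := contDiff_id.sub contDiff_const
  exact ((Q.toContinuousLinearEquiv : E3 →L[ℝ] E3).contDiff.comp h1).add (sg.smul contDiff_const)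

lemma LG {c : ℝ} (hc : TwoD c) {A : E3 → E3} (hA : ContDiff ℝ (⊤ : ℕ∞) A) (hcurl : HasUnitCurl A)
    (h n3 ρ c1 d1 : ℝ) (hh : 0 < h) (hm0 : 0 ≤ Theta0 + c * |n3|) (hm2 : Theta0 + c * |n3| ≤ 2)
    (hρ : 0 ≤ ρ) (hnr : n3 ^ 2 + ρ ^ 2 = 1) (hcd : c1 ^ 2 + d1 ^ 2 = 1)
    {Ω B K : Set E3} (oΩ : IsOpen Ω) (oB : IsOpen B) (cB : Convex ℝ B) (cK : IsCompact K) (KB : K ⊆ B)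
    (x₀ : E3) {g : E3 → ℝ} (sg : ContDiff ℝ (⊤ : ℕ∞) g) {e : ℝ} (he0 : 0 ≤ e) (he1 : e < 1)
    (hge : ∀ x ∈ B, ‖fderiv ℝ g x‖ ≤ e) {b1 b2 : ℝ} (hgb : ∀ x ∈ B, |ρ * g x| ≤ b1)
    (hTA : ∀ x ∈ B, ‖A x - A x₀ - fderiv ℝ A x₀ (x - x₀)‖ ≤ b2)
    (hOm : ∀ x ∈ B, x ∈ Ω ↔ 0 < -ρ * c1 * (x - x₀) 0 - ρ * d1 * (x - x₀) 1 - n3 * (x - x₀) 2 + g x)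
    {v : E3 → ℂ} (sv : ContDiffOn ℝ (⊤ : ℕ∞) v (Ω ∩ B)) (zv : ∀ x ∈ Ω ∩ B, x ∉ K → v x = 0)
    (ε : ℝ) (e0 : 0 < ε) (e1 : ε ≤ 1) :
    ENNReal.ofReal (h * (Theta0 + c * |n3|)) * (∫⁻ x in Ω ∩ B, ENNReal.ofReal (‖v x‖ ^ 2)) ≤
    (∫⁻ x in Ω ∩ B, ENNReal.ofReal (hs (MD (Afl A) h v x))) +
      ENNReal.ofReal ((b1 + b2) ^ 2 / ε + 2 * h * (ε + 8 * e)) * ∫⁻ x in Ω ∩ B, ENNReal.ofReal (‖v x‖ ^ 2) := by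
  have sφ := gph_smooth A c1 d1 x₀
  have sE : ContDiff ℝ (⊤ : ℕ∞) (fun x => Complex.exp (-(Complex.I * (gph A c1 d1 x₀ x / h : ℝ)))) := by
    have : ContDiff ℝ (⊤ : ℕ∞) (fun x => ((gph A c1 d1 x₀ x / h : ℝ) : ℂ)) :=
      Complex.ofRealCLM.contDiff.comp (sφ.div_const h)
    exact ((contDiff_const.mul this).neg).cexp
  have D : FD Ω B K (kap (QI c1 d1 n3 ρ hcd hnr) x₀ g) (QI c1 d1 n3 ρ hcd hnr) e
      (fun x => Complex.exp (-(Complex.I * (gph A c1 d1 x₀ x / h : ℝ))) * v x) := by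
    refine ⟨oΩ, oB, cB, cK, KB, kap_smooth _ _ sg, he1, ?_, ?_, sE.contDiffOn.mul sv, ?_⟩
    · intro x hx
      rw [kap_fderiv _ _ sg, add_sub_cancel_left, ContinuousLinearMap.norm_smulRight_apply]
      simpa using hge x hx
    · intro x hx
      rw [hOm x hx]
      have : (kap (QI c1 d1 n3 ρ hcd hnr) x₀ g x) 2 =
        -ρ * c1 * (x - x₀) 0 - ρ * d1 * (x - x₀) 1 - n3 * (x - x₀) 2 + g x := by
        rw [kap, PiLp.add_apply, QI_2]; simp
      rw [← this]; rfl
    · intro x hx hk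
      show _ * v x = 0
      rw [zv x hx hk, mul_zero]
  refine LLr hc h n3 ρ hh hm0 hm2 hρ hnr he0 D sφ sv (Afl A) (b1 + b2) ?_ ε e0 e1
  intro x hx
  have key : Afl A x - fderiv ℝ (gph A c1 d1 x₀) x - alph n3 ρ (kap (QI c1 d1 n3 ρ hcd hnr) x₀ g x) ∘L
      fderiv ℝ (kap (QI c1 d1 n3 ρ hcd hnr) x₀ g) x =
      (ρ * g x) • ((EuclideanSpace.proj 0 : E3 →L[ℝ] ℝ) ∘L ((QI c1 d1 n3 ρ hcd hnr).toContinuousLinearEquiv : E3 →L[ℝ] E3)) +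
      innerSL ℝ (A x - A x₀ - fderiv ℝ A x₀ (x - x₀)) := by
    ext w
    have k1 : (kap (QI c1 d1 n3 ρ hcd hnr) x₀ g x) 1 = -c1 * n3 * (x - x₀) 0 - d1 * n3 * (x - x₀) 1 + ρ * (x - x₀) 2 := by
      rw [kap, PiLp.add_apply, QI_1]; simp
    have k2 : (kap (QI c1 d1 n3 ρ hcd hnr) x₀ g x) 2 =
        -ρ * c1 * (x - x₀) 0 - ρ * d1 * (x - x₀) 1 - n3 * (x - x₀) 2 + g x := by
      rw [kap, PiLp.add_apply, QI_2]; simp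
    have k0 : (fderiv ℝ (kap (QI c1 d1 n3 ρ hcd hnr) x₀ g) x w) 0 = -d1 * w 0 + c1 * w 1 := by
      rw [kap_fderiv _ _ sg]
      show ((QI c1 d1 n3 ρ hcd hnr) w + fderiv ℝ g x w • EuclideanSpace.single (2 : Fin 3) (1:ℝ)) 0 = _
      rw [PiLp.add_apply, QI_0]; simp
    have L1 : (Afl A x - fderiv ℝ (gph A c1 d1 x₀) x - alph n3 ρ (kap (QI c1 d1 n3 ρ hcd hnr) x₀ g x) ∘L
      fderiv ℝ (kap (QI c1 d1 n3 ρ hcd hnr) x₀ g) x) w = inner ℝ (A x) w - fderiv ℝ (gph A c1 d1 x₀) x w -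
      (-(n3 * (kap (QI c1 d1 n3 ρ hcd hnr) x₀ g x) 1 + ρ * (kap (QI c1 d1 n3 ρ hcd hnr) x₀ g x) 2)) *
      (fderiv ℝ (kap (QI c1 d1 n3 ρ hcd hnr) x₀ g) x w) 0 := rfl
    have R1 : ((ρ * g x) • ((EuclideanSpace.proj 0 : E3 →L[ℝ] ℝ) ∘L ((QI c1 d1 n3 ρ hcd hnr).toContinuousLinearEquiv : E3 →L[ℝ] E3)) +
      innerSL ℝ (A x - A x₀ - fderiv ℝ A x₀ (x - x₀))) w = (ρ * g x) * (QI c1 d1 n3 ρ hcd hnr w) 0 +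
      inner ℝ (A x - A x₀ - fderiv ℝ A x₀ (x - x₀)) w := rfl
    rw [L1, R1, k0, k1, k2, gph_fderiv hA hcurl c1 d1 hcd, QI_0, inner_sub_left, inner_sub_left]
    linear_combination (-(c1 * (x - x₀) 0 + d1 * (x - x₀) 1)) * (-d1 * w 0 + c1 * w 1) * hnr
  rw [key]
  refine (norm_add_le _ _).trans (add_le_add ?_ ?_)
  · rw [norm_smul]
    have : ‖(EuclideanSpace.proj 0 : E3 →L[ℝ] ℝ) ∘L ((QI c1 d1 n3 ρ hcd hnr).toContinuousLinearEquiv : E3 →L[ℝ] E3)‖ ≤ 1 := by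
      refine ContinuousLinearMap.opNorm_le_bound _ zero_le_one fun w => ?_
      rw [one_mul, ← (QI c1 d1 n3 ρ hcd hnr).norm_map w]
      exact PiLp.norm_apply_le (QI c1 d1 n3 ρ hcd hnr w) 0
    calc _ ≤ ‖ρ * g x‖ * 1 := by gcongr
      _ ≤ b1 := by rw [mul_one]; exact hgb x hx.2
  · rw [innerSL_apply_norm]; exact hTA x hx.2

end MagAux

namespace MagAux

lemma taylor2 {V : Type*} [NormedAddCommGroup V] [NormedSpace ℝ V] {F : E3 → V} (hF : ContDiff ℝ (⊤ : ℕ∞) F) (R : ℝ) :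
    ∃ M > 0, ∀ x₀ ∈ Metric.closedBall (0 : E3) R, ∀ x ∈ Metric.closedBall (0 : E3) R,
      ‖fderiv ℝ F x - fderiv ℝ F x₀‖ ≤ M * ‖x - x₀‖ ∧
      ‖F x - F x₀ - fderiv ℝ F x₀ (x - x₀)‖ ≤ M * ‖x - x₀‖ ^ 2 := by
  have h1 : ContDiff ℝ (⊤ : ℕ∞) (fderiv ℝ F) := hF.fderiv_right (by simp)
  have h2 : Continuous (fderiv ℝ (fderiv ℝ F)) := h1.continuous_fderiv (by simp)
  obtain ⟨M, hM⟩ := (isCompact_closedBall (0 : E3) R).exists_bound_of_continuousOn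
    (f := fderiv ℝ (fderiv ℝ F)) h2.continuousOn
  have lip : ∀ x₀ ∈ Metric.closedBall (0 : E3) R, ∀ x ∈ Metric.closedBall (0 : E3) R,
      ‖fderiv ℝ F x - fderiv ℝ F x₀‖ ≤ (|M| + 1) * ‖x - x₀‖ := by
    intro x₀ h₀ x hx
    exact Convex.norm_image_sub_le_of_norm_fderiv_le (𝕜 := ℝ) (fun y _ => h1.differentiable (by simp) y)
      (fun y hy => (hM y hy).trans (by linarith [le_abs_self M])) (convex_closedBall _ _) h₀ hx
  refine ⟨|M| + 1, by positivity, fun x₀ h₀ x hx => ⟨lip x₀ h₀ x hx, ?_⟩⟩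
  have := Convex.norm_image_sub_le_of_norm_fderiv_le' (𝕜 := ℝ) (f := F) (φ := fderiv ℝ F x₀) (x := x₀) (y := x)
    (C := (|M| + 1) * ‖x - x₀‖) (s := Metric.closedBall (0 : E3) R ∩ Metric.closedBall x₀ ‖x - x₀‖)
    (fun y _ => hF.differentiable (by simp) y) ?_ ((convex_closedBall _ _).inter (convex_closedBall _ _))
    ⟨h₀, Metric.mem_closedBall_self (norm_nonneg _)⟩ ⟨hx, by rw [Metric.mem_closedBall, dist_eq_norm]⟩
  · calc _ ≤ _ := this
      _ = _ := by ring
  · intro y hy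
    refine (lip x₀ h₀ y hy.1).trans ?_
    have := hy.2
    rw [Metric.mem_closedBall, dist_eq_norm] at this
    gcongr

lemma loc_fin {Ω B : Set E3} (oΩ : IsOpen Ω) (oB : IsOpen B) {a : E3 → E3 →L[ℝ] ℝ} {h T C₁ C₂ : ℝ}
    (h0 : 0 < h) (hT : 0 ≤ T) (hC1 : 0 ≤ C₁) (hC2 : 0 ≤ C₂)
    {w : E3 → ℝ} (hw : ∀ x ∈ Ω ∩ B, w x ≤ T + C₁) {v : E3 → ℂ} (zv : ∀ x ∈ Ω, x ∉ B → v x = 0)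
    (H : ENNReal.ofReal (h * T) * (∫⁻ x in Ω ∩ B, ENNReal.ofReal (‖v x‖ ^ 2)) ≤
    (∫⁻ x in Ω ∩ B, ENNReal.ofReal (hs (MD a h v x))) +
      ENNReal.ofReal C₂ * ∫⁻ x in Ω ∩ B, ENNReal.ofReal (‖v x‖ ^ 2)) :
    (∫⁻ x in Ω, ENNReal.ofReal (h * w x) * ENNReal.ofReal (‖v x‖ ^ 2)) ≤
    (∫⁻ x in Ω, ENNReal.ofReal (hs (MD a h v x))) +
      ENNReal.ofReal (h * C₁ + C₂) * ∫⁻ x in Ω, ENNReal.ofReal (‖v x‖ ^ 2) := by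
  have hsub : Ω ∩ B ⊆ Ω := Set.inter_subset_left
  have e1 : (∫⁻ x in Ω, ENNReal.ofReal (h * w x) * ENNReal.ofReal (‖v x‖ ^ 2)) =
      ∫⁻ x in Ω ∩ B, ENNReal.ofReal (h * w x) * ENNReal.ofReal (‖v x‖ ^ 2) := by
    rw [← lintegral_indicator oΩ.measurableSet, ← lintegral_indicator (oΩ.inter oB).measurableSet]
    congr 1
    ext x
    by_cases h1 : x ∈ Ω
    · by_cases h2 : x ∈ B
      · rw [Set.indicator_of_mem h1, Set.indicator_of_mem (show x ∈ Ω ∩ B from ⟨h1, h2⟩)]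
      · rw [Set.indicator_of_mem h1, Set.indicator_of_notMem (fun q => h2 q.2), zv x h1 h2]; simp
    · rw [Set.indicator_of_notMem h1, Set.indicator_of_notMem (fun q => h1 q.1)]
  have m1 : MeasurableSet (Ω ∩ B) := (oΩ.inter oB).measurableSet
  rw [e1]
  calc (∫⁻ x in Ω ∩ B, ENNReal.ofReal (h * w x) * ENNReal.ofReal (‖v x‖ ^ 2)) ≤
        ∫⁻ x in Ω ∩ B, ENNReal.ofReal (h * T + h * C₁) * ENNReal.ofReal (‖v x‖ ^ 2) := by
        apply setLIntegral_mono' m1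
        intro x hx
        apply mul_le_mul_left
        apply ENNReal.ofReal_le_ofReal
        nlinarith [hw x hx]
    _ = ENNReal.ofReal (h * T) * (∫⁻ x in Ω ∩ B, ENNReal.ofReal (‖v x‖ ^ 2)) +
        ENNReal.ofReal (h * C₁) * (∫⁻ x in Ω ∩ B, ENNReal.ofReal (‖v x‖ ^ 2)) := by
        rw [lintegral_const_mul' _ _ ENNReal.ofReal_ne_top, ENNReal.ofReal_add (by positivity) (by positivity), add_mul]
    _ ≤ (∫⁻ x in Ω ∩ B, ENNReal.ofReal (hs (MD a h v x))) +
      ENNReal.ofReal C₂ * (∫⁻ x in Ω ∩ B, ENNReal.ofReal (‖v x‖ ^ 2)) +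
        ENNReal.ofReal (h * C₁) * (∫⁻ x in Ω ∩ B, ENNReal.ofReal (‖v x‖ ^ 2)) := by gcongr
    _ = (∫⁻ x in Ω ∩ B, ENNReal.ofReal (hs (MD a h v x))) +
      ENNReal.ofReal (h * C₁ + C₂) * (∫⁻ x in Ω ∩ B, ENNReal.ofReal (‖v x‖ ^ 2)) := by
        rw [ENNReal.ofReal_add (by positivity) (by positivity), add_mul, add_assoc]
        congr 1
        rw [add_comm]
    _ ≤ _ := by
        gcongr

structure Geo (Ω : Set E3) (A : E3 → E3) (f : E3 → ℝ) (n : E3 → E3) (Γ : Set E3) : Prop where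
  oΩ : IsOpen Ω
  bΩ : Bornology.IsBounded Ω
  sA : ContDiff ℝ (⊤ : ℕ∞) A
  cA : HasUnitCurl A
  sf : ContDiff ℝ (⊤ : ℕ∞) f
  hf : Ω = f ⁻¹' Set.Iio 0
  hg : ∀ x ∈ frontier Ω, gradient f x ≠ 0
  hn : ∀ x ∈ frontier Ω, n x = ‖gradient f x‖⁻¹ • gradient f x
  nΓ : Γ.Nonempty
  sΓ : Γ ⊆ frontier Ω
  lin : ∃ c > 0, ∀ x ∈ frontier Ω, c * Metric.infDist x Γ ≤ |n x 2|

lemma unit_param (N : E3) (hN : ‖N‖ = 1) : ∃ c d ρ : ℝ, c ^ 2 + d ^ 2 = 1 ∧ 0 ≤ ρ ∧ (N 2) ^ 2 + ρ ^ 2 = 1 ∧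
    ρ * c = N 0 ∧ ρ * d = N 1 := by
  have h1 : N 0 ^ 2 + N 1 ^ 2 + N 2 ^ 2 = 1 := by
    have := EuclideanSpace.norm_sq_eq N
    rw [hN, Fin.sum_univ_three] at this
    simp only [Real.norm_eq_abs, sq_abs] at this
    linarith
  have h2 : 0 ≤ N 0 ^ 2 + N 1 ^ 2 := by positivity
  set ρ := Real.sqrt (N 0 ^ 2 + N 1 ^ 2)
  have hρ : ρ ^ 2 = N 0 ^ 2 + N 1 ^ 2 := Real.sq_sqrt h2
  by_cases h0 : ρ = 0
  · rw [h0] at hρ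
    refine ⟨1, 0, 0, by norm_num, le_refl _, by nlinarith, ?_, ?_⟩
    · nlinarith [sq_nonneg (N 0), sq_nonneg (N 1)]
    · nlinarith [sq_nonneg (N 0), sq_nonneg (N 1)]
  · refine ⟨N 0 / ρ, N 1 / ρ, ρ, ?_, Real.sqrt_nonneg _, by linarith, by field_simp, by field_simp⟩
    rw [div_pow, div_pow, ← add_div, ← hρ, div_self (by positivity)]

end MagAux

namespace MagAux

lemma loc_int {c : ℝ} (hc : TwoD c) (hc0 : 0 < c) (hc1 : c ≤ 1) {A : E3 → E3} (hA : ContDiff ℝ (⊤ : ℕ∞) A)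
    (hcurl : HasUnitCurl A) {Ω : Set E3} (oΩ : IsOpen Ω) {s M R : ℝ} (s0 : 0 < s) (s1 : s ≤ 1)
    (hM0 : 0 < M)
    (hM : ∀ x₀ ∈ Metric.closedBall (0 : E3) R, ∀ x ∈ Metric.closedBall (0 : E3) R,
      ‖A x - A x₀ - fderiv ℝ A x₀ (x - x₀)‖ ≤ M * ‖x - x₀‖ ^ 2) (y : E3)
    (hB : Metric.ball y (2 * s ^ 3) ⊆ Ω) (hBR : Metric.ball y (2 * s ^ 3) ⊆ Metric.closedBall (0 : E3) R)
    {v : E3 → ℂ} (sv : ContDiffOn ℝ (⊤ : ℕ∞) v Ω) (zv : ∀ x ∈ Ω, x ∉ Metric.closedBall y (s ^ 3) → v x = 0)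
    {w : E3 → ℝ} (hw : ∀ x ∈ Ω, w x ≤ Theta0 + c) :
    (∫⁻ x in Ω, ENNReal.ofReal (s ^ 8 * w x) * ENNReal.ofReal (‖v x‖ ^ 2)) ≤
    (∫⁻ x in Ω, ENNReal.ofReal (hs (MD (Afl A) (s ^ 8) v x))) +
      ENNReal.ofReal ((16 * M ^ 2 + 2) * s ^ 10) * ∫⁻ x in Ω, ENNReal.ofReal (‖v x‖ ^ 2) := by
  have hKB : Metric.closedBall y (s ^ 3) ⊆ Metric.ball y (2 * s ^ 3) :=
    Metric.closedBall_subset_ball (by linarith [pow_pos s0 3])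
  have hs3 := pow_pos s0 3
  have T0 := theta0_nonneg
  have T1 := theta0_lt_one
  have H := LG hc hA hcurl (s ^ 8) 1 0 1 0 (by positivity) (by rw [abs_one]; linarith) (by rw [abs_one]; linarith)
    le_rfl (by norm_num) (by norm_num) oΩ (Metric.isOpen_ball (x := y) (ε := 2 * s ^ 3)) (convex_ball _ _)
    (isCompact_closedBall y (s ^ 3)) hKB y (g := fun _ => 3 * s ^ 3) contDiff_const (e := 0) le_rfl one_pos
    (by intro x _; simp) (b1 := 0) (b2 := M * (2 * s ^ 3) ^ 2) (by intro x _; simp) ?_ ?_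
    (sv.mono Set.inter_subset_left) (fun x hx hk => zv x hx.1 hk) (s ^ 2) (by positivity) (pow_le_one₀ s0.le s1)
  · rw [abs_one, mul_one] at H
    have e1 : (0 + M * (2 * s ^ 3) ^ 2) ^ 2 / s ^ 2 + 2 * s ^ 8 * (s ^ 2 + 8 * 0) = (16 * M ^ 2 + 2) * s ^ 10 := by
      field_simp; ring
    rw [e1] at H
    have F := loc_fin oΩ Metric.isOpen_ball (C₁ := 0) (by positivity) (by linarith) le_rfl (by positivity)
      (w := w) (fun x hx => by linarith [hw x hx.1]) (fun x hx hk => zv x hx (fun q => hk (hKB q))) H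
    rwa [mul_zero, zero_add] at F
  · intro x hx
    have y0 : y ∈ Metric.ball y (2 * s ^ 3) := Metric.mem_ball_self (by positivity)
    refine (hM y (hBR y0) x (hBR hx)).trans ?_
    rw [Metric.mem_ball, dist_eq_norm] at hx
    gcongr
  · intro x hx
    refine iff_of_true (hB hx) ?_
    rw [Metric.mem_ball, dist_eq_norm] at hx
    have := PiLp.norm_apply_le (x - y) 2
    rw [Real.norm_eq_abs] at this
    have := le_abs_self ((x - y) 2)
    simp only [zero_mul, neg_zero, sub_zero, zero_sub, one_mul]
    linarith

lemma loc_bdy {c : ℝ} (hc : TwoD c) (hc0 : 0 < c) (hc1 : c ≤ 1) {Ω : Set E3} {A : E3 → E3} {f : E3 → ℝ}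
    {n : E3 → E3} {Γ : Set E3} (Gg : Geo Ω A f n Γ) {s M Mf R gm c' : ℝ} (s0 : 0 < s) (s1 : s ≤ 1)
    (hM0 : 0 < M) (hMf0 : 0 < Mf) (hgm : 0 < gm) (hc' : 0 < c')
    (hM : ∀ x₀ ∈ Metric.closedBall (0 : E3) R, ∀ x ∈ Metric.closedBall (0 : E3) R,
      ‖A x - A x₀ - fderiv ℝ A x₀ (x - x₀)‖ ≤ M * ‖x - x₀‖ ^ 2)
    (hMf : ∀ x₀ ∈ Metric.closedBall (0 : E3) R, ∀ x ∈ Metric.closedBall (0 : E3) R,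
      ‖fderiv ℝ f x - fderiv ℝ f x₀‖ ≤ Mf * ‖x - x₀‖ ∧
      ‖f x - f x₀ - fderiv ℝ f x₀ (x - x₀)‖ ≤ Mf * ‖x - x₀‖ ^ 2)
    (hgmin : ∀ x ∈ frontier Ω, gm ≤ ‖gradient f x‖)
    (hlin : ∀ x ∈ frontier Ω, c' * Metric.infDist x Γ ≤ c * |n x 2|)
    (hsm : Mf * (4 * s ^ 3) / gm < 1) (y x₀ : E3) (hx₀ : x₀ ∈ frontier Ω) (hx₀B : x₀ ∈ Metric.ball y (2 * s ^ 3))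
    (hBR : Metric.ball y (2 * s ^ 3) ⊆ Metric.closedBall (0 : E3) R)
    {v : E3 → ℂ} (sv : ContDiffOn ℝ (⊤ : ℕ∞) v Ω) (zv : ∀ x ∈ Ω, x ∉ Metric.closedBall y (s ^ 3) → v x = 0) :
    (∫⁻ x in Ω, ENNReal.ofReal (s ^ 8 * (Theta0 + c' * Metric.infDist x Γ)) * ENNReal.ofReal (‖v x‖ ^ 2)) ≤
    (∫⁻ x in Ω, ENNReal.ofReal (hs (MD (Afl A) (s ^ 8) v x))) +
      ENNReal.ofReal ((4 * c' + 256 * (Mf / gm + M) ^ 2 + 2 + 64 * (Mf / gm)) * s ^ 10) *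
        ∫⁻ x in Ω, ENNReal.ofReal (‖v x‖ ^ 2) := by
  have hKB : Metric.closedBall y (s ^ 3) ⊆ Metric.ball y (2 * s ^ 3) :=
    Metric.closedBall_subset_ball (by linarith [pow_pos s0 3])
  have hs3 := pow_pos s0 3
  have T0 := theta0_nonneg
  have T1 := theta0_lt_one
  have hG := hgmin x₀ hx₀
  set G := ‖gradient f x₀‖ with hGdef
  have G0 : 0 < G := hgm.trans_le hG
  have hNx := Gg.hn x₀ hx₀
  set N := n x₀ with hNdef
  have hN1 : ‖N‖ = 1 := by
    rw [hNx, norm_smul, norm_inv, norm_norm, inv_mul_cancel₀ G0.ne']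
  have hN2 : |N 2| ≤ 1 := by
    have := PiLp.norm_apply_le N 2
    rwa [hN1] at this
  obtain ⟨c1, d1, ρ, hcd, hρ, hnr, hN0, hN1'⟩ := unit_param N hN1
  have hρ1 : ρ ≤ 1 := by nlinarith [sq_nonneg (N 2)]
  have hNf : ∀ w, inner ℝ N w = G⁻¹ * fderiv ℝ f x₀ w := by
    intro w
    rw [hNx, ← hGdef, real_inner_smul_left, gradient, InnerProductSpace.toDual_symm_apply]
  have hf0 : f x₀ = 0 := by
    apply le_antisymm
    · have h1 : x₀ ∈ closure Ω := frontier_subset_closure hx₀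
      have h2 : closure Ω ⊆ f ⁻¹' Set.Iic 0 := by
        apply closure_minimal
        · rw [Gg.hf]
          intro z hz
          exact le_of_lt (show f z < 0 from hz)
        · exact isClosed_Iic.preimage Gg.sf.continuous
      exact h2 h1
    · by_contra hneg
      push Not at hneg
      have : x₀ ∈ Ω := by rw [Gg.hf]; exact hneg
      rw [Gg.oΩ.frontier_eq] at hx₀
      exact hx₀.2 this
  have hd : ∀ x ∈ Metric.ball y (2 * s ^ 3), ‖x - x₀‖ ≤ 4 * s ^ 3 := by
    intro x hx
    rw [← dist_eq_norm]
    have h1 := dist_triangle_right x x₀ y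
    rw [Metric.mem_ball] at hx hx₀B
    linarith
  obtain ⟨g, hg⟩ : ∃ g : E3 → ℝ, g = fun x => inner ℝ N (x - x₀) - G⁻¹ * f x := ⟨_, rfl⟩
  have sx : ContDiff ℝ (⊤ : ℕ∞) (fun x : E3 => x - x₀) := contDiff_id.sub contDiff_const
  have sg : ContDiff ℝ (⊤ : ℕ∞) g := by
    rw [hg]
    exact (contDiff_const.inner ℝ sx).sub (contDiff_const.mul Gg.sf)
  have hgd : ∀ x, fderiv ℝ g x = -(G⁻¹ • (fderiv ℝ f x - fderiv ℝ f x₀)) := by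
    intro x
    have h1 : HasFDerivAt (fun x : E3 => x - x₀) (ContinuousLinearMap.id ℝ E3) x := (hasFDerivAt_id x).sub_const x₀
    have h2 : HasFDerivAt (fun x : E3 => inner ℝ N (x - x₀)) (innerSL ℝ N) x := by
      have q : HasFDerivAt (fun x : E3 => innerSL ℝ N x) (innerSL ℝ N) (x - x₀) := (innerSL ℝ N).hasFDerivAt
      exact q.comp x h1
    have h3 := h2.sub ((Gg.sf.differentiable (by simp) x).hasFDerivAt.const_mul G⁻¹)
    have h4 : fderiv ℝ g x = (innerSL ℝ) N - G⁻¹ • fderiv ℝ f x := by rw [hg]; exact h3.fderiv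
    rw [h4]
    ext w
    have := hNf w
    simp [this]
    ring
  have H := LG hc Gg.sA Gg.cA (s ^ 8) (N 2) ρ c1 d1 (by positivity) (by positivity) (by nlinarith [abs_nonneg (N 2)])
    hρ hnr hcd Gg.oΩ (Metric.isOpen_ball (x := y) (ε := 2 * s ^ 3)) (convex_ball _ _)
    (isCompact_closedBall y (s ^ 3)) hKB x₀ sg (e := Mf * (4 * s ^ 3) / gm) (by positivity) hsm
    ?_ (b1 := Mf * (4 * s ^ 3) ^ 2 / gm) (b2 := M * (4 * s ^ 3) ^ 2) ?_ ?_ ?_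
    (sv.mono Set.inter_subset_left) (fun x hx hk => zv x hx.1 hk) (s ^ 2) (by positivity) (pow_le_one₀ s0.le s1)
  · have e1 : (Mf * (4 * s ^ 3) ^ 2 / gm + M * (4 * s ^ 3) ^ 2) ^ 2 / s ^ 2 +
        2 * s ^ 8 * (s ^ 2 + 8 * (Mf * (4 * s ^ 3) / gm)) =
        (256 * (Mf / gm + M) ^ 2 + 2) * s ^ 10 + 64 * (Mf / gm) * s ^ 11 := by
      field_simp; ring
    rw [e1] at H
    have F := loc_fin Gg.oΩ Metric.isOpen_ball (C₁ := c' * (4 * s ^ 3)) (by positivity) (by positivity)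
      (by positivity) (by positivity)
      (w := fun x => Theta0 + c' * Metric.infDist x Γ) ?_ (fun x hx hk => zv x hx (fun q => hk (hKB q))) H
    · refine F.trans ?_
      gcongr
      have e2 : s ^ 8 * (c' * (4 * s ^ 3)) = 4 * c' * s ^ 11 := by ring
      rw [e2]
      have e3 : s ^ 11 ≤ s ^ 10 := pow_le_pow_of_le_one s0.le s1 (by norm_num)
      have e4 : 4 * c' * s ^ 11 ≤ 4 * c' * s ^ 10 := by gcongr
      have e5 : 64 * (Mf / gm) * s ^ 11 ≤ 64 * (Mf / gm) * s ^ 10 := by gcongr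
      linarith
    · intro x hx
      have h1 := hd x hx.2
      have h2 : Metric.infDist x Γ ≤ Metric.infDist x₀ Γ + dist x x₀ := Metric.infDist_le_infDist_add_dist
      rw [dist_eq_norm] at h2
      have h3 := hlin x₀ hx₀
      have h4 : c' * Metric.infDist x Γ ≤ c' * (Metric.infDist x₀ Γ + 4 * s ^ 3) := by
        gcongr; linarith
      show Theta0 + c' * Metric.infDist x Γ ≤ Theta0 + c * |N 2| + c' * (4 * s ^ 3)
      linarith
  · intro x hx
    rw [hgd, norm_neg, norm_smul, norm_inv, Real.norm_of_nonneg G0.le, ← div_eq_inv_mul]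
    have h1 := (hMf x₀ (hBR hx₀B) x (hBR hx)).1
    have h2 := hd x hx
    calc _ ≤ Mf * ‖x - x₀‖ / G := by gcongr
      _ ≤ _ := by gcongr
  · intro x hx
    have h1 := (hMf x₀ (hBR hx₀B) x (hBR hx)).2
    have h2 := hd x hx
    have h3 : g x = -((f x - f x₀ - fderiv ℝ f x₀ (x - x₀)) / G) := by
      rw [hg]
      show inner ℝ N (x - x₀) - G⁻¹ * f x = _
      rw [hNf, hf0]; field_simp; ring
    rw [abs_mul, abs_of_nonneg hρ, h3, abs_neg, abs_div, abs_of_pos G0, ← Real.norm_eq_abs]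
    calc _ ≤ 1 * (‖f x - f x₀ - fderiv ℝ f x₀ (x - x₀)‖ / G) := by gcongr
      _ ≤ Mf * ‖x - x₀‖ ^ 2 / G := by rw [one_mul]; gcongr
      _ ≤ _ := by gcongr
  · intro x hx
    refine (hM x₀ (hBR hx₀B) x (hBR hx)).trans ?_
    have h2 := hd x hx
    gcongr
  · intro x hx
    have h1 : -ρ * c1 * (x - x₀) 0 - ρ * d1 * (x - x₀) 1 - N 2 * (x - x₀) 2 + g x = -(G⁻¹ * f x) := by
      have : inner ℝ N (x - x₀) = N 0 * (x - x₀) 0 + N 1 * (x - x₀) 1 + N 2 * (x - x₀) 2 := by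
        rw [PiLp.inner_apply, Fin.sum_univ_three]; simp; ring
      rw [hg]
      show _ + (inner ℝ N (x - x₀) - G⁻¹ * f x) = _
      rw [this]
      linear_combination (-(x - x₀) 0) * hN0 - (x - x₀) 1 * hN1'
    rw [h1, Gg.hf]
    show f x < 0 ↔ _
    have : 0 < G⁻¹ := inv_pos.2 G0
    constructor
    · intro h; nlinarith
    · intro h
      by_contra h5
      push Not at h5
      nlinarith [mul_nonneg this.le h5]

lemma local_est {Ω : Set E3} {A : E3 → E3} {f : E3 → ℝ} {n : E3 → E3} {Γ : Set E3} (Gg : Geo Ω A f n Γ) :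
    ∃ c' > 0, ∃ C > 0, ∃ s₀ > 0, s₀ ≤ 1 ∧ ∀ s, 0 < s → s < s₀ → ∀ y : E3, ∀ v : E3 → ℂ,
      ContDiffOn ℝ (⊤ : ℕ∞) v Ω → (∀ x ∈ Ω, x ∉ Metric.closedBall y (s ^ 3) → v x = 0) →
    (∫⁻ x in Ω, ENNReal.ofReal (s ^ 8 * (Theta0 + c' * Metric.infDist x Γ)) * ENNReal.ofReal (‖v x‖ ^ 2)) ≤
    (∫⁻ x in Ω, ENNReal.ofReal (hs (MD (Afl A) (s ^ 8) v x))) +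
      ENNReal.ofReal (C * s ^ 10) * ∫⁻ x in Ω, ENNReal.ofReal (‖v x‖ ^ 2) := by
  obtain ⟨c, hc0, hc1, hc⟩ := two_d
  obtain ⟨c₀, hc₀, hlin⟩ := Gg.lin
  obtain ⟨R₀, hR₀⟩ := Gg.bΩ.closure.subset_closedBall (0 : E3)
  have cF : IsCompact (frontier Ω) := (Gg.bΩ.isCompact_closure).of_isClosed_subset isClosed_frontier frontier_subset_closure
  obtain ⟨γ, hγ⟩ := Gg.nΓ
  obtain ⟨xm, hxm, hmin⟩ : ∃ xm ∈ frontier Ω, IsMinOn (fun x => ‖gradient f x‖) (frontier Ω) xm := by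
    apply cF.exists_isMinOn ⟨γ, Gg.sΓ hγ⟩
    have : Continuous (gradient f) := by
      have h1 := Gg.sf.continuous_fderiv (by simp)
      exact (InnerProductSpace.toDual ℝ E3).symm.continuous.comp h1
    exact this.norm.continuousOn
  set gm := ‖gradient f xm‖ with hgmd
  have hgm : 0 < gm := norm_pos_iff.2 (Gg.hg xm hxm)
  obtain ⟨M, hM0, hM⟩ := taylor2 Gg.sA (R₀ + 4)
  obtain ⟨Mf, hMf0, hMf⟩ := taylor2 Gg.sf (R₀ + 4)
  have hR0 : 0 ≤ R₀ := by
    have := hR₀ (frontier_subset_closure hxm)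
    rw [Metric.mem_closedBall] at this
    exact dist_nonneg.trans this
  set c' := min (c * c₀) (c / (2 * R₀ + 1)) with hc'd
  have hc' : 0 < c' := lt_min (by positivity) (by positivity)
  set C₁ := 16 * M ^ 2 + 2
  set C₂ := 4 * c' + 256 * (Mf / gm + M) ^ 2 + 2 + 64 * (Mf / gm)
  have hC₁ : 0 < C₁ := by positivity
  have hC₂ : 0 < C₂ := by positivity
  refine ⟨c', hc', C₁ + C₂, by positivity, min 1 (gm / (4 * Mf)), lt_min one_pos (by positivity), min_le_left _ _, ?_⟩
  intro s s0 hs y v sv zv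
  have s1 : s ≤ 1 := (hs.trans_le (min_le_left _ _)).le
  have hs2 : s < gm / (4 * Mf) := hs.trans_le (min_le_right _ _)
  have s31 : s ^ 3 ≤ 1 := pow_le_one₀ s0.le s1
  have hs3 : s ^ 3 ≤ s := by
    calc s ^ 3 ≤ s ^ 1 := pow_le_pow_of_le_one s0.le s1 (by norm_num)
      _ = s := pow_one s
  have hsm : Mf * (4 * s ^ 3) / gm < 1 := by
    rw [div_lt_one hgm]
    rw [lt_div_iff₀ (by positivity)] at hs2
    nlinarith
  have s30 : 0 < s ^ 3 := by positivity
  have hdist : ∀ z ∈ closure Ω, z ∈ Metric.ball y (2 * s ^ 3) → Metric.ball y (2 * s ^ 3) ⊆ Metric.closedBall (0 : E3) (R₀ + 4) := by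
    intro z hz hzB x hx
    have h1 := hR₀ hz
    rw [Metric.mem_closedBall] at h1 ⊢
    rw [Metric.mem_ball] at hzB hx
    have h2 := dist_triangle x z 0
    have h3 := dist_triangle_right x z y
    linarith
  have mono : ∀ C', C' ≤ C₁ + C₂ → ENNReal.ofReal (C' * s ^ 10) * (∫⁻ x in Ω, ENNReal.ofReal (‖v x‖ ^ 2)) ≤
      ENNReal.ofReal ((C₁ + C₂) * s ^ 10) * ∫⁻ x in Ω, ENNReal.ofReal (‖v x‖ ^ 2) := by
    intro C' h; gcongr
  by_cases hF : (Metric.ball y (2 * s ^ 3) ∩ frontier Ω).Nonempty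
  · obtain ⟨x₀, hx₀B, hx₀⟩ := hF
    refine (loc_bdy hc hc0 hc1 Gg s0 s1 hM0 hMf0 hgm hc' (fun a ha b hb => (hM a ha b hb).2) hMf
      (fun x hx => hmin hx) ?_ hsm y x₀ hx₀ hx₀B (hdist x₀ (frontier_subset_closure hx₀) hx₀B) sv zv).trans ?_
    · intro x hx
      have h1 : c' ≤ c * c₀ := min_le_left _ _
      have h2 := hlin x hx
      calc c' * Metric.infDist x Γ ≤ c * c₀ * Metric.infDist x Γ := by
            apply mul_le_mul_of_nonneg_right h1 Metric.infDist_nonneg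
        _ = c * (c₀ * Metric.infDist x Γ) := by ring
        _ ≤ _ := by gcongr
    · exact add_le_add le_rfl (mono C₂ (by linarith))
  · by_cases hI : (Metric.ball y (2 * s ^ 3) ∩ Ω).Nonempty
    · have hsub : Metric.ball y (2 * s ^ 3) ⊆ Ω := by
        by_contra hns
        rw [Set.not_subset] at hns
        obtain ⟨z, hz, hzΩ⟩ := hns
        refine hF (((convex_ball y (2 * s ^ 3)).isPreconnected Ω (closure Ω)ᶜ Gg.oΩ isClosed_closure.isOpen_compl ?_ hI
          ?_).mono ?_)
        · intro q hq
          by_cases q1 : q ∈ Ω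
          · exact Or.inl q1
          · right
            intro q2
            exact hF ⟨q, hq, by rw [Gg.oΩ.frontier_eq]; exact ⟨q2, q1⟩⟩
        · refine ⟨z, hz, fun q2 => hF ⟨z, hz, by rw [Gg.oΩ.frontier_eq]; exact ⟨q2, hzΩ⟩⟩⟩
        · rintro q ⟨_, q1, q2⟩
          exact absurd (subset_closure q1) q2
      obtain ⟨z, hzB, hz⟩ := hI
      refine (loc_int hc hc0 hc1 Gg.sA Gg.cA Gg.oΩ s0 s1 hM0 (fun a ha b hb => (hM a ha b hb).2) y hsub
        (hdist z (subset_closure hz) hzB) sv zv ?_).trans (add_le_add le_rfl (mono C₁ (by linarith)))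
      intro x hx
      have h1 : Metric.infDist x Γ ≤ 2 * R₀ := by
        refine (Metric.infDist_le_dist_of_mem hγ).trans ?_
        have a1 := hR₀ (subset_closure hx)
        have a2 := hR₀ (frontier_subset_closure (Gg.sΓ hγ))
        rw [Metric.mem_closedBall] at a1 a2
        have a3 := dist_triangle_right x γ 0
        linarith
      have h2 : c' ≤ c / (2 * R₀ + 1) := min_le_right _ _
      have h3 : c' * Metric.infDist x Γ ≤ c := by
        calc c' * Metric.infDist x Γ ≤ c / (2 * R₀ + 1) * (2 * R₀ + 1) := by
              apply mul_le_mul h2 (by linarith) Metric.infDist_nonneg (by positivity)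
          _ = c := by field_simp
      linarith
    · have hv : ∀ x ∈ Ω, v x = 0 := by
        intro x hx
        apply zv x hx
        intro hk
        exact hI ⟨x, Metric.closedBall_subset_ball (by linarith) hk, hx⟩
      have : (∫⁻ x in Ω, ENNReal.ofReal (s ^ 8 * (Theta0 + c' * Metric.infDist x Γ)) * ENNReal.ofReal (‖v x‖ ^ 2)) = 0 := by
        rw [setLIntegral_congr_fun (g := fun _ => 0) Gg.oΩ.measurableSet]
        · simp
        · intro x hx
          simp [hv x hx]
      rw [this]; exact zero_le

end MagAux

namespace MagAux

structure Bmp (χ : E3 → ℝ) : Prop where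
  sm : ContDiff ℝ (⊤ : ℕ∞) χ
  cs : HasCompactSupport χ
  ev : ∀ x, χ (-x) = χ x
  z : ∀ x, 1 < ‖x‖ → χ x = 0
  o : χ 0 = 1

lemma exists_bmp : ∃ χ, Bmp χ := by
  let b : ContDiffBump (0 : E3) := ⟨1 / 2, 1, by norm_num, by norm_num⟩
  refine ⟨b, b.contDiff, b.hasCompactSupport, b.neg, ?_, ?_⟩
  · intro x hx
    apply b.zero_of_le_dist
    rw [dist_zero_right]; exact hx.le
  · apply b.one_of_mem_closedBall
    apply Metric.mem_closedBall_self
    exact b.rIn_pos.le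

lemma Bmp.d_neg {χ : E3 → ℝ} (H : Bmp χ) (x : E3) : fderiv ℝ χ (-x) = - fderiv ℝ χ x := by
  have h1 : (fun y => χ (-y)) = χ := funext H.ev
  have h2 : HasFDerivAt (fun y : E3 => -y) (-(ContinuousLinearMap.id ℝ E3)) x := (hasFDerivAt_id x).neg
  have h3 : HasFDerivAt (fun y => χ (-y)) (fderiv ℝ χ (-x) ∘L (-(ContinuousLinearMap.id ℝ E3))) x :=
    HasFDerivAt.comp (g := χ) x (H.sm.differentiable (by simp) (-x)).hasFDerivAt h2
  rw [h1] at h3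
  rw [h3.fderiv]
  ext w
  simp

def I0 (χ : E3 → ℝ) : ENNReal := ∫⁻ q, ENNReal.ofReal (χ q ^ 2)
def I1 (χ : E3 → ℝ) : ENNReal := ∫⁻ q, ENNReal.ofReal (‖fderiv ℝ χ q‖ ^ 2)

lemma lint_top {g : E3 → ℝ} (hg : Continuous g) (hc : HasCompactSupport g) : ∫⁻ q, ENNReal.ofReal (g q) ≠ ⊤ := by
  have h1 : Integrable g volume := hg.integrable_of_hasCompactSupport hc
  refine ne_top_of_le_ne_top ((hasFiniteIntegral_iff_norm _).1 h1.2).ne ?_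
  apply lintegral_mono
  intro q
  exact ENNReal.ofReal_le_ofReal (le_abs_self _)

lemma Bmp.I0_top {χ : E3 → ℝ} (H : Bmp χ) : I0 χ ≠ ⊤ := by
  have h1 : HasCompactSupport (fun q => χ q ^ 2) := H.cs.comp_left (g := fun t : ℝ => t ^ 2) (by simp)
  exact lint_top (g := fun q => χ q ^ 2) (H.sm.continuous.pow 2) h1

lemma Bmp.I1_top {χ : E3 → ℝ} (H : Bmp χ) : I1 χ ≠ ⊤ := by
  have h1 := H.sm.continuous_fderiv (by simp)
  have h2 : HasCompactSupport (fun q => ‖fderiv ℝ χ q‖ ^ 2) :=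
    (H.cs.fderiv (𝕜 := ℝ)).comp_left (g := fun t : E3 →L[ℝ] ℝ => ‖t‖ ^ 2) (by simp)
  exact lint_top (g := fun q => ‖fderiv ℝ χ q‖ ^ 2) (h1.norm.pow 2) h2

lemma Bmp.I0_pos {χ : E3 → ℝ} (H : Bmp χ) : I0 χ ≠ 0 := by
  intro h0
  have hc : Continuous fun q => ENNReal.ofReal (χ q ^ 2) := ENNReal.continuous_ofReal.comp (H.sm.continuous.pow 2)
  rw [I0, lintegral_eq_zero_iff hc.measurable] at h0
  have h1 := Continuous.ae_eq_iff_eq volume hc continuous_const |>.1 h0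
  have h2 := congrFun h1 0
  simp [H.o] at h2

lemma hs_par (t : ℝ) (L N : E3 →L[ℝ] ℂ) : hs (t • L + N) + hs (t • L - N) = 2 * (t ^ 2 * hs L + hs N) := by
  unfold hs
  rw [Finset.mul_sum, ← Finset.sum_add_distrib, ← Finset.sum_add_distrib, Finset.mul_sum]
  apply Finset.sum_congr rfl
  intro j _
  simp only [add_apply, sub_apply, smul_apply]
  have := parallelogram_law_with_norm ℝ (t • L (EuclideanSpace.single j 1)) (N (EuclideanSpace.single j 1))
  rw [norm_smul, Real.norm_eq_abs] at this
  have h2 := sq_abs t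
  nlinarith

lemma Bmp.avg {χ : E3 → ℝ} (H : Bmp χ) (L : E3 →L[ℝ] ℂ) (β : ℂ) (z : E3) :
    ∫⁻ k, ENNReal.ofReal (hs (χ (z - k) • L + β • (Complex.ofRealCLM ∘L fderiv ℝ χ (z - k)))) =
    ENNReal.ofReal (hs L) * I0 χ + ENNReal.ofReal (‖β‖ ^ 2) * I1 χ := by
  have hd := H.sm.continuous_fderiv (by simp)
  have hχ := H.sm.continuous
  have hcomp : Continuous fun q => Complex.ofRealCLM ∘L fderiv ℝ χ q := continuous_const.clm_comp hd
  set J := ∫⁻ k, ENNReal.ofReal (hs (χ k • L + β • (Complex.ofRealCLM ∘L fderiv ℝ χ k))) with hJ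
  have c1 : Continuous fun k => ENNReal.ofReal (hs (χ k • L + β • (Complex.ofRealCLM ∘L fderiv ℝ χ k))) :=
    ENNReal.continuous_ofReal.comp (hs_cont.comp ((hχ.smul continuous_const).add (hcomp.const_smul β)))
  rw [lintegral_sub_left_eq_self (μ := volume)
    (fun k => ENNReal.ofReal (hs (χ k • L + β • (Complex.ofRealCLM ∘L fderiv ℝ χ k)))) z, ← hJ]
  have J2 : J = ∫⁻ k, ENNReal.ofReal (hs (χ k • L - β • (Complex.ofRealCLM ∘L fderiv ℝ χ k))) := by
    rw [hJ, ← lintegral_neg_eq_self (μ := volume)]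
    apply lintegral_congr
    intro k
    rw [H.ev, H.d_neg]
    congr 2
    ext w
    simp
    ring
  have J3 : J + J = 2 * (ENNReal.ofReal (hs L) * I0 χ + ENNReal.ofReal (‖β‖ ^ 2) * I1 χ) := by
    conv_lhs => rw [J2]; rw [← J2]; enter [2]; rw [J2]
    rw [hJ, ← lintegral_add_left c1.measurable, I0, I1,
      ← lintegral_const_mul' _ _ ENNReal.ofReal_ne_top, ← lintegral_const_mul' _ _ ENNReal.ofReal_ne_top,
      ← lintegral_add_left, ← lintegral_const_mul' _ _ (by simp)]
    · apply lintegral_congr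
      intro k
      rw [← ENNReal.ofReal_add (hs_nonneg _) (hs_nonneg _), hs_par, ENNReal.ofReal_mul (by norm_num),
        ENNReal.ofReal_add (mul_nonneg (sq_nonneg _) (hs_nonneg _)) (hs_nonneg _), hs_smul, hs_ofReal,
        ← ENNReal.ofReal_mul (hs_nonneg _), ← ENNReal.ofReal_mul (by positivity), mul_comm (χ k ^ 2)]
      simp
    · exact (ENNReal.continuous_ofReal.comp (hχ.pow 2)).measurable.const_mul _
  rw [← two_mul] at J3
  exact (ENNReal.mul_right_inj (by simp) (by simp)).1 J3

end MagAux

namespace MagAux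

lemma Bmp.swap0 {χ : E3 → ℝ} (H : Bmp χ) (t : ℝ) (Ω : Set E3) {p : E3 → ENNReal}
    (hp : AEMeasurable p (volume.restrict Ω)) :
    ∫⁻ k, ∫⁻ x in Ω, ENNReal.ofReal (χ (t • x - k) ^ 2) * p x = I0 χ * ∫⁻ x in Ω, p x := by
  have hm : AEMeasurable (Function.uncurry fun (k x : E3) => ENNReal.ofReal (χ (t • x - k) ^ 2) * p x)
      (volume.prod (volume.restrict Ω)) := by
    have c1 : Continuous fun z : E3 × E3 => ENNReal.ofReal (χ (t • z.2 - z.1) ^ 2) :=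
      ENNReal.continuous_ofReal.comp ((H.sm.continuous.comp (by fun_prop)).pow 2)
    exact c1.measurable.aemeasurable.mul hp.comp_snd
  rw [lintegral_lintegral_swap hm, ← lintegral_const_mul' _ _ H.I0_top]
  apply lintegral_congr
  intro x
  have e1 : ∫⁻ k, ENNReal.ofReal (χ (t • x - k) ^ 2) * p x = (∫⁻ k, ENNReal.ofReal (χ (t • x - k) ^ 2)) * p x := by
    rw [lintegral_mul_const]
    have c1 : Continuous fun k : E3 => ENNReal.ofReal (χ (t • x - k) ^ 2) :=
      ENNReal.continuous_ofReal.comp ((H.sm.continuous.comp (by fun_prop)).pow 2)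
    exact c1.measurable
  rw [e1, lintegral_sub_left_eq_self (μ := volume) (fun k => ENNReal.ofReal (χ k ^ 2)) (t • x), I0]

lemma MD_contOn {Ω : Set E3} (oΩ : IsOpen Ω) {u : E3 → ℂ} (su : ContDiffOn ℝ (⊤ : ℕ∞) u Ω)
    {a : E3 → E3 →L[ℝ] ℝ} (ha : Continuous a) (h : ℝ) : ContinuousOn (MD a h u) Ω := by
  have h1 : ContinuousOn (fderiv ℝ u) Ω := su.continuousOn_fderiv_of_isOpen oΩ (by simp)
  have h2 : Continuous fun x => Complex.ofRealCLM ∘L a x := continuous_const.clm_comp ha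
  have q1 : ContinuousOn (fun x => (-(Complex.I * (h : ℂ))) • fderiv ℝ u x) Ω :=
    ContinuousOn.const_smul (M := ℂ) (α := E3 →L[ℝ] ℂ) h1 _
  have q2 : ContinuousOn (fun x => u x • (Complex.ofRealCLM ∘L a x)) Ω :=
    ContinuousOn.smul su.continuousOn h2.continuousOn
  exact ContinuousOn.sub q1 q2

lemma Bmp.swap1 {χ : E3 → ℝ} (H : Bmp χ) (t : ℝ) {Ω : Set E3} (oΩ : IsOpen Ω) {L : E3 → E3 →L[ℝ] ℂ} {β : E3 → ℂ}
    (hL : ContinuousOn L Ω) (hβ : ContinuousOn β Ω) :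
    ∫⁻ k, ∫⁻ x in Ω, ENNReal.ofReal (hs (χ (t • x - k) • L x + β x • (Complex.ofRealCLM ∘L fderiv ℝ χ (t • x - k)))) =
    I0 χ * (∫⁻ x in Ω, ENNReal.ofReal (hs (L x))) + I1 χ * ∫⁻ x in Ω, ENNReal.ofReal (‖β x‖ ^ 2) := by
  have hm : AEMeasurable (Function.uncurry fun (k x : E3) =>
      ENNReal.ofReal (hs (χ (t • x - k) • L x + β x • (Complex.ofRealCLM ∘L fderiv ℝ χ (t • x - k)))))
      (volume.prod (volume.restrict Ω)) := by
    have hr : (volume : Measure E3).prod (volume.restrict Ω) = (volume.prod volume).restrict (Set.univ ×ˢ Ω) := by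
      rw [← Measure.prod_restrict, Measure.restrict_univ]
    rw [hr]
    apply ContinuousOn.aemeasurable _ (MeasurableSet.univ.prod oΩ.measurableSet)
    have m2 : Set.MapsTo (Prod.snd : E3 × E3 → E3) (Set.univ ×ˢ Ω) Ω := fun z hz => hz.2
    have q1 : Continuous fun z : E3 × E3 => t • z.2 - z.1 := by fun_prop
    have a1 : ContinuousOn (fun z : E3 × E3 => χ (t • z.2 - z.1) • L z.2) (Set.univ ×ˢ Ω) :=
      (H.sm.continuous.comp q1).continuousOn.smul (hL.comp continuous_snd.continuousOn m2)
    have a2 : ContinuousOn (fun z : E3 × E3 => β z.2 • (Complex.ofRealCLM ∘L fderiv ℝ χ (t • z.2 - z.1))) (Set.univ ×ˢ Ω) := by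
      have hd := H.sm.continuous_fderiv (by simp)
      have b1 : Continuous fun z : E3 × E3 => Complex.ofRealCLM ∘L fderiv ℝ χ (t • z.2 - z.1) :=
        continuous_const.clm_comp (hd.comp q1)
      exact (hβ.comp continuous_snd.continuousOn m2).smul b1.continuousOn
    exact ENNReal.continuous_ofReal.comp_continuousOn (hs_cont.comp_continuousOn (a1.add a2))
  have mL : AEMeasurable (fun x => I0 χ * ENNReal.ofReal (hs (L x))) (volume.restrict Ω) :=
    ((ENNReal.continuous_ofReal.comp_continuousOn (hs_cont.comp_continuousOn hL)).aemeasurable oΩ.measurableSet).const_mul _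
  rw [lintegral_lintegral_swap hm, ← lintegral_const_mul' _ _ H.I0_top, ← lintegral_const_mul' _ _ H.I1_top,
    ← lintegral_add_left' mL]
  apply lintegral_congr
  intro x
  rw [H.avg, mul_comm, mul_comm (I1 χ)]

lemma MD_cut {Ω : Set E3} (oΩ : IsOpen Ω) {u : E3 → ℂ} (su : ContDiffOn ℝ (⊤ : ℕ∞) u Ω) {χ : E3 → ℝ} (H : Bmp χ)
    (a : E3 → E3 →L[ℝ] ℝ) (h t : ℝ) (k : E3) {x : E3} (hx : x ∈ Ω) :
    MD a h (fun x => χ (t • x - k) • u x) x = χ (t • x - k) • MD a h u x +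
      (-(Complex.I * h) * t * u x) • (Complex.ofRealCLM ∘L fderiv ℝ χ (t • x - k)) := by
  have hu : HasFDerivAt u (fderiv ℝ u x) x :=
    ((su.contDiffAt (oΩ.mem_nhds hx)).differentiableAt (by simp)).hasFDerivAt
  have hq : HasFDerivAt (fun x : E3 => t • x - k) (t • ContinuousLinearMap.id ℝ E3) x :=
    ((hasFDerivAt_id x).const_smul t).sub_const k
  have hc : HasFDerivAt (fun x => χ (t • x - k)) (fderiv ℝ χ (t • x - k) ∘L (t • ContinuousLinearMap.id ℝ E3)) x :=
    HasFDerivAt.comp (g := χ) x (H.sm.differentiable (by simp) _).hasFDerivAt hq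
  have h1 := (hc.smul hu).fderiv
  have h2 : fderiv ℝ (fun x => χ (t • x - k) • u x) x = _ := h1
  rw [MD, h2, MD]
  ext w
  simp
  ring

lemma star {Ω : Set E3} {A : E3 → E3} {f : E3 → ℝ} {n : E3 → E3} {Γ : Set E3} (Gg : Geo Ω A f n Γ) :
    ∃ c' > 0, ∃ C > 0, ∃ s₀ > 0, s₀ ≤ 1 ∧ ∀ s, 0 < s → s < s₀ → ∀ u : E3 → ℂ,
      ContDiffOn ℝ (⊤ : ℕ∞) u Ω → 
    (∫⁻ x in Ω, ENNReal.ofReal (s ^ 8 * (Theta0 + c' * Metric.infDist x Γ)) * ENNReal.ofReal (‖u x‖ ^ 2)) ≤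
    (∫⁻ x in Ω, ENNReal.ofReal (hs (MD (Afl A) (s ^ 8) u x))) +
      ENNReal.ofReal (C * s ^ 10) * ∫⁻ x in Ω, ENNReal.ofReal (‖u x‖ ^ 2) := by
  obtain ⟨c', hc', C, hC, s₀, hs₀, hs₁, loc⟩ := local_est Gg
  obtain ⟨χ, H⟩ := exists_bmp
  obtain ⟨C₁, hC₁⟩ : ∃ C₁ : ℝ, 0 ≤ C₁ ∧ I1 χ = ENNReal.ofReal C₁ * I0 χ := by
    refine ⟨(I1 χ / I0 χ).toReal, ENNReal.toReal_nonneg, ?_⟩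
    rw [ENNReal.ofReal_toReal (ENNReal.div_ne_top H.I1_top H.I0_pos), ENNReal.div_mul_cancel H.I0_pos H.I0_top]
  refine ⟨c', hc', C + C₁, by linarith [hC₁.1], s₀, hs₀, hs₁, ?_⟩
  intro s s0 hss u su
  set t := (s ^ 3)⁻¹
  have oΩ := Gg.oΩ
  have hAc : Continuous (Afl A) := (innerSL ℝ).continuous.comp Gg.sA.continuous
  have cu : AEMeasurable (fun x => ENNReal.ofReal (‖u x‖ ^ 2)) (volume.restrict Ω) :=
    (ENNReal.continuous_ofReal.comp_continuousOn (su.continuousOn.norm.pow 2)).aemeasurable oΩ.measurableSet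
  have cw : AEMeasurable (fun x => ENNReal.ofReal (s ^ 8 * (Theta0 + c' * Metric.infDist x Γ)) * ENNReal.ofReal (‖u x‖ ^ 2))
      (volume.restrict Ω) := by
    have : Continuous fun x => ENNReal.ofReal (s ^ 8 * (Theta0 + c' * Metric.infDist x Γ)) :=
      ENNReal.continuous_ofReal.comp (continuous_const.mul (continuous_const.add (continuous_const.mul
        (Metric.continuous_infDist_pt Γ))))
    exact this.measurable.aemeasurable.mul cu
  have each : ∀ k, (∫⁻ x in Ω, ENNReal.ofReal (χ (t • x - k) ^ 2) *
        (ENNReal.ofReal (s ^ 8 * (Theta0 + c' * Metric.infDist x Γ)) * ENNReal.ofReal (‖u x‖ ^ 2))) ≤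
      (∫⁻ x in Ω, ENNReal.ofReal (hs (χ (t • x - k) • MD (Afl A) (s ^ 8) u x +
        (-(Complex.I * (s ^ 8 : ℝ)) * t * u x) • (Complex.ofRealCLM ∘L fderiv ℝ χ (t • x - k))))) +
      ENNReal.ofReal (C * s ^ 10) * ∫⁻ x in Ω, ENNReal.ofReal (χ (t • x - k) ^ 2) * ENNReal.ofReal (‖u x‖ ^ 2) := by
    intro k
    have sχ : ContDiff ℝ (⊤ : ℕ∞) (fun x : E3 => χ (t • x - k)) :=
      H.sm.comp ((contDiff_id.const_smul t).sub contDiff_const)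
    have L1 := loc s s0 hss (s ^ 3 • k) (fun x => χ (t • x - k) • u x) (sχ.contDiffOn.smul su) ?_
    · have n1 : ∀ x, ENNReal.ofReal (‖χ (t • x - k) • u x‖ ^ 2) =
          ENNReal.ofReal (χ (t • x - k) ^ 2) * ENNReal.ofReal (‖u x‖ ^ 2) := by
        intro x
        rw [norm_smul, mul_pow, Real.norm_eq_abs, sq_abs, ENNReal.ofReal_mul (sq_nonneg _)]
      simp only [n1] at L1
      have e2 : (∫⁻ x in Ω, ENNReal.ofReal (hs (MD (Afl A) (s ^ 8) (fun x => χ (t • x - k) • u x) x))) =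
        ∫⁻ x in Ω, ENNReal.ofReal (hs (χ (t • x - k) • MD (Afl A) (s ^ 8) u x +
        (-(Complex.I * (s ^ 8 : ℝ)) * t * u x) • (Complex.ofRealCLM ∘L fderiv ℝ χ (t • x - k)))) := by
        apply setLIntegral_congr_fun oΩ.measurableSet
        intro x hx
        show ENNReal.ofReal (hs (MD (Afl A) (s ^ 8) (fun x => χ (t • x - k) • u x) x)) = _
        rw [MD_cut oΩ su H _ _ _ _ hx]
      rw [e2] at L1
      refine le_trans (le_of_eq ?_) L1
      apply lintegral_congr
      intro x
      ring
    · intro x _ hk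
      show χ (t • x - k) • u x = 0
      rw [H.z, zero_smul]
      rw [Metric.mem_closedBall, dist_eq_norm] at hk
      push Not at hk
      have s3 : 0 < s ^ 3 := by positivity
      have : t • x - k = t • (x - s ^ 3 • k) := by
        rw [smul_sub, smul_smul, inv_mul_cancel₀ s3.ne', one_smul]
      rw [this, norm_smul, Real.norm_of_nonneg (by positivity), ← div_eq_inv_mul, lt_div_iff₀ s3, one_mul]
      exact hk
  have big := lintegral_mono (μ := (volume : Measure E3)) each
  have cβ : ContinuousOn (fun x => -(Complex.I * (s ^ 8 : ℝ)) * t * u x) Ω := continuousOn_const.mul su.continuousOn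
  have mB : AEMeasurable fun k : E3 => ENNReal.ofReal (C * s ^ 10) *
      ∫⁻ x in Ω, ENNReal.ofReal (χ (t • x - k) ^ 2) * ENNReal.ofReal (‖u x‖ ^ 2) := by
    have hm : AEMeasurable (Function.uncurry fun (k x : E3) => ENNReal.ofReal (χ (t • x - k) ^ 2) * ENNReal.ofReal (‖u x‖ ^ 2))
        (volume.prod (volume.restrict Ω)) := by
      have c1 : Continuous fun z : E3 × E3 => ENNReal.ofReal (χ (t • z.2 - z.1) ^ 2) :=
        ENNReal.continuous_ofReal.comp ((H.sm.continuous.comp (by fun_prop)).pow 2)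
      exact c1.measurable.aemeasurable.mul cu.comp_snd
    exact hm.lintegral_prod_right'.const_mul _
  rw [H.swap0 t Ω cw, lintegral_add_right' _ mB, lintegral_const_mul' _ _ ENNReal.ofReal_ne_top, H.swap0 t Ω cu,
    H.swap1 t oΩ (MD_contOn oΩ su hAc _) cβ, hC₁.2] at big
  have nβ : ∀ x, ENNReal.ofReal (‖-(Complex.I * (s ^ 8 : ℝ)) * t * u x‖ ^ 2) =
      ENNReal.ofReal (s ^ 10) * ENNReal.ofReal (‖u x‖ ^ 2) := by
    intro x
    rw [← ENNReal.ofReal_mul (by positivity)]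
    congr 1
    rw [norm_mul, norm_mul, norm_neg, norm_mul, Complex.norm_I, Complex.norm_real, Complex.norm_real,
      Real.norm_of_nonneg (by positivity), Real.norm_of_nonneg (by positivity)]
    simp only [t]
    field_simp
  simp only [nβ] at big
  rw [lintegral_const_mul' _ _ ENNReal.ofReal_ne_top] at big
  rw [← ENNReal.mul_le_mul_iff_right H.I0_pos H.I0_top]
  refine big.trans (le_of_eq ?_)
  rw [add_mul, ENNReal.ofReal_add (by positivity) (mul_nonneg hC₁.1 (by positivity)),
    ENNReal.ofReal_mul hC₁.1]
  ring

end MagAux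

namespace MagAux

lemma moll (Γ : Set E3) {ε : ℝ} (hε : 0 < ε) : ∃ D : E3 → ℝ, ContDiff ℝ (⊤ : ℕ∞) D ∧
    (∀ x, |D x - Metric.infDist x Γ| ≤ ε) ∧ ∀ x, ‖fderiv ℝ D x‖ ≤ 1 := by
  let φ : ContDiffBump (0 : E3) := ⟨ε / 2, ε, by linarith, by linarith⟩
  let d : E3 → ℝ := fun x => Metric.infDist x Γ
  have hd : Continuous d := Metric.continuous_infDist_pt Γ
  have dl : ∀ x y, |d x - d y| ≤ dist x y := by
    intro x y
    have := (Metric.lipschitz_infDist_pt Γ).dist_le_mul x y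
    rwa [NNReal.coe_one, one_mul, Real.dist_eq] at this
  let D : E3 → ℝ := convolution (φ.normed volume) d (ContinuousLinearMap.lsmul ℝ ℝ) volume
  have hcs : HasCompactSupport (φ.normed (volume : Measure E3)) := φ.hasCompactSupport_normed
  have hcn : Continuous (φ.normed (volume : Measure E3)) := φ.continuous_normed
  refine ⟨D, ?_, ?_, ?_⟩
  · exact hcs.contDiff_convolution_left _ φ.contDiff_normed hd.locallyIntegrable
  · intro x
    rw [← Real.dist_eq]
    apply ContDiffBump.dist_normed_convolution_le hd.aestronglyMeasurable
    intro y hy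
    rw [Real.dist_eq]
    exact (dl y x).trans (le_of_lt (Metric.mem_ball.mp hy))
  · intro x
    have hl : LipschitzWith 1 D := by
      apply LipschitzWith.of_dist_le_mul
      intro x y
      have ex : ∀ z, Integrable fun t => φ.normed (volume : Measure E3) t * d (z - t) := by
        intro z
        apply Continuous.integrable_of_hasCompactSupport
        · exact hcn.mul (hd.comp (by fun_prop))
        · exact hcs.mul_right
      have e1 : D x - D y = ∫ t, φ.normed (volume : Measure E3) t * (d (x - t) - d (y - t)) := by
        simp only [mul_sub]
        rw [integral_sub (ex x) (ex y)]
        rfl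
      rw [Real.dist_eq, e1, NNReal.coe_one, one_mul, ← Real.norm_eq_abs]
      have i2 : Integrable (fun t => φ.normed (volume : Measure E3) t * dist x y) :=
        φ.integrable_normed.mul_const _
      refine (norm_integral_le_of_norm_le i2 (Eventually.of_forall fun t => ?_)).trans ?_
      · rw [norm_mul, Real.norm_of_nonneg (φ.nonneg_normed t)]
        apply mul_le_mul_of_nonneg_left _ (φ.nonneg_normed t)
        refine (dl _ _).trans (by simp)
      · rw [integral_mul_const, φ.integral_normed, one_mul]
    simpa using norm_fderiv_le_of_lipschitz ℝ hl (x₀ := x)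

lemma grad_bdd {Ω : Set E3} (oΩ : IsOpen Ω) (bΩ : Bornology.IsBounded Ω) {u : E3 → ℂ}
    (su : ContDiffOn ℝ (⊤ : ℕ∞) u (closure Ω)) : ∃ M, ∀ y ∈ Ω, ‖fderiv ℝ u y‖ ≤ M := by
  have key : ∃ M, ∀ y ∈ closure Ω, y ∈ Ω → ‖fderiv ℝ u y‖ ≤ M := by
    apply bΩ.isCompact_closure.induction_on (p := fun S => ∃ M, ∀ y ∈ S, y ∈ Ω → ‖fderiv ℝ u y‖ ≤ M)
    · exact ⟨0, by simp⟩
    · rintro s t hst ⟨M, hM⟩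
      exact ⟨M, fun y hy => hM y (hst hy)⟩
    · rintro s t ⟨M, hM⟩ ⟨N, hN⟩
      refine ⟨max M N, fun y hy hyΩ => ?_⟩
      rcases hy with hy | hy
      · exact (hM y hy hyΩ).trans (le_max_left _ _)
      · exact (hN y hy hyΩ).trans (le_max_right _ _)
    · intro x hx
      have h1 : ContDiffWithinAt ℝ (0 + 1) u (closure Ω) x := (su x hx).of_le (by simp)
      rw [contDiffWithinAt_succ_iff_hasFDerivWithinAt (by simp)] at h1
      obtain ⟨v, hv, -, f', hf', cf'⟩ := h1
      rw [Set.insert_eq_of_mem hx] at hv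
      have hxv : x ∈ v := mem_of_mem_nhdsWithin hx hv
      have c1 : ContinuousWithinAt f' v x := cf'.continuousWithinAt
      have c2 : ∀ᶠ y in 𝓝[v] x, ‖f' y‖ < ‖f' x‖ + 1 := c1.norm.eventually (gt_mem_nhds (by linarith))
      have c3 : ∀ᶠ y in 𝓝[closure Ω] x, ‖f' y‖ < ‖f' x‖ + 1 := by
        have : 𝓝[closure Ω] x ≤ 𝓝[v] x := nhdsWithin_le_of_mem hv
        exact this c2
      obtain ⟨W, oW, xW, hW⟩ := mem_nhdsWithin.mp hv
      refine ⟨_, Filter.inter_mem c3 (inter_mem_nhdsWithin _ (oW.mem_nhds xW)), ‖f' x‖ + 1, ?_⟩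
      rintro y ⟨hy1, hy2, hy3⟩ hyΩ
      have hvn : v ∈ 𝓝 y := by
        apply Filter.mem_of_superset ((oW.inter oΩ).mem_nhds ⟨hy3, hyΩ⟩)
        rintro z ⟨z1, z2⟩
        exact hW ⟨z1, subset_closure z2⟩
      have := ((hf' y (mem_of_mem_nhds hvn)).hasFDerivAt hvn).fderiv
      rw [this]
      exact le_of_lt hy1
  obtain ⟨M, hM⟩ := key
  exact ⟨M, fun y hy => hM y (subset_closure hy) hy⟩

lemma magD_eq (A : E3 → E3) (h : ℝ) (u : E3 → ℂ) (j : Fin 3) (x : E3) :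
    magD A h u j x = MD (Afl A) h u x (EuclideanSpace.single j 1) := by
  simp [magD, MD, Afl, EuclideanSpace.inner_single_right, mul_comm]

lemma int_of_bdd {F : Type*} [NormedAddCommGroup F] [SecondCountableTopology F] {Ω : Set E3} (oΩ : IsOpen Ω) (bΩ : Bornology.IsBounded Ω) {g : E3 → F}
    (hg : ContinuousOn g Ω) {M : ℝ} (hM : ∀ x ∈ Ω, ‖g x‖ ≤ M) : IntegrableOn g Ω := by
  have hm : volume Ω ≠ ⊤ := bΩ.measure_lt_top.ne
  exact IntegrableOn.of_bound bΩ.measure_lt_top (hg.aestronglyMeasurable oΩ.measurableSet) M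
    ((ae_restrict_iff' oΩ.measurableSet).mpr (Eventually.of_forall hM))

lemma MD_bdd {Ω : Set E3} (oΩ : IsOpen Ω) (bΩ : Bornology.IsBounded Ω) {u : E3 → ℂ}
    (su : ContDiffOn ℝ (⊤ : ℕ∞) u (closure Ω)) {A : E3 → E3} (hA : Continuous A) (h : ℝ) :
    ∃ M, ∀ y ∈ Ω, ∀ j, ‖MD (Afl A) h u y (EuclideanSpace.single j 1)‖ ≤ M := by
  obtain ⟨M1, h1⟩ := grad_bdd oΩ bΩ su
  obtain ⟨M2, h2⟩ := bΩ.isCompact_closure.exists_bound_of_continuousOn su.continuousOn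
  obtain ⟨M3, h3⟩ := bΩ.isCompact_closure.exists_bound_of_continuousOn hA.continuousOn
  refine ⟨|h| * M1 + M3 * M2, fun y hy j => ?_⟩
  have hs1 : ‖(EuclideanSpace.single j 1 : E3)‖ = 1 := by simp
  rw [← magD_eq, magD]
  refine (norm_sub_le _ _).trans (add_le_add ?_ ?_)
  · rw [norm_mul, norm_neg, norm_mul, Complex.norm_I, one_mul, Complex.norm_real, Real.norm_eq_abs]
    apply mul_le_mul_of_nonneg_left _ (abs_nonneg _)
    have := (fderiv ℝ u y).le_opNorm (EuclideanSpace.single j 1)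
    rw [hs1, mul_one] at this
    exact this.trans (h1 y hy)
  · rw [norm_mul, Complex.norm_real]
    have a1 := (PiLp.norm_apply_le (A y) j).trans (h3 y (subset_closure hy))
    exact mul_le_mul a1 (h2 y (subset_closure hy)) (norm_nonneg _) ((norm_nonneg _).trans a1)

end MagAux

namespace MagAux

lemma MD_exp {Ω : Set E3} (oΩ : IsOpen Ω) {u : E3 → ℂ} (su : ContDiffOn ℝ (⊤ : ℕ∞) u Ω) {Φ : E3 → ℝ}
    (sΦ : ContDiff ℝ (⊤ : ℕ∞) Φ) (a : E3 → E3 →L[ℝ] ℝ) (h t : ℝ) {x : E3} (hx : x ∈ Ω) (e : E3) :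
    MD a h (fun x => Real.exp (t * Φ x) • u x) x e = Real.exp (t * Φ x) * (MD a h u x e +
      t * (-(Complex.I * h) * u x * (fderiv ℝ Φ x e : ℝ))) := by
  have hu : HasFDerivAt u (fderiv ℝ u x) x :=
    ((su.contDiffAt (oΩ.mem_nhds hx)).differentiableAt (by simp)).hasFDerivAt
  have hq : HasFDerivAt Φ (fderiv ℝ Φ x) x := (sΦ.differentiable (by simp) x).hasFDerivAt
  have hc := (hq.const_mul t).exp
  have h1 := (hc.smul hu).fderiv
  have h2 : fderiv ℝ (fun x => Real.exp (t * Φ x) • u x) x = _ := h1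
  rw [MD, h2, MD]
  simp
  ring

lemma agmon_pt {Ω : Set E3} (oΩ : IsOpen Ω) {u : E3 → ℂ} (su : ContDiffOn ℝ (⊤ : ℕ∞) u Ω) {Φ : E3 → ℝ}
    (sΦ : ContDiff ℝ (⊤ : ℕ∞) Φ) (A : E3 → E3) (h : ℝ) {x : E3} (hx : x ∈ Ω) :
    (∑ j : Fin 3, magD A h u j x * starRingEnd ℂ (magD A h (fun x => Real.exp (2 * Φ x) • u x) j x)).re =
      hs (MD (Afl A) h (fun x => Real.exp (1 * Φ x) • u x) x) -
      h ^ 2 * ‖fderiv ℝ Φ x‖ ^ 2 * ‖Real.exp (1 * Φ x) • u x‖ ^ 2 := by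
  rw [hs, norm_dual_sq, Finset.mul_sum, Finset.sum_mul, ← Finset.sum_sub_distrib, Complex.re_sum]
  apply Finset.sum_congr rfl
  intro j _
  rw [magD_eq, magD_eq, MD_exp oΩ su sΦ _ _ _ hx, MD_exp oΩ su sΦ _ _ _ hx]
  generalize MD (Afl A) h u x (EuclideanSpace.single j 1) = X
  generalize fderiv ℝ Φ x (EuclideanSpace.single j 1) = d
  have e2 : Real.exp (2 * Φ x) = Real.exp (1 * Φ x) * Real.exp (1 * Φ x) := by
    rw [← Real.exp_add]; ring_nf
  rw [e2]
  generalize Real.exp (1 * Φ x) = g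
  generalize u x = v
  rw [← Complex.normSq_eq_norm_sq, ← Complex.normSq_eq_norm_sq, Complex.normSq_apply, Complex.normSq_apply]
  simp
  ring

set_option maxHeartbeats 1000000 in
lemma agmon_int {Ω : Set E3} (oΩ : IsOpen Ω) (bΩ : Bornology.IsBounded Ω) {A : E3 → E3} (hA : Continuous A)
    {h lam : ℝ} {u : E3 → ℂ} (E : IsMagEigenpair Ω ∅ A h lam u) {Φ : E3 → ℝ} (sΦ : ContDiff ℝ (⊤ : ℕ∞) Φ)
    {G : ℝ} (hG : ∀ x, ‖fderiv ℝ Φ x‖ ^ 2 ≤ G) :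
    IntegrableOn (fun x => hs (MD (Afl A) h (fun x => Real.exp (1 * Φ x) • u x) x)) Ω ∧
    ∫ x in Ω, hs (MD (Afl A) h (fun x => Real.exp (1 * Φ x) • u x) x) ≤
      (lam + h ^ 2 * G) * ∫ x in Ω, ‖Real.exp (1 * Φ x) • u x‖ ^ 2 := by
  obtain ⟨-, ⟨su, -⟩, eq⟩ := E
  have hex : ∀ t : ℝ, ContDiff ℝ (⊤ : ℕ∞) fun x => Real.exp (t * Φ x) := fun t =>
    (contDiff_const.mul sΦ).exp
  have sw : ∀ t : ℝ, ContDiffOn ℝ (⊤ : ℕ∞) (fun x => Real.exp (t * Φ x) • u x) (closure Ω) := fun t =>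
    (hex t).contDiffOn.smul su
  have hAc : Continuous (Afl A) := (innerSL ℝ).continuous.comp hA
  have suΩ := su.mono subset_closure
  have swΩ := fun t => (sw t).mono subset_closure
  have ev := eq _ ⟨sw 2, by simp⟩
  obtain ⟨M0, hM0⟩ := MD_bdd oΩ bΩ su hA h
  obtain ⟨M1, hM1⟩ := MD_bdd oΩ bΩ (sw 1) hA h
  obtain ⟨M2, hM2⟩ := MD_bdd oΩ bΩ (sw 2) hA h
  obtain ⟨N1, hN1⟩ := bΩ.isCompact_closure.exists_bound_of_continuousOn (sw 1).continuousOn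
  have i1 : IntegrableOn (fun x => hs (MD (Afl A) h (fun x => Real.exp (1 * Φ x) • u x) x)) Ω := by
    apply int_of_bdd oΩ bΩ (M := ∑ j : Fin 3, M1 ^ 2) (hs_cont.comp_continuousOn (MD_contOn oΩ (swΩ 1) hAc h))
    intro x hx
    show ‖hs (MD (Afl A) h (fun x => Real.exp (1 * Φ x) • u x) x)‖ ≤ _
    rw [Real.norm_of_nonneg (hs_nonneg _)]
    exact Finset.sum_le_sum fun j _ => pow_le_pow_left₀ (norm_nonneg _) (hM1 x hx j) 2
  have i2 : IntegrableOn (fun x => ‖Real.exp (1 * Φ x) • u x‖ ^ 2) Ω := by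
    apply int_of_bdd oΩ bΩ (M := N1 ^ 2) ((swΩ 1).continuousOn.norm.pow 2)
    intro x hx
    show ‖‖Real.exp (1 * Φ x) • u x‖ ^ 2‖ ≤ _
    rw [Real.norm_of_nonneg (by positivity)]
    exact pow_le_pow_left₀ (norm_nonneg _) (hN1 x (subset_closure hx)) 2
  have cj : ∀ (v : E3 → ℂ), ContDiffOn ℝ (⊤ : ℕ∞) v Ω → ∀ j : Fin 3, ContinuousOn (fun x => magD A h v j x) Ω := by
    intro v sv j
    simp only [magD_eq]
    exact (MD_contOn oΩ sv hAc h).clm_apply continuousOn_const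
  have i3 : IntegrableOn (fun x => ∑ j : Fin 3, magD A h u j x *
      starRingEnd ℂ (magD A h (fun x => Real.exp (2 * Φ x) • u x) j x)) Ω := by
    apply integrable_finsetSum
    intro j _
    apply int_of_bdd oΩ bΩ (M := M0 * M2)
    · exact (cj _ suΩ j).mul (Complex.continuous_conj.comp_continuousOn (cj _ (swΩ 2) j))
    · intro x hx
      rw [norm_mul, RCLike.norm_conj, magD_eq, magD_eq]
      have a := hM0 x hx j
      exact mul_le_mul a (hM2 x hx j) (norm_nonneg _) ((norm_nonneg _).trans a)
  refine ⟨i1, ?_⟩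
  have r1 : (magFormC Ω A h u fun x => Real.exp (2 * Φ x) • u x).re =
      ∫ x in Ω, (hs (MD (Afl A) h (fun x => Real.exp (1 * Φ x) • u x) x) -
      h ^ 2 * ‖fderiv ℝ Φ x‖ ^ 2 * ‖Real.exp (1 * Φ x) • u x‖ ^ 2) := by
    rw [magFormC]
    have := integral_re i3
    simp only [RCLike.re_eq_complex_re] at this
    rw [← this]
    exact setIntegral_congr_fun oΩ.measurableSet fun x hx => agmon_pt oΩ suΩ sΦ A h hx
  have r2 : l2ipC Ω u (fun x => Real.exp (2 * Φ x) • u x) = ((∫ x in Ω, ‖Real.exp (1 * Φ x) • u x‖ ^ 2 : ℝ) : ℂ) := by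
    rw [l2ipC, ← integral_complex_ofReal]
    congr 1
    ext x
    have e2 : Real.exp (2 * Φ x) = Real.exp (1 * Φ x) * Real.exp (1 * Φ x) := by
      rw [← Real.exp_add]; ring_nf
    rw [e2, ← Complex.normSq_eq_norm_sq]
    simp only [Complex.real_smul, ← Complex.mul_conj, map_mul, Complex.conj_ofReal, Complex.ofReal_mul]
    ring
  rw [ev] at r1
  rw [r2, ← Complex.ofReal_mul, Complex.ofReal_re] at r1
  have i4 : IntegrableOn (fun x => h ^ 2 * G * ‖Real.exp (1 * Φ x) • u x‖ ^ 2) Ω := i2.const_mul _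
  have le : ∫ x in Ω, (hs (MD (Afl A) h (fun x => Real.exp (1 * Φ x) • u x) x) -
      h ^ 2 * G * ‖Real.exp (1 * Φ x) • u x‖ ^ 2) ≤ lam * ∫ x in Ω, ‖Real.exp (1 * Φ x) • u x‖ ^ 2 := by
    rw [r1]
    have i5 : IntegrableOn (fun x => h ^ 2 * ‖fderiv ℝ Φ x‖ ^ 2 * ‖Real.exp (1 * Φ x) • u x‖ ^ 2) Ω := by
      have cf : Continuous (fderiv ℝ Φ) := sΦ.continuous_fderiv (by simp)
      apply int_of_bdd oΩ bΩ (M := h ^ 2 * G * N1 ^ 2)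
      · intro x hx
        rw [Real.norm_of_nonneg (by positivity)]
        have := hG x
        have b : ‖Real.exp (1 * Φ x) • u x‖ ^ 2 ≤ N1 ^ 2 := pow_le_pow_left₀ (norm_nonneg _) (hN1 x (subset_closure hx)) 2
        have b0 : 0 ≤ G := le_trans (by positivity) this
        exact mul_le_mul (mul_le_mul_of_nonneg_left this (sq_nonneg _)) b (by positivity) (by positivity)
      · exact (continuous_const.mul (cf.norm.pow 2)).continuousOn.mul ((swΩ 1).continuousOn.norm.pow 2)
    apply integral_mono (i1.sub i4) (i1.sub i5)
    intro x
    have := hG x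
    have : h ^ 2 * ‖fderiv ℝ Φ x‖ ^ 2 * ‖Real.exp (1 * Φ x) • u x‖ ^ 2 ≤ h ^ 2 * G * ‖Real.exp (1 * Φ x) • u x‖ ^ 2 :=
      mul_le_mul_of_nonneg_right (mul_le_mul_of_nonneg_left this (sq_nonneg _)) (by positivity)
    exact sub_le_sub_left this _
  rw [integral_sub i1 i4, integral_const_mul] at le
  linarith

end MagAux

namespace MagAux

set_option maxHeartbeats 1000000 in
lemma agmon {Ω : Set E3} {A : E3 → E3} {f : E3 → ℝ} {n : E3 → E3} {Γ : Set E3} (Gg : Geo Ω A f n Γ) :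
    ∃ C > 0, ∃ s₀ > 0, s₀ ≤ 1 ∧ ∀ s, 0 < s → s < s₀ → ∀ (lam : ℝ) (u : E3 → ℂ),
      IsMagEigenpair Ω ∅ A (s ^ 8) lam u → lam ≤ Theta0 * s ^ 8 + s ^ 10 →
      IntegrableOn (fun x => Real.exp (2 * Metric.infDist x Γ / s ^ 2) * ‖u x‖ ^ 2) Ω ∧
      ∫ x in Ω, Real.exp (2 * Metric.infDist x Γ / s ^ 2) * ‖u x‖ ^ 2 ≤ C * l2sq Ω u := by
  obtain ⟨c', hc', C, hC, s₀, hs₀, hs₁, st⟩ := star Gg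
  have oΩ := Gg.oΩ
  have bΩ := Gg.bΩ
  obtain ⟨K, hK⟩ : ∃ K, K = C + 2 := ⟨_, rfl⟩
  have hK0 : 0 < K := by linarith
  obtain ⟨R, hR⟩ : ∃ R, R = 2 * K / c' := ⟨_, rfl⟩
  obtain ⟨Ec, hEc⟩ : ∃ Ec, Ec = Real.exp (2 * (R + 1)) := ⟨_, rfl⟩
  have hEc0 : 0 < Ec := hEc ▸ Real.exp_pos _
  refine ⟨Real.exp 2 * (2 * Ec), by positivity, s₀, hs₀, hs₁, ?_⟩
  intro s s0 hss lam u E hlam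
  have s2 : 0 < s ^ 2 := by positivity
  have s8 : 0 < s ^ 8 := by positivity
  obtain ⟨D, sD, hD, gD⟩ := moll Γ s2
  let Φ : E3 → ℝ := fun x => (s ^ 2)⁻¹ * D x
  have sΦ : ContDiff ℝ (⊤ : ℕ∞) Φ := contDiff_const.mul sD
  have gΦ : ∀ x, ‖fderiv ℝ Φ x‖ ^ 2 ≤ (s ^ 4)⁻¹ := by
    intro x
    have hq : HasFDerivAt D (fderiv ℝ D x) x := (sD.differentiable (by simp) x).hasFDerivAt
    have : fderiv ℝ Φ x = (s ^ 2)⁻¹ • fderiv ℝ D x := (hq.const_mul _).fderiv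
    rw [this, norm_smul, Real.norm_of_nonneg (by positivity), mul_pow]
    have e : ((s ^ 2)⁻¹) ^ 2 = (s ^ 4)⁻¹ := by rw [inv_pow]; ring_nf
    rw [e]
    have : ‖fderiv ℝ D x‖ ^ 2 ≤ 1 := pow_le_one₀ (norm_nonneg _) (gD x)
    exact mul_le_of_le_one_right (by positivity) this
  obtain ⟨i1, a1⟩ := agmon_int oΩ bΩ Gg.sA.continuous E sΦ gΦ
  obtain ⟨-, ⟨su, -⟩, -⟩ := E
  have sw : ContDiffOn ℝ (⊤ : ℕ∞) (fun x => Real.exp (1 * Φ x) • u x) (closure Ω) :=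
    (contDiff_const.mul sΦ).exp.contDiffOn.smul su
  have st1 := st s s0 hss (fun x => Real.exp (1 * Φ x) • u x) (sw.mono subset_closure)
  have nw : ∀ x, ‖Real.exp (1 * Φ x) • u x‖ ^ 2 = Real.exp (2 * D x / s ^ 2) * ‖u x‖ ^ 2 := by
    intro x
    rw [norm_smul, mul_pow, Real.norm_of_nonneg (Real.exp_nonneg _), ← Real.exp_nat_mul]
    congr 2
    simp only [Φ]
    push_cast
    field_simp
  have hd : Continuous fun x => Metric.infDist x Γ := Metric.continuous_infDist_pt Γ
  have intc : ∀ g : E3 → ℝ, ContinuousOn g (closure Ω) → IntegrableOn g Ω := by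
    intro g hg
    exact (hg.integrableOn_compact bΩ.isCompact_closure).mono_set subset_closure
  have iu : IntegrableOn (fun x => ‖u x‖ ^ 2) Ω := intc _ (su.continuousOn.norm.pow 2)
  have iw : IntegrableOn (fun x => ‖Real.exp (1 * Φ x) • u x‖ ^ 2) Ω := intc _ (sw.continuousOn.norm.pow 2)
  have idw : IntegrableOn (fun x => Metric.infDist x Γ * ‖Real.exp (1 * Φ x) • u x‖ ^ 2) Ω :=
    intc _ (hd.continuousOn.mul (sw.continuousOn.norm.pow 2))
  have ie : IntegrableOn (fun x => Real.exp (2 * Metric.infDist x Γ / s ^ 2) * ‖u x‖ ^ 2) Ω := by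
    apply intc
    have : Continuous fun x => Real.exp (2 * Metric.infDist x Γ / s ^ 2) :=
      Real.continuous_exp.comp ((continuous_const.mul hd).div_const _)
    exact this.continuousOn.mul (su.continuousOn.norm.pow 2)
  refine ⟨ie, ?_⟩
  obtain ⟨W, hW⟩ : ∃ W, W = ∫ x in Ω, ‖Real.exp (1 * Φ x) • u x‖ ^ 2 := ⟨_, rfl⟩
  obtain ⟨T, hT⟩ : ∃ T, T = ∫ x in Ω, Metric.infDist x Γ * ‖Real.exp (1 * Φ x) • u x‖ ^ 2 := ⟨_, rfl⟩
  obtain ⟨N, hN⟩ : ∃ N, N = ∫ x in Ω, ‖u x‖ ^ 2 := ⟨_, rfl⟩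
  have W0 : 0 ≤ W := by rw [hW]; exact integral_nonneg fun x => by positivity
  have b1 : s ^ 8 * Theta0 * W + s ^ 8 * c' * T ≤
      (∫ x in Ω, hs (MD (Afl A) (s ^ 8) (fun x => Real.exp (1 * Φ x) • u x) x)) + C * s ^ 10 * W := by
    have e1 : (∫⁻ x in Ω, ENNReal.ofReal (s ^ 8 * (Theta0 + c' * Metric.infDist x Γ)) *
        ENNReal.ofReal (‖Real.exp (1 * Φ x) • u x‖ ^ 2)) = ENNReal.ofReal (s ^ 8 * Theta0 * W + s ^ 8 * c' * T) := by
      rw [hW, hT, ← integral_const_mul, ← integral_const_mul, ← integral_add (iw.const_mul _) (idw.const_mul _)]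
      have ii : Integrable (fun a => s ^ 8 * Theta0 * ‖Real.exp (1 * Φ a) • u a‖ ^ 2 +
          s ^ 8 * c' * (Metric.infDist a Γ * ‖Real.exp (1 * Φ a) • u a‖ ^ 2)) (volume.restrict Ω) :=
        (iw.const_mul _).add (idw.const_mul _)
      rw [ofReal_integral_eq_lintegral_ofReal ii]
      · apply lintegral_congr
        intro x
        rw [← ENNReal.ofReal_mul]
        · congr 1
          ring
        · have := theta0_nonneg
          have := Metric.infDist_nonneg (x := x) (s := Γ)
          positivity
      · apply Eventually.of_forall
        intro x
        have := theta0_nonneg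
        have := Metric.infDist_nonneg (x := x) (s := Γ)
        simp only [Pi.zero_apply]
        positivity
    have e2 : (∫⁻ x in Ω, ENNReal.ofReal (hs (MD (Afl A) (s ^ 8) (fun x => Real.exp (1 * Φ x) • u x) x))) =
        ENNReal.ofReal (∫ x in Ω, hs (MD (Afl A) (s ^ 8) (fun x => Real.exp (1 * Φ x) • u x) x)) :=
      (ofReal_integral_eq_lintegral_ofReal i1 (Eventually.of_forall fun x => hs_nonneg _)).symm
    have e3 : (∫⁻ x in Ω, ENNReal.ofReal (‖Real.exp (1 * Φ x) • u x‖ ^ 2)) = ENNReal.ofReal W := by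
      rw [hW]
      exact (ofReal_integral_eq_lintegral_ofReal iw (Eventually.of_forall fun x => by positivity)).symm
    have h0 : 0 ≤ ∫ x in Ω, hs (MD (Afl A) (s ^ 8) (fun x => Real.exp (1 * Φ x) • u x) x) :=
      integral_nonneg fun x => hs_nonneg _
    rw [e1, e2, e3, ← ENNReal.ofReal_mul (by positivity), ← ENNReal.ofReal_add h0 (by positivity)] at st1
    exact (ENNReal.ofReal_le_ofReal_iff (by positivity)).mp st1
  rw [← hW] at a1
  have b2 : c' * T ≤ K * s ^ 2 * W := by
    have q1 : (s ^ 8) ^ 2 * (s ^ 4)⁻¹ ≤ s ^ 10 := by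
      have : (s ^ 8) ^ 2 * (s ^ 4)⁻¹ = s ^ 10 * s ^ 2 := by field_simp
      rw [this]
      exact mul_le_of_le_one_right (by positivity) (pow_le_one₀ s0.le (by linarith))
    have q2 : (lam + (s ^ 8) ^ 2 * (s ^ 4)⁻¹) * W ≤ (Theta0 * s ^ 8 + 2 * s ^ 10) * W :=
      mul_le_mul_of_nonneg_right (by linarith) W0
    have q3 : s ^ 8 * (c' * T) ≤ s ^ 8 * (K * s ^ 2 * W) := by
      rw [hK]
      nlinarith
    exact le_of_mul_le_mul_left q3 s8
  have b3 : 2 * K * s ^ 2 * W ≤ c' * T + 2 * K * s ^ 2 * Ec * N := by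
    rw [hW, hT, hN, ← integral_const_mul, ← integral_const_mul, ← integral_const_mul,
      ← integral_add (idw.const_mul _) (iu.const_mul _)]
    apply integral_mono (iw.const_mul _) ((idw.const_mul _).add (iu.const_mul _))
    intro x
    show 2 * K * s ^ 2 * ‖Real.exp (1 * Φ x) • u x‖ ^ 2 ≤ c' * (Metric.infDist x Γ * ‖Real.exp (1 * Φ x) • u x‖ ^ 2) +
      2 * K * s ^ 2 * Ec * ‖u x‖ ^ 2
    by_cases hx : R * s ^ 2 ≤ Metric.infDist x Γ
    · have h1 : 2 * K * s ^ 2 ≤ c' * Metric.infDist x Γ := by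
        have : c' * (R * s ^ 2) = 2 * K * s ^ 2 := by rw [hR]; field_simp
        rw [← this]
        exact mul_le_mul_of_nonneg_left hx hc'.le
      have h2 := mul_le_mul_of_nonneg_right h1 (sq_nonneg ‖Real.exp (1 * Φ x) • u x‖)
      have h3 : 0 ≤ 2 * K * s ^ 2 * Ec * ‖u x‖ ^ 2 := by positivity
      linarith
    · push Not at hx
      have h1 : ‖Real.exp (1 * Φ x) • u x‖ ^ 2 ≤ Ec * ‖u x‖ ^ 2 := by
        rw [nw, hEc]
        apply mul_le_mul_of_nonneg_right _ (by positivity)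
        apply Real.exp_le_exp.mpr
        rw [div_le_iff₀ s2]
        have := (abs_le.mp (hD x)).2
        nlinarith
      have h2 := mul_le_mul_of_nonneg_left h1 (show 0 ≤ 2 * K * s ^ 2 by positivity)
      have h3 : 0 ≤ c' * (Metric.infDist x Γ * ‖Real.exp (1 * Φ x) • u x‖ ^ 2) :=
        mul_nonneg hc'.le (mul_nonneg Metric.infDist_nonneg (sq_nonneg _))
      linarith
  have b4 : W ≤ 2 * Ec * N := by
    have q : K * s ^ 2 * W ≤ K * s ^ 2 * (2 * Ec * N) := by linarith
    exact le_of_mul_le_mul_left q (by positivity)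
  have b5 : ∫ x in Ω, Real.exp (2 * Metric.infDist x Γ / s ^ 2) * ‖u x‖ ^ 2 ≤ Real.exp 2 * W := by
    rw [hW, ← integral_const_mul]
    apply integral_mono ie (iw.const_mul _)
    intro x
    show Real.exp (2 * Metric.infDist x Γ / s ^ 2) * ‖u x‖ ^ 2 ≤ Real.exp 2 * ‖Real.exp (1 * Φ x) • u x‖ ^ 2
    rw [nw, ← mul_assoc, ← Real.exp_add]
    apply mul_le_mul_of_nonneg_right _ (by positivity)
    apply Real.exp_le_exp.mpr
    rw [div_le_iff₀ s2, add_mul, div_mul_cancel₀ _ s2.ne']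
    have := (abs_le.mp (hD x)).1
    linarith
  rw [l2sq, ← hN]
  have := mul_le_mul_of_nonneg_left b4 (Real.exp_pos 2).le
  linarith

end MagAux

/-- Rough localization of low-lying eigenfunctions near
`Γ = {x ∈ ∂Ω : e₃ · n(x) = 0}` at the scale `h^{1/4}`. -/
theorem statement1
    -- Ω is a smooth bounded connected open set
    (Ω : Set E3) (hΩo : IsOpen Ω) (hΩb : Bornology.IsBounded Ω) (hΩc : IsConnected Ω)
    (hΩsm : HasSmoothBoundary Ω)
    -- smooth vector potential with constant unit magnetic field e₃
    (A : E3 → E3) (hA : ContDiff ℝ (⊤ : ℕ∞) A) (hcurl : HasUnitCurl A)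
    -- outward unit normal
    (n : E3 → E3) (hn : IsOutwardNormal Ω n)
    -- Γ is the cancellation set of e₃ · n on ∂Ω
    (Γ : Set E3) (hΓ : Γ = {x ∈ frontier Ω | n x 2 = 0})
    -- Γ is a smooth closed curve (arc-length parametrized, of length 2L)
    (L : ℝ) (hL : 0 < L) (γc : ℝ → E3) (hγsm : ContDiff ℝ (⊤ : ℕ∞) γc)
    (hγper : Function.Periodic γc (2 * L)) (hγarc : ∀ s, ‖deriv γc s‖ = 1)
    (hγrange : Γ = Set.range γc) (hγinj : Set.InjOn γc (Set.Ico 0 (2 * L)))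
    -- e₃ · n vanishes linearly on Γ
    (hlin : VanishesLinearlyOn Ω Γ n)
    -- nearest-point projection on the boundary
    (p : E3 → E3)
    (hp : ∀ x ∈ Ω, p x ∈ frontier Ω ∧ dist x (p x) = Metric.infDist x (frontier Ω)) :
    ∃ δ₀ > (0:ℝ), ∃ C > (0:ℝ), ∃ α > (0:ℝ), ∃ h₀ > (0:ℝ),
      ∀ h ∈ Set.Ioo (0:ℝ) h₀, ∀ δ ∈ Set.Ioo (0:ℝ) δ₀, ∀ lam : ℝ, ∀ ψ : E3 → ℂ,
        IsMagEigenpair Ω ∅ A h lam ψ →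
        lam ≤ Theta0 * h + C * h ^ ((4:ℝ)/3) →
        (∫ x in {x ∈ Ω | Metric.infDist x (frontier Ω) < δ},
            Real.exp (2 * α * Metric.infDist (p x) Γ / h ^ ((1:ℝ)/4)) * ‖ψ x‖ ^ 2)
          ≤ C * l2sq Ω ψ := by
  have hΓne : Γ.Nonempty := by rw [hγrange]; exact Set.range_nonempty γc
  have hΓsub : Γ ⊆ frontier Ω := by rw [hΓ]; exact fun x hx => hx.1
  obtain ⟨f, sf, hf, hg, hnf⟩ := hn
  have Gg : MagAux.Geo Ω A f n Γ := ⟨hΩo, hΩb, hA, hcurl, sf, hf, hg, hnf, hΓne, hΓsub, hlin⟩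
  obtain ⟨C, hC, s₀, hs₀, hs₁, ag⟩ := MagAux.agmon Gg
  refine ⟨1, one_pos, C, hC, 1 / 2, by norm_num, min (s₀ ^ 8) ((1 / C) ^ 12),
    lt_min (by positivity) (by positivity), ?_⟩
  rintro h ⟨h0, hh⟩ δ - lam ψ E hlam
  have hh1 : h < s₀ ^ 8 := hh.trans_le (min_le_left _ _)
  have hh2 : h < (1 / C) ^ 12 := hh.trans_le (min_le_right _ _)
  obtain ⟨s, hs⟩ : ∃ s, s = h ^ ((1:ℝ) / 8) := ⟨_, rfl⟩
  have s0 : 0 < s := hs ▸ Real.rpow_pos_of_pos h0 _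
  have spow : ∀ k : ℕ, s ^ k = h ^ ((k : ℝ) / 8) := by
    intro k
    rw [hs, ← Real.rpow_natCast, ← Real.rpow_mul h0.le]
    congr 1
    ring
  have s8 : s ^ 8 = h := by
    rw [spow]; norm_num
  have s2 : s ^ 2 = h ^ ((1:ℝ) / 4) := by
    rw [spow]; norm_num
  have s10 : s ^ 10 = h ^ ((5:ℝ) / 4) := by
    rw [spow]; norm_num
  have hss : s < s₀ := by
    rw [← s8] at hh1
    exact lt_of_pow_lt_pow_left₀ 8 hs₀.le hh1
  have hlam' : lam ≤ Theta0 * s ^ 8 + s ^ 10 := by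
    refine hlam.trans ?_
    rw [s8, s10]
    have e : h ^ ((4:ℝ) / 3) = h ^ ((5:ℝ) / 4) * h ^ ((1:ℝ) / 12) := by
      rw [← Real.rpow_add h0]; norm_num
    have q : h ^ ((1:ℝ) / 12) ≤ 1 / C := by
      have q1 := Real.rpow_le_rpow h0.le hh2.le (show (0:ℝ) ≤ 1 / 12 by norm_num)
      have q2 : ((1 / C) ^ 12) ^ ((1:ℝ) / 12) = 1 / C := by
        rw [← Real.rpow_natCast, ← Real.rpow_mul (by positivity)]
        norm_num
      rwa [q2] at q1
    have q3 : C * h ^ ((1:ℝ) / 12) ≤ 1 := by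
      rw [le_div_iff₀ hC] at q
      linarith
    have q4 : 0 ≤ h ^ ((5:ℝ) / 4) := Real.rpow_nonneg h0.le _
    rw [e]
    nlinarith
  obtain ⟨ie, est⟩ := ag s s0 hss lam ψ (by rw [s8]; exact E) hlam'
  refine le_trans ?_ est
  have oδ : {x ∈ Ω | Metric.infDist x (frontier Ω) < δ} ⊆ Ω := fun x hx => hx.1
  have mδ : MeasurableSet {x ∈ Ω | Metric.infDist x (frontier Ω) < δ} :=
    (hΩo.inter (isOpen_lt (Metric.continuous_infDist_pt _) continuous_const)).measurableSet
  refine le_trans (integral_mono_of_nonneg (Eventually.of_forall fun x => by positivity) (ie.mono_set oδ) ?_)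
    (setIntegral_mono_set ie (Eventually.of_forall fun x => by positivity) (HasSubset.Subset.eventuallyLE oδ))
  refine (ae_restrict_iff' mδ).mpr (Eventually.of_forall fun x hx => ?_)
  apply mul_le_mul_of_nonneg_right _ (by positivity)
  apply Real.exp_le_exp.mpr
  rw [← s2]
  apply div_le_div_of_nonneg_right _ (by positivity)
  have d1 : Metric.infDist (p x) Γ ≤ Metric.infDist x Γ + dist (p x) x := Metric.infDist_le_infDist_add_dist
  have d2 : Metric.infDist x (frontier Ω) ≤ Metric.infDist x Γ :=
    Metric.infDist_le_infDist_of_subset hΓsub hΓne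
  have d3 := (hp x hx.1).2
  rw [dist_comm] at d1
  linarith
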